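/- Let φ and ψ be anisotropic quadratic forms of dimension ≥ 2 over F with ψ dominated by φ (ψ ≺ φ). If dim ψ > dim_Izh(φ), then φ and ψ are stably birationally equivalent; in particular dim_Izh(φ) = dim_Izh(ψ). -/

import Mathlib

/-!  Common framework: quadratic forms over a field of characteristic 2, presented by
coefficient matrices, together with the standard invariants used in the paper
"Rationality of cycles modulo 2 on products of generically smooth quadrics in
characteristic 2" by S. Scully and G. Zhu. -/

open scoped TensorProduct

/-- A quadratic form of dimension `n` over `F`, presented by an `n × n` coefficient
matrix `q`: the associated quadratic form is `x ↦ ∑ i j, q i j * x i * x j`. -/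
abbrev QF (F : Type) (n : ℕ) := Matrix (Fin n) (Fin n) F

namespace QF

section Basic

variable {F : Type} [Field F]

/-- The value of a quadratic form at a vector. -/
def eval {n : ℕ} (q : QF F n) (x : Fin n → F) : F := ∑ i, ∑ j, q i j * x i * x j

/-- The polar bilinear form of `q`. -/
def polar {n : ℕ} (q : QF F n) (x y : Fin n → F) : F :=
  eval q (x + y) - eval q x - eval q y

/-- `q` is isotropic: it vanishes at some nonzero vector. -/
def Isotropic {n : ℕ} (q : QF F n) : Prop := ∃ x, x ≠ 0 ∧ eval q x = 0

/-- `q` is anisotropic: it vanishes only at `0`. -/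
def Anisotropic {n : ℕ} (q : QF F n) : Prop := ∀ x, eval q x = 0 → x = 0

/-- The zero form `d ⬝ ⟨0⟩` of dimension `d`. -/
def zeroForm (d : ℕ) : QF F d := 0

/-- Isometry of quadratic forms. -/
def Isom {n m : ℕ} (q : QF F n) (q' : QF F m) : Prop :=
  ∃ e : (Fin n → F) ≃ₗ[F] (Fin m → F), ∀ x, eval q' (e x) = eval q x

/-- Orthogonal sum of quadratic forms. -/
def orthSum {n m : ℕ} (q : QF F n) (q' : QF F m) : QF F (n + m) :=
  Matrix.reindex finSumFinEquiv finSumFinEquiv (Matrix.fromBlocks q 0 0 q')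

/-- The binary quadratic form `[a, b] : (x, y) ↦ a x² + x y + b y²`. -/
def binary (a b : F) : QF F 2 := !![a, 1; 0, b]

/-- The orthogonal sum of the binary forms `[a i, b i]`, `i = 0, …, r - 1`. -/
def binSum {r : ℕ} (a b : Fin r → F) : QF F (r + r) :=
  Matrix.reindex finSumFinEquiv finSumFinEquiv
    (Matrix.fromBlocks (Matrix.diagonal a) 1 0 (Matrix.diagonal b))

/-- The split form `w ⬝ ℍ`, the orthogonal sum of `w` hyperbolic planes. -/
def hyper (w : ℕ) : QF F (w + w) := binSum 0 0

/-- The quasilinear (diagonal) quadratic form `⟨c 0, …, c (s - 1)⟩`. -/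
def diag {s : ℕ} (c : Fin s → F) : QF F s := Matrix.diagonal c

/-- `q` has type `(r, s)` with quasilinear part `⟨c⟩`, i.e.
`q ≃ [a 0, b 0] ⊥ ⋯ ⊥ [a (r-1), b (r-1)] ⊥ ⟨c⟩` for some `a b`. -/
def HasTypeWith {n : ℕ} (q : QF F n) (r s : ℕ) (c : Fin s → F) : Prop :=
  ∃ a b : Fin r → F, Isom q (orthSum (binSum a b) (diag c))

/-- `q` has type `(r, s)`. -/
def HasType {n : ℕ} (q : QF F n) (r s : ℕ) : Prop := ∃ c : Fin s → F, HasTypeWith q r s c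

/-- `q` is quasilinear, i.e. isometric to a diagonal form. -/
def IsQuasilinear {n : ℕ} (q : QF F n) : Prop := ∃ c : Fin n → F, Isom q (diag c)

/-- The isotropy index `i₀(q)`: the maximal dimension of a totally isotropic subspace. -/
noncomputable def i0 {n : ℕ} (q : QF F n) : ℕ :=
  sSup {d | ∃ W : Submodule F (Fin n → F), Module.finrank F W = d ∧ ∀ x ∈ W, eval q x = 0}

/-- The defect index `i_d(q)`: the maximal dimension of a totally isotropic subspace
contained in the radical of the polar form (equivalently, the isotropy index of the
quasilinear part of `q`, in characteristic 2). -/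
noncomputable def defect {n : ℕ} (q : QF F n) : ℕ :=
  sSup {d | ∃ W : Submodule F (Fin n → F), Module.finrank F W = d ∧
    (∀ x ∈ W, eval q x = 0) ∧ ∀ x ∈ W, ∀ y, polar q x y = 0}

/-- `q` is nondefective. -/
def Nondefective {n : ℕ} (q : QF F n) : Prop := defect q = 0

/-- The Witt index `i_W(q)`: the maximal number of hyperbolic planes splitting off `q`. -/
noncomputable def wittIndex {n : ℕ} (q : QF F n) : ℕ :=
  sSup {w | ∃ (m : ℕ) (q' : QF F m), Isom q (orthSum q' (hyper w))}

/-- `qa` is the anisotropic part of `q`: `qa` is anisotropic and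
`q ≃ qa ⊥ w ⬝ ℍ ⊥ d ⬝ ⟨0⟩` (Witt decomposition). -/
def IsAnisotropicPart {n m : ℕ} (q : QF F n) (qa : QF F m) : Prop :=
  Anisotropic qa ∧ ∃ w d : ℕ, Isom q (orthSum (orthSum qa (hyper w)) (zeroForm d))

/-- Witt equivalence: `q` and `q'` have isometric anisotropic parts. -/
def WittEquiv {n m : ℕ} (q : QF F n) (q' : QF F m) : Prop :=
  ∃ (k : ℕ) (qa : QF F k), IsAnisotropicPart q qa ∧ IsAnisotropicPart q' qa

/-- `p` is dominated by `q` (`p ≺ q`): `p` is isometric to the restriction of `q` to a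
subspace of the underlying space of `q`. -/
def Dominated {m n : ℕ} (p : QF F m) (q : QF F n) : Prop :=
  ∃ f : (Fin m → F) →ₗ[F] (Fin n → F), Function.Injective f ∧ ∀ x, eval q (f x) = eval p x

/-- `p` is a subform (orthogonal direct summand) of `q`. -/
def Subform {m n : ℕ} (p : QF F m) (q : QF F n) : Prop :=
  ∃ (k : ℕ) (p' : QF F k), Isom q (orthSum p p')

/-- Base change of a quadratic form along a field extension `K/F`. -/
def baseChange {n : ℕ} (q : QF F n) (K : Type) [Field K] [Algebra F K] : QF K n :=
  q.map (algebraMap F K)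

/-- Transport a quadratic form along an equality of dimensions. -/
def castQF {n m : ℕ} (h : n = m) (q : QF F n) : QF F m :=
  Matrix.reindex (finCongr h) (finCongr h) q

/-- The orthogonal sum of the first `h` members of a family of quadratic forms. -/
noncomputable def sumFam {D : ℕ → ℕ} (f : ∀ i, QF F (D i)) :
    (h : ℕ) → QF F (∑ i ∈ Finset.range h, D i)
  | 0 => castQF (by simp) (zeroForm 0)
  | h + 1 => castQF (Finset.sum_range_succ D h).symm (orthSum (sumFam f h) (f h))

/-- The Gram matrix of the `k`-fold bilinear Pfister form `⟪a 0, …, a (k-1)⟫_b`. -/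
noncomputable def bPfister {k : ℕ} (a : Fin k → F) :
    Matrix (Fin (2 ^ k)) (Fin (2 ^ k)) F :=
  Matrix.reindex finFunctionFinEquiv finFunctionFinEquiv
    (Matrix.diagonal fun f : Fin k → Fin 2 => ∏ i, if f i = 1 then a i else 1)

/-- The `(k+1)`-fold quadratic Pfister form `⟪a 0, …, a (k-1)⟫_b ⊗ [1, c]`. -/
noncomputable def qPfister {k : ℕ} (a : Fin k → F) (c : F) : QF F (2 ^ k * 2) :=
  Matrix.reindex finProdFinEquiv finProdFinEquiv
    (Matrix.kroneckerMap (· * ·) (bPfister a) (binary 1 c))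

/-- `π` is a `(k+1)`-fold quadratic Pfister form. -/
def IsPfister {m : ℕ} (k : ℕ) (π : QF F m) : Prop :=
  ∃ (a : Fin k → F) (c : F), Isom π (qPfister a c)

/-- `π` is a general `(k+1)`-fold Pfister form: a nonzero scalar multiple of a
`(k+1)`-fold quadratic Pfister form. -/
def IsGenPfister {m : ℕ} (k : ℕ) (π : QF F m) : Prop :=
  ∃ d : F, d ≠ 0 ∧ ∃ (a : Fin k → F) (c : F), Isom π (d • qPfister a c)

/-- `q` is a Pfister neighbour: `2 ^ k < dim q ≤ 2 ^ (k + 1)` and `q` is dominated by a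
general `(k+1)`-fold Pfister form (domination forces `dim q ≤ 2 ^ (k + 1)`). -/
def IsPfisterNeighbour {n : ℕ} (q : QF F n) : Prop :=
  ∃ (k : ℕ) (π : QF F (2 ^ k * 2)), 2 ^ k < n ∧ IsGenPfister k π ∧ Dominated q π

/-- `qc` is the complementary form of the Pfister neighbour `q` in its ambient general
Pfister form `π`: it is the nondefective form of dimension `2 ^ (k + 1) - dim q` which is
Witt equivalent to `q ⊥ π` (this pins down `qc` up to isometry). -/
def IsComplement {n k m : ℕ} (q : QF F n) (π : QF F (2 ^ k * 2)) (qc : QF F m) : Prop :=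
  m = 2 ^ k * 2 - n ∧ Nondefective qc ∧ WittEquiv (orthSum q π) qc

/-- `qc` is the complementary form of the Pfister neighbour `q`. -/
def IsComplementOf {n m : ℕ} (q : QF F n) (qc : QF F m) : Prop :=
  ∃ (k : ℕ) (π : QF F (2 ^ k * 2)), 2 ^ k < n ∧ IsGenPfister k π ∧ Dominated q π ∧
    IsComplement q π qc

/-- The polynomial of the quadric `{q = 0}` in the affine chart where the last
projective coordinate equals `1`. -/
noncomputable def affinePoly {n : ℕ} (q : QF F n) : MvPolynomial (Fin (n - 1)) F :=
  ∑ i : Fin n, ∑ j : Fin n,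
    MvPolynomial.C (q i j) *
      (if h : (i : ℕ) < n - 1 then MvPolynomial.X (⟨(i : ℕ), h⟩ : Fin (n - 1)) else 1) *
      (if h : (j : ℕ) < n - 1 then MvPolynomial.X (⟨(j : ℕ), h⟩ : Fin (n - 1)) else 1)

/-- `K` is a model of the function field `F(q)` of the projective quadric `{q = 0}`:
`K` is the fraction field of the affine coordinate ring of the (dense) standard affine
chart of the quadric. -/
def IsFunctionField {n : ℕ} (q : QF F n) (K : Type) [Field K] [Algebra F K] : Prop :=
  ∃ f : MvPolynomial (Fin (n - 1)) F →ₐ[F] K,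
    RingHom.ker f = Ideal.span {affinePoly q} ∧
    IntermediateField.adjoin F (Set.range fun i => f (MvPolynomial.X i)) = ⊤

end Basic

/-- A bundled field extension of `F`. -/
structure FieldExt (F : Type) [Field F] : Type 1 where
  carrier : Type
  [fieldInst : Field carrier]
  [algInst : Algebra F carrier]

attribute [instance] FieldExt.fieldInst FieldExt.algInst

/-- `K/F` is a separable field extension (MacLane's criterion: `K ⊗_F L` is reduced for
every purely inseparable extension `L/F`). -/
def IsSepExt (F : Type) [Field F] (K : Type) [Field K] [Algebra F K] : Prop :=
  ∀ (L : Type) [Field L] [Algebra F L], IsPurelyInseparable F L → IsReduced (K ⊗[F] L)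

/-- `K/F` is purely transcendental: `K` is generated over `F` by an algebraically
independent subset. -/
def IsPurelyTranscendentalExt (F : Type) [Field F] (K : Type) [Field K] [Algebra F K] :
    Prop :=
  ∃ s : Set K, AlgebraicIndependent F (fun x : s => (x : K)) ∧
    IntermediateField.adjoin F s = ⊤

section Invariants

variable {F : Type} [Field F]

/-- `p` and `q` are stably birationally equivalent: over every field extension of `F`,
`p` is isotropic if and only if `q` is (for anisotropic forms of dimension at least 2
this is equivalent to stable birationality of the associated projective quadrics). -/
def SBEquiv {m n : ℕ} (p : QF F m) (q : QF F n) : Prop :=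
  ∀ (K : Type) [Field K] [Algebra F K],
    (Isotropic (baseChange p K) ↔ Isotropic (baseChange q K))

/-- The first higher isotropy index `i₁(q)` of an anisotropic form: the minimal positive
isotropy index attained over field extensions of `F`. -/
noncomputable def i1 {n : ℕ} (q : QF F n) : ℕ :=
  sInf {i | 0 < i ∧ ∃ K : FieldExt F, i0 (baseChange q K.carrier) = i}

/-- The Izhboldin dimension `dim q - i₁(q)`. -/
noncomputable def izh {n : ℕ} (q : QF F n) : ℕ := n - i1 q

/-- The nondefective splitting pattern of a nondefective form `q`: the set of Witt
indices attained by `q` over separable field extensions of `F`. -/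
def splittingPattern {n : ℕ} (q : QF F n) : Set ℕ :=
  {w | ∃ K : FieldExt F, IsSepExt F K.carrier ∧ wittIndex (baseChange q K.carrier) = w}

/-- The nondefective height `h_nd(q)`. -/
noncomputable def hnd {n : ℕ} (q : QF F n) : ℕ := (splittingPattern q).ncard - 1

/-- `jrel q t = j_t(q)`: the `t`-th value (in increasing order) of the nondefective
splitting pattern of `q`. -/
noncomputable def jrel {n : ℕ} (q : QF F n) (t : ℕ) : ℕ :=
  sInf {w | w ∈ splittingPattern q ∧ {w' | w' ∈ splittingPattern q ∧ w' < w}.ncard = t}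

/-- `irel q t = i_t(q) = j_t(q) - j_(t-1)(q)`: the `t`-th higher Witt index of `q`. -/
noncomputable def irel {n : ℕ} (q : QF F n) (t : ℕ) : ℕ := jrel q t - jrel q (t - 1)

/-- `q` is a virtual Pfister neighbour: it becomes an anisotropic Pfister neighbour
over some field extension of `F`. -/
def IsVirtualPfisterNeighbour {n : ℕ} (q : QF F n) : Prop :=
  ∃ K : FieldExt F, Anisotropic (baseChange q K.carrier) ∧
    IsPfisterNeighbour (baseChange q K.carrier)

end Invariants

/-! ### The combinatorics of `Λ(X)` and the motivic decomposition type -/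

/-- Formal symbols `i_lo` and `iᵘᵖ` indexing the Tate motives of a split quadric. -/
inductive Sym : Type
  | lo : ℤ → Sym
  | up : ℤ → Sym
  deriving DecidableEq

/-- Shift of a symbol by `j`. -/
def Sym.shift (j : ℤ) : Sym → Sym
  | .lo i => .lo (i + j)
  | .up i => .up (i + j)

/-- The shift `Λ[j]` of a set of symbols. -/
def shiftSet (Λ : Set Sym) (j : ℤ) : Set Sym := Sym.shift j '' Λ

/-- The set `Λ(X)` for a quadric `X` of dimension `d` attached to a form of type
`(r, s)`: the symbols `i_lo` for `0 ≤ i < r` and `iᵘᵖ` for `d - r < i ≤ d`. -/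
def LamSet (r d : ℤ) : Set Sym :=
  {x | (∃ i : ℤ, x = Sym.lo i ∧ 0 ≤ i ∧ i < r) ∨ ∃ i : ℤ, x = Sym.up i ∧ d - r < i ∧ i ≤ d}

/-- `a(Λ) = m`: `m` is the least index `i` with `i_lo ∈ Λ`. -/
def IsALower (Λ : Set Sym) (m : ℤ) : Prop :=
  Sym.lo m ∈ Λ ∧ ∀ i : ℤ, Sym.lo i ∈ Λ → m ≤ i

/-- `b(Λ) = m`: `m` is the largest index `i` with `iᵘᵖ ∈ Λ`. -/
def IsBUpper (Λ : Set Sym) (m : ℤ) : Prop :=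
  Sym.up m ∈ Λ ∧ ∀ i : ℤ, Sym.up i ∈ Λ → i ≤ m

/-- The member of a partition `M` of `Λ(X)` containing `0_lo`: the upper connected
component `Λᵁ(X)`. -/
def upperComp (M : Set (Set Sym)) : Set Sym := ⋃₀ {Λ | Λ ∈ M ∧ Sym.lo 0 ∈ Λ}

/-- An abstract theory of `F`-rational algebraic cycles modulo 2 of middle dimension on
the squares of generically smooth nondefective quadrics, as constructed in §§4–7 of the
paper: `RatCyc K q` is the family of subsets `Λ ⊆ Λ(X_q)` whose associated cycle
`α_Λ = ∑_{λ ∈ Λ} α_λ` is an `F`-rational element of `Ch̄_{d_X}(X_q²)` (the image of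
`CH_{d_X}(X_q²)/2 → CH_{d_X}((X_q²)_F̄)/2`).  The formal properties recorded here are
those established in the paper: the family is an `𝔽₂`-subspace (closed under symmetric
difference), is closed under intersections, consists of subsets of `Λ(X_q)`, and
contains `Λ(X_q)` itself. -/
structure MDTTheory : Type 1 where
  RatCyc : ∀ (K : Type) [Field K] {n : ℕ} (q : QF K n), Set (Set Sym)
  inter_mem : ∀ (K : Type) [Field K] {n : ℕ} (q : QF K n),
    ∀ Λ₁ ∈ RatCyc K q, ∀ Λ₂ ∈ RatCyc K q, Λ₁ ∩ Λ₂ ∈ RatCyc K q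
  symmDiff_mem : ∀ (K : Type) [Field K] {n : ℕ} (q : QF K n),
    ∀ Λ₁ ∈ RatCyc K q, ∀ Λ₂ ∈ RatCyc K q, symmDiff Λ₁ Λ₂ ∈ RatCyc K q
  subset_lam : ∀ (K : Type) [Field K] {n : ℕ} (q : QF K n) (r s : ℕ),
    HasType q r s → ∀ Λ ∈ RatCyc K q, Λ ⊆ LamSet (r : ℤ) ((n : ℤ) - 2)
  lam_mem : ∀ (K : Type) [Field K] {n : ℕ} (q : QF K n) (r s : ℕ),
    HasType q r s → LamSet (r : ℤ) ((n : ℤ) - 2) ∈ RatCyc K q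

/-- The motivic decomposition type `MDT(q)`: the partition of `Λ(X_q)` into the supports
of the indecomposable rational cycles, i.e. the minimal nonempty members of the family
of rational subsets. -/
def MDTTheory.MDT (T : MDTTheory) (K : Type) [Field K] {n : ℕ} (q : QF K n) :
    Set (Set Sym) :=
  {Λ | Λ ∈ T.RatCyc K q ∧ Λ.Nonempty ∧
    ∀ Λ' ∈ T.RatCyc K q, Λ' ⊆ Λ → Λ' = ∅ ∨ Λ' = Λ}

end QF

namespace S3

section basics
variable {A : Type} [CommRing A] {n : ℕ}

/-- value of the quadratic form over a commutative ring -/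
def ev (q : Matrix (Fin n) (Fin n) A) (x : Fin n → A) : A := ∑ i, ∑ j, q i j * x i * x j

/-- the functional attached to a vector by the polar form -/
def bv (q : Matrix (Fin n) (Fin n) A) (x : Fin n → A) : Fin n → A :=
  fun j => ∑ i, (q i j + q j i) * x i

theorem bv_dot (q : Matrix (Fin n) (Fin n) A) (x y : Fin n → A) :
    bv q x ⬝ᵥ y = ∑ i, ∑ j, (q i j * x i * y j + q i j * y i * x j) := by
  simp only [dotProduct, bv, Finset.sum_mul, Finset.sum_add_distrib, add_mul]
  congr 1
  · rw [Finset.sum_comm]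
  · refine Finset.sum_congr rfl fun i _ => Finset.sum_congr rfl fun j _ => ?_
    ring

theorem ev_add (q : Matrix (Fin n) (Fin n) A) (x y : Fin n → A) :
    ev q (x + y) = ev q x + ev q y + bv q x ⬝ᵥ y := by
  rw [bv_dot]
  simp only [ev, ← Finset.sum_add_distrib]
  refine Finset.sum_congr rfl fun i _ => Finset.sum_congr rfl fun j _ => ?_
  simp only [Pi.add_apply]; ring

theorem ev_smul (q : Matrix (Fin n) (Fin n) A) (c : A) (x : Fin n → A) :
    ev q (c • x) = c ^ 2 * ev q x := by
  simp only [ev, Finset.mul_sum]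
  refine Finset.sum_congr rfl fun i _ => Finset.sum_congr rfl fun j _ => ?_
  simp only [Pi.smul_apply, smul_eq_mul]; ring

theorem ev_zero (q : Matrix (Fin n) (Fin n) A) : ev q 0 = 0 := by simp [ev]

theorem bv_add (q : Matrix (Fin n) (Fin n) A) (x y : Fin n → A) :
    bv q (x + y) = bv q x + bv q y := by
  funext j
  simp [bv, mul_add, Finset.sum_add_distrib]

theorem bv_smul (q : Matrix (Fin n) (Fin n) A) (c : A) (x : Fin n → A) :
    bv q (c • x) = c • bv q x := by
  funext j
  simp only [bv, Pi.smul_apply, smul_eq_mul, Finset.mul_sum]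
  refine Finset.sum_congr rfl fun i _ => ?_
  ring

theorem bv_zero (q : Matrix (Fin n) (Fin n) A) : bv q 0 = 0 := by
  funext j; simp [bv]

theorem bv_comm (q : Matrix (Fin n) (Fin n) A) (x y : Fin n → A) :
    bv q x ⬝ᵥ y = bv q y ⬝ᵥ x := by
  rw [bv_dot, bv_dot]
  refine Finset.sum_congr rfl fun i _ => Finset.sum_congr rfl fun j _ => ?_
  ring

theorem bv_self (q : Matrix (Fin n) (Fin n) A) (x : Fin n → A) :
    bv q x ⬝ᵥ x = 2 * ev q x := by
  rw [bv_dot]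
  simp only [ev, Finset.mul_sum]
  refine Finset.sum_congr rfl fun i _ => Finset.sum_congr rfl fun j _ => ?_
  ring

variable {K : Type} [CommRing K]

theorem ev_map (f : A →+* K) (q : Matrix (Fin n) (Fin n) A) (x : Fin n → A) :
    ev (q.map f) (f ∘ x) = f (ev q x) := by
  simp [ev, map_sum, Matrix.map_apply]

theorem bv_map (f : A →+* K) (q : Matrix (Fin n) (Fin n) A) (x : Fin n → A) :
    bv (q.map f) (f ∘ x) = f ∘ bv q x := by
  funext j
  simp [bv, map_sum, Matrix.map_apply]

theorem dot_map (f : A →+* K) (x y : Fin n → A) :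
    (f ∘ x) ⬝ᵥ (f ∘ y) = f (x ⬝ᵥ y) := by
  simp [dotProduct, map_sum]

theorem ev_sum (q : Matrix (Fin n) (Fin n) A) {ι : Type} (s : Finset ι) (v : ι → Fin n → A)
    (h0 : ∀ i ∈ s, ev q (v i) = 0) (h1 : ∀ i ∈ s, ∀ j ∈ s, bv q (v i) ⬝ᵥ v j = 0) :
    ev q (∑ i ∈ s, v i) = 0 := by
  classical
  induction s using Finset.induction_on with
  | empty => simp [ev_zero]
  | insert a s ha ih =>
    rw [Finset.sum_insert ha, ev_add, h0 a (by simp), ih (fun i hi => h0 i (by simp [hi]))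
      (fun i hi j hj => h1 i (by simp [hi]) j (by simp [hj])), dotProduct_sum]
    rw [Finset.sum_eq_zero (fun i hi => h1 a (by simp) i (by simp [hi]))]
    simp

/-- `x` satisfies the quadratic equation `q` and the linear equations `L` (coefficients via `f`) -/
def SolH (f : A →+* K) (q : Matrix (Fin n) (Fin n) A) (L : Set (Fin n → A)) (x : Fin n → K) :
    Prop := ev (q.map f) x = 0 ∧ ∀ l ∈ L, (f ∘ l) ⬝ᵥ x = 0

theorem SolH.smul {f : A →+* K} {q : Matrix (Fin n) (Fin n) A} {L : Set (Fin n → A)}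
    {x : Fin n → K} (h : SolH f q L x) (c : K) : SolH f q L (c • x) := by
  refine ⟨by rw [ev_smul, h.1, mul_zero], fun l hl => ?_⟩
  rw [dotProduct_smul, h.2 l hl, smul_zero]

theorem SolH.add {f : A →+* K} {q : Matrix (Fin n) (Fin n) A} {L : Set (Fin n → A)}
    {x y : Fin n → K} (h : SolH f q L x) (h' : SolH f q L y)
    (hb : bv (q.map f) x ⬝ᵥ y = 0) : SolH f q L (x + y) := by
  refine ⟨by rw [ev_add, h.1, h'.1, hb]; simp, fun l hl => ?_⟩
  rw [dotProduct_add, h.2 l hl, h'.2 l hl, add_zero]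

theorem SolH.zero {f : A →+* K} {q : Matrix (Fin n) (Fin n) A} {L : Set (Fin n → A)} :
    SolH f q L 0 := ⟨ev_zero _, by simp⟩

theorem SolH.map {K' : Type} [CommRing K'] {f : A →+* K} {q : Matrix (Fin n) (Fin n) A}
    {L : Set (Fin n → A)}
    {x : Fin n → K} (h : SolH f q L x) (g : K →+* K') : SolH (g.comp f) q L (g ∘ x) := by
  have hq : q.map (g.comp f) = (q.map f).map g := by
    ext i j; simp
  refine ⟨by rw [hq, ev_map, h.1, map_zero], fun l hl => ?_⟩
  have := dot_map g (f ∘ l) x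
  rw [h.2 l hl, map_zero] at this
  exact this

theorem SolH.of_map {K' : Type} [CommRing K'] {f : A →+* K} {q : Matrix (Fin n) (Fin n) A}
    {L : Set (Fin n → A)} {x : Fin n → K} (g : K →+* K') (hg : Function.Injective g)
    (h : SolH (g.comp f) q L (g ∘ x)) : SolH f q L x := by
  have hq : q.map (g.comp f) = (q.map f).map g := by
    ext i j; simp
  refine ⟨hg (by rw [← ev_map, ← hq, h.1, map_zero]), fun l hl => hg ?_⟩
  rw [← dot_map, map_zero]
  exact h.2 l hl

end basics

section iso
variable {A : Type} [CommRing A] {n : ℕ} {K : Type} [Field K]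

/-- there is an `r`-dimensional subspace of solutions -/
def Iso (f : A →+* K) (q : Matrix (Fin n) (Fin n) A) (L : Set (Fin n → A)) (r : ℕ) : Prop :=
  ∃ W : Submodule K (Fin n → K), r ≤ Module.finrank K W ∧ ∀ x ∈ W, SolH f q L x

theorem Iso.mono {f : A →+* K} {q : Matrix (Fin n) (Fin n) A} {L : Set (Fin n → A)} {r s : ℕ}
    (h : Iso f q L r) (hs : s ≤ r) : Iso f q L s := by
  obtain ⟨W, h1, h2⟩ := h
  exact ⟨W, hs.trans h1, h2⟩

theorem Iso.subset {f : A →+* K} {q : Matrix (Fin n) (Fin n) A} {L L' : Set (Fin n → A)} {r : ℕ}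
    (h : Iso f q L r) (hs : L' ⊆ L) : Iso f q L' r := by
  obtain ⟨W, h1, h2⟩ := h
  exact ⟨W, h1, fun x hx => ⟨(h2 x hx).1, fun l hl => (h2 x hx).2 l (hs hl)⟩⟩

theorem bv_eq_zero_of_mem {q : Matrix (Fin n) (Fin n) K} {W : Submodule K (Fin n → K)}
    (h : ∀ x ∈ W, ev q x = 0) {x y : Fin n → K} (hx : x ∈ W) (hy : y ∈ W) :
    bv q x ⬝ᵥ y = 0 := by
  have := ev_add q x y
  rw [h _ (W.add_mem hx hy), h _ hx, h _ hy] at this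
  simpa using this.symm

theorem iso_one {f : A →+* K} {q : Matrix (Fin n) (Fin n) A} {L : Set (Fin n → A)} :
    Iso f q L 1 ↔ ∃ x : Fin n → K, x ≠ 0 ∧ SolH f q L x := by
  constructor
  · rintro ⟨W, h1, h2⟩
    have : 0 < Module.finrank K W := h1
    rw [Module.finrank_pos_iff_exists_ne_zero] at this
    obtain ⟨x, hx⟩ := this
    exact ⟨x, by simpa using hx, h2 x x.2⟩
  · rintro ⟨x, hx, h⟩
    refine ⟨K ∙ x, by rw [finrank_span_singleton hx], fun y hy => ?_⟩
    obtain ⟨c, rfl⟩ := Submodule.mem_span_singleton.1 hy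
    exact h.smul c

theorem finrank_sup_span {W : Submodule K (Fin n → K)} {e : Fin n → K} (he : e ∉ W) :
    Module.finrank K ↥(W ⊔ (K ∙ e)) = Module.finrank K W + 1 := by
  have h1 := Submodule.finrank_sup_add_finrank_inf_eq W (K ∙ e)
  have h0 : e ≠ 0 := fun h => he (h ▸ W.zero_mem)
  have h2 : W ⊓ (K ∙ e) = ⊥ := by
    rw [← disjoint_iff]
    rw [Submodule.disjoint_span_singleton' h0]
    exact he
  rw [h2, finrank_span_singleton h0] at h1
  simpa using h1

theorem Iso.extend {f : A →+* K} {q : Matrix (Fin n) (Fin n) A} {L : Set (Fin n → A)} {r : ℕ}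
    {W : Submodule K (Fin n → K)} (h1 : r ≤ Module.finrank K W) (h2 : ∀ x ∈ W, SolH f q L x)
    {e : Fin n → K} (he : e ∉ W) (hs : SolH f q L e) (hb : ∀ x ∈ W, bv (q.map f) e ⬝ᵥ x = 0) :
    Iso f q L (r + 1) := by
  refine ⟨W ⊔ (K ∙ e), by rw [finrank_sup_span he]; omega, fun x hx => ?_⟩
  obtain ⟨w, hw, z, hz, rfl⟩ := Submodule.mem_sup.1 hx
  obtain ⟨c, rfl⟩ := Submodule.mem_span_singleton.1 hz
  refine (h2 w hw).add (hs.smul c) ?_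
  rw [dotProduct_smul, bv_comm, hb w hw, smul_zero]

theorem Iso.hyper {f : A →+* K} {q : Matrix (Fin n) (Fin n) A} {L : Set (Fin n → A)} {r : ℕ}
    (h : Iso f q L (r + 1)) (l : (Fin n → K) →ₗ[K] K) :
    ∃ W : Submodule K (Fin n → K), r ≤ Module.finrank K W ∧ ∀ x ∈ W, SolH f q L x ∧ l x = 0 := by
  obtain ⟨W, h1, h2⟩ := h
  have h3 := LinearMap.finrank_range_add_finrank_ker (l.comp W.subtype)
  have h4 : Module.finrank K (LinearMap.range (l.comp W.subtype)) ≤ 1 := by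
    simpa using Submodule.finrank_le (LinearMap.range (l.comp W.subtype))
  refine ⟨(LinearMap.ker (l.comp W.subtype)).map W.subtype, ?_, ?_⟩
  · rw [Submodule.finrank_map_subtype_eq]
    omega
  · rintro x ⟨y, hy, rfl⟩
    exact ⟨h2 y y.2, hy⟩

theorem linInd_map {K' : Type} [Field K'] (g : K →+* K') {r : ℕ} {b : Fin r → Fin n → K}
    (hb : LinearIndependent K b) : LinearIndependent K' (fun i => (g ∘ b i : Fin n → K')) := by
  algebraize [g]
  exact (linearIndependent_algebraMap_comp_iff (R := K) (S := K') (v := b)).2 hb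

theorem Iso.map {K' : Type} [Field K'] {f : A →+* K} {q : Matrix (Fin n) (Fin n) A}
    {L : Set (Fin n → A)} {r : ℕ} (h : Iso f q L r) (g : K →+* K') : Iso (g.comp f) q L r := by
  obtain ⟨W, h1, h2⟩ := h
  let b := Module.finBasis K W
  have hb : LinearIndependent K (fun i => (b i : Fin n → K)) :=
    b.linearIndependent.map' W.subtype (by simp)
  have hb' := linInd_map g hb
  refine ⟨Submodule.span K' (Set.range fun i => (g ∘ (b i : Fin n → K) : Fin n → K')), ?_, ?_⟩
  · rw [finrank_span_eq_card hb']; simpa using h1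
  · intro x hx
    obtain ⟨c, rfl⟩ := (Submodule.mem_span_range_iff_exists_fun K').1 hx
    have hS : ∀ i, SolH (g.comp f) q L (c i • (g ∘ (b i : Fin n → K))) :=
      fun i => ((h2 _ (b i).2).map g).smul _
    have hq : q.map (g.comp f) = (q.map f).map g := by
      ext i j; simp
    refine ⟨ev_sum _ _ _ (fun i _ => (hS i).1) (fun i _ j _ => ?_), fun l hl => ?_⟩
    · rw [bv_smul, dotProduct_smul, smul_dotProduct, hq, bv_map, dot_map,
        bv_eq_zero_of_mem (fun x hx => (h2 x hx).1) (b i).2 (b j).2]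
      simp
    · rw [dotProduct_sum, Finset.sum_eq_zero fun i _ => (hS i).2 l hl]

theorem iso_comp {A' : Type} [CommRing A'] {f : A →+* K} {g : A' →+* A}
    {q : Matrix (Fin n) (Fin n) A'} {L : Set (Fin n → A')} {r : ℕ} :
    Iso (f.comp g) q L r ↔ Iso f (q.map g) ((fun l => g ∘ l) '' L) r := by
  have hq : q.map (f.comp g) = (q.map g).map f := by
    ext i j; simp
  unfold Iso SolH
  rw [hq]
  simp only [Set.forall_mem_image, Function.comp_assoc, RingHom.coe_comp]

end iso
end S3

namespace S3

section lemS
variable {n : ℕ}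

theorem lemS {R : Type} [CommRing R] [IsDomain R] [IsPrincipalIdealRing R] {E : Type} [Field E]
    [Algebra R E] [IsFractionRing R E] {κ : Type} [Field κ] (ρ : R →+* κ)
    (hs : Function.Surjective ρ) (w : R) (hw : w ≠ 0) (hker : ∀ r, ρ r = 0 ↔ w ∣ r)
    (W : Submodule E (Fin n → E)) :
    ∃ W' : Submodule κ (Fin n → κ), Module.finrank E W ≤ Module.finrank κ W' ∧
      ∀ y ∈ W', ∃ x : Fin n → R, (algebraMap R E ∘ x) ∈ W ∧ ρ ∘ x = y := by
  have hinj : Function.Injective (algebraMap R E) := IsFractionRing.injective R E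
  let M : Submodule R (Fin n → R) :=
    { carrier := {x | algebraMap R E ∘ x ∈ W}
      add_mem' := by
        intro a b ha hb
        have : algebraMap R E ∘ (a + b) = algebraMap R E ∘ a + algebraMap R E ∘ b := by
          funext i; simp
        simp only [Set.mem_ofPred_eq] at *
        rw [this]; exact W.add_mem ha hb
      zero_mem' := by
        have : algebraMap R E ∘ (0 : Fin n → R) = 0 := by funext i; simp
        simp only [Set.mem_ofPred_eq]
        rw [this]; exact W.zero_mem
      smul_mem' := by
        intro c a ha
        have : algebraMap R E ∘ (c • a) = algebraMap R E c • (algebraMap R E ∘ a) := by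
          funext i; simp
        simp only [Set.mem_ofPred_eq] at *
        rw [this]; exact W.smul_mem _ ha }
  have hM : ∀ x, x ∈ M ↔ algebraMap R E ∘ x ∈ W := fun x => Iff.rfl
  let b := Module.finBasis R M
  have hmapsum : ∀ {S : Type} [CommRing S] (g : R →+* S)
      (c : Fin (Module.finrank R M) → R) (v : Fin (Module.finrank R M) → Fin n → R),
      g ∘ (∑ i, c i • v i) = ∑ i, g (c i) • (g ∘ v i) := by
    intro S _ g c v
    funext j
    simp [Finset.sum_apply]
  have hrank : Module.finrank E W ≤ Module.finrank R M := by
    have hsub : W ≤ Submodule.span E (Set.range fun i => (algebraMap R E ∘ (b i : Fin n → R))) := by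
      intro x hx
      obtain ⟨d, hd⟩ := IsLocalization.exist_integer_multiples (nonZeroDivisors R) Finset.univ x
      choose z hz using fun i => hd i (Finset.mem_univ i)
      have hz' : algebraMap R E ∘ z = algebraMap R E d • x := by
        funext i; simp [hz, Algebra.smul_def]
      have hzM : z ∈ M := by rw [hM, hz']; exact W.smul_mem _ hx
      have h1 : (⟨z, hzM⟩ : M) = ∑ i, b.repr ⟨z, hzM⟩ i • b i := (b.sum_repr _).symm
      have h2 : z = ∑ i, b.repr ⟨z, hzM⟩ i • (b i : Fin n → R) := by
        have := congrArg M.subtype h1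
        rw [map_sum] at this
        simpa only [map_smul, Submodule.subtype_apply] using this
      have hd0 : algebraMap R E d ≠ 0 := by
        simp
      have h3 : x = (algebraMap R E d)⁻¹ • (algebraMap R E ∘ z) := by
        rw [hz', smul_smul, inv_mul_cancel₀ hd0, one_smul]
      rw [h3, h2, hmapsum]
      refine Submodule.smul_mem _ _ (Submodule.sum_mem _ fun i _ => Submodule.smul_mem _ _ ?_)
      exact Submodule.subset_span ⟨i, rfl⟩
    calc Module.finrank E W ≤ _ := Submodule.finrank_mono hsub
      _ ≤ _ := (finrank_range_le_card (R := E)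
                    (b := fun i => (algebraMap R E ∘ (b i : Fin n → R)))).trans_eq (by simp)
  refine ⟨Submodule.span κ (Set.range fun i => (ρ ∘ (b i : Fin n → R))), ?_, ?_⟩
  · rw [finrank_span_eq_card]
    · simpa using hrank
    · rw [Fintype.linearIndependent_iff]
      intro c hc i
      choose r hr using fun i => hs (c i)
      have h1 : ρ ∘ (∑ i, r i • (b i : Fin n → R)) = 0 := by
        rw [hmapsum]; simpa [hr] using hc
      have h2 : ∀ j, w ∣ (∑ i, r i • (b i : Fin n → R)) j := by
        intro j
        rw [← hker]
        exact congrFun h1 j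
      choose x' hx' using h2
      have hx2 : (∑ i, r i • (b i : Fin n → R)) = w • x' := by
        funext j; simpa using hx' j
      have hxM : x' ∈ M := by
        have h3 : w • x' ∈ M := by
          rw [← hx2]
          exact Submodule.sum_mem _ fun i _ => Submodule.smul_mem _ _ (b i).2
        rw [hM] at h3 ⊢
        have h4 : algebraMap R E ∘ x' = (algebraMap R E w)⁻¹ • (algebraMap R E ∘ (w • x')) := by
          have : algebraMap R E w ≠ 0 := by simpa using hw
          funext j; simp [this]
        rw [h4]; exact W.smul_mem _ h3
      have h5 : ∑ i, r i • b i = w • (⟨x', hxM⟩ : M) := by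
        apply Subtype.ext
        simpa using hx2
      have h6 : r i = w * b.repr ⟨x', hxM⟩ i := by
        have := congrArg (fun m => b.repr m i) h5
        rw [map_smul] at this
        simpa [Finsupp.single_apply] using this
      rw [← hr i, hker]
      exact ⟨_, h6⟩
  · intro y hy
    obtain ⟨c, rfl⟩ := (Submodule.mem_span_range_iff_exists_fun κ).1 hy
    choose r hr using fun i => hs (c i)
    refine ⟨∑ i, r i • (b i : Fin n → R), ?_, ?_⟩
    · rw [← hM]
      exact Submodule.sum_mem _ fun i _ => Submodule.smul_mem _ _ (b i).2
    · rw [hmapsum]; simp [hr]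

variable {A : Type} [CommRing A]

theorem Iso.liftInj {B : Type} [CommRing B] [IsDomain B] {E : Type} [Field E] [Algebra B E]
    [IsFractionRing B E] {K : Type} [Field K] {f : A →+* B} {q : Matrix (Fin n) (Fin n) A}
    {L : Set (Fin n → A)} {r : ℕ} (h : Iso ((algebraMap B E).comp f) q L r) (g : B →+* K)
    (hg : Function.Injective g) : Iso (g.comp f) q L r := by
  have h1 := h.map (IsFractionRing.lift hg)
  have h2 : (IsFractionRing.lift hg : E →+* K).comp ((algebraMap B E).comp f) = g.comp f := by
    ext x; simp
  rwa [h2] at h1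

theorem Iso.spec {R : Type} [CommRing R] [IsDomain R] [IsPrincipalIdealRing R] {E : Type}
    [Field E] [Algebra R E] [IsFractionRing R E] {κ : Type} [Field κ] {f : A →+* R}
    {q : Matrix (Fin n) (Fin n) A} {L : Set (Fin n → A)} {r : ℕ}
    (h : Iso ((algebraMap R E).comp f) q L r) (ρ : R →+* κ) : Iso (ρ.comp f) q L r := by
  by_cases hb : RingHom.ker ρ = ⊥
  · exact h.liftInj ρ ((RingHom.injective_iff_ker_eq_bot ρ).2 hb)
  obtain ⟨w, hw⟩ := (IsPrincipalIdealRing.principal (RingHom.ker ρ)).principal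
  have hw0 : w ≠ 0 := by
    rintro rfl; apply hb; simpa using hw
  have : (RingHom.ker ρ).IsPrime := RingHom.ker_isPrime ρ
  have : (RingHom.ker ρ).IsMaximal :=
    IsPrime.to_maximal_ideal (S := RingHom.ker ρ) hb
  let _ : Field (R ⧸ RingHom.ker ρ) := Ideal.Quotient.field _
  obtain ⟨W, h1, h2⟩ := h
  obtain ⟨W', h3, h4⟩ := lemS (Ideal.Quotient.mk (RingHom.ker ρ)) Ideal.Quotient.mk_surjective w hw0
    (fun r => by
      rw [Ideal.Quotient.eq_zero_iff_mem, hw]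
      exact Ideal.mem_span_singleton) W
  have h5 : Iso ((Ideal.Quotient.mk (RingHom.ker ρ)).comp f) q L r := by
    refine ⟨W', h1.trans h3, fun y hy => ?_⟩
    obtain ⟨x, hx, rfl⟩ := h4 y hy
    exact ((h2 _ hx).of_map (algebraMap R E) (IsFractionRing.injective R E)).map _
  have h6 := h5.map (RingHom.kerLift ρ)
  have h7 : (RingHom.kerLift ρ).comp ((Ideal.Quotient.mk (RingHom.ker ρ)).comp f) = ρ.comp f := by
    ext x; simp
  rwa [h7] at h6

theorem Iso.specMv {K : Type} [Field K] {q : Matrix (Fin n) (Fin n) A} {L : Set (Fin n → A)}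
    {r : ℕ} : ∀ {N : ℕ} {f : A →+* MvPolynomial (Fin N) K},
    Iso ((algebraMap _ (FractionRing (MvPolynomial (Fin N) K))).comp f) q L r →
      Iso ((MvPolynomial.constantCoeff).comp f) q L r := by
  intro N
  induction N with
  | zero =>
    intro f h
    refine h.liftInj _ ?_
    intro x y hxy
    rw [MvPolynomial.eq_C_of_isEmpty x, MvPolynomial.eq_C_of_isEmpty y]
    exact congrArg _ hxy
  | succ N ih =>
    intro f h
    let K1 := FractionRing (MvPolynomial (Fin N) K)
    let e : MvPolynomial (Fin (N + 1)) K →+* Polynomial (MvPolynomial (Fin N) K) :=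
      (MvPolynomial.finSuccEquiv K N).toRingEquiv.toRingHom
    let m : Polynomial (MvPolynomial (Fin N) K) →+* Polynomial K1 :=
      Polynomial.mapRingHom (algebraMap _ K1)
    have hm : Function.Injective m :=
      Polynomial.map_injective _ (IsFractionRing.injective _ K1)
    have hg : Function.Injective ((algebraMap (Polynomial K1) (RatFunc K1)).comp (m.comp e)) := by
      refine (IsFractionRing.injective _ (RatFunc K1)).comp (hm.comp ?_)
      exact (MvPolynomial.finSuccEquiv K N).injective
    have h1 := h.liftInj _ hg
    rw [RingHom.comp_assoc] at h1
    have h2 := h1.spec (Polynomial.evalRingHom (0 : K1))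
    have h3 : (Polynomial.evalRingHom (0 : K1)).comp ((m.comp e).comp f) =
        (algebraMap _ K1).comp ((Polynomial.constantCoeff.comp e).comp f) := by
      ext x
      simp [m, Polynomial.eval_map, Polynomial.eval₂_at_zero, Polynomial.coeff_zero_eq_eval_zero]
    rw [h3] at h2
    have h4 := ih h2
    have h5 : MvPolynomial.constantCoeff.comp ((Polynomial.constantCoeff.comp e).comp f)
        = MvPolynomial.constantCoeff.comp f := by
      rw [← RingHom.comp_assoc, ← RingHom.comp_assoc]
      congr 1
      apply MvPolynomial.ringHom_ext
      · intro r
        simp [e, MvPolynomial.finSuccEquiv_apply]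
      · intro i
        refine Fin.cases ?_ (fun i => ?_) i
        · simp [e, MvPolynomial.finSuccEquiv_X_zero]
        · simp [e, MvPolynomial.finSuccEquiv_X_succ]
    rwa [h5] at h4

end lemS
end S3

namespace S3

section springer
open Polynomial
variable {n : ℕ}

theorem odd_factor {K : Type} [Field K] : ∀ (d : ℕ) (h : K[X]), h.natDegree = d → Odd d →
    ∃ p : K[X], Irreducible p ∧ p ∣ h ∧ Odd p.natDegree := by
  intro d
  induction d using Nat.strong_induction_on with
  | _ d ih =>
    intro h hd hodd
    have hh0 : h ≠ 0 := by
      rintro rfl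
      simp at hd; subst hd; exact absurd hodd (by decide)
    have hu : ¬ IsUnit h := by
      intro hu
      have := natDegree_eq_zero_of_isUnit hu
      rw [this] at hd; subst hd; exact absurd hodd (by decide)
    obtain ⟨p, hp, k, rfl⟩ := WfDvdMonoid.exists_irreducible_factor hu hh0
    by_cases ho : Odd p.natDegree
    · exact ⟨p, hp, Dvd.intro _ rfl, ho⟩
    have hk0 : k ≠ 0 := right_ne_zero_of_mul hh0
    rw [natDegree_mul hp.ne_zero hk0] at hd
    have hpos : 0 < p.natDegree := hp.natDegree_pos
    have hko : Odd k.natDegree := by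
      rw [Nat.not_odd_iff_even] at ho
      rw [← hd] at hodd
      by_contra hc
      rw [Nat.not_odd_iff_even] at hc
      exact (Nat.not_odd_iff_even.2 (ho.add hc)) hodd
    obtain ⟨p', h1, h2, h3⟩ := ih k.natDegree (by omega) k rfl hko
    exact ⟨p', h1, h2.mul_left _, h3⟩

theorem ev_degree {K : Type} [Field K] (q : Matrix (Fin n) (Fin n) K) (L : Set (Fin n → K))
    (hno : ∀ x, SolH (RingHom.id K) q L x → x = 0) (w : Fin n → K[X]) (D : ℕ)
    (hD : ∀ i, (w i).natDegree ≤ D) (hD' : ∃ i, (w i).coeff D ≠ 0)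
    (hL : ∀ l ∈ L, (C ∘ l) ⬝ᵥ w = 0) :
    (ev (q.map C) w).natDegree = 2 * D := by
  have hc : (ev (q.map C) w).coeff (2 * D) = ev q (fun i => (w i).coeff D) := by
    simp only [ev, finsetSum_coeff, Matrix.map_apply]
    refine Finset.sum_congr rfl fun i _ => Finset.sum_congr rfl fun j _ => ?_
    rw [mul_assoc, coeff_C_mul, two_mul, coeff_mul_add_eq_of_natDegree_le (hD i) (hD j), mul_assoc]
  refine natDegree_eq_of_le_of_coeff_ne_zero ?_ ?_
  · refine natDegree_sum_le_of_forall_le _ _ fun i _ => natDegree_sum_le_of_forall_le _ _ fun j _ => ?_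
    refine natDegree_mul_le.trans ?_
    refine (Nat.add_le_add_right (natDegree_mul_le) _).trans ?_
    simp only [Matrix.map_apply, natDegree_C]
    have := hD i; have := hD j; omega
  · rw [hc]
    intro h0
    have := hno (fun i => (w i).coeff D) ⟨by simpa using h0, fun l hl => by
      have := congrArg (fun p => p.coeff D) (hL l hl)
      simpa [dotProduct, finsetSum_coeff] using this⟩
    obtain ⟨i, hi⟩ := hD'
    exact hi (congrFun this i)

theorem springer_aux {K : Type} [Field K] (q : Matrix (Fin n) (Fin n) K) (L : Set (Fin n → K))
    (hno : ∀ x, SolH (RingHom.id K) q L x → x = 0) :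
    ∀ (d : ℕ) (p : K[X]), Irreducible p → p.natDegree = d → Odd d →
      ∀ x : Fin n → AdjoinRoot p, SolH (AdjoinRoot.of p) q L x → x = 0 := by
  classical
  let _ : NormalizedGCDMonoid K[X] := UniqueFactorizationMonoid.toNormalizedGCDMonoid K[X]
  intro d
  induction d using Nat.strong_induction_on with
  | _ d ih =>
    intro p hp hd hodd x hx
    by_contra hx0
    have hdpos : 0 < d := hodd.pos
    choose u hu using fun i => AdjoinRoot.mk_surjective (x i)
    let v : Fin n → K[X] := fun i => u i % p
    have hv : AdjoinRoot.mk p ∘ v = x := by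
      funext i
      rw [← hu i]
      simp only [Function.comp, v]
      rw [AdjoinRoot.mk_eq_mk]
      rw [← EuclideanDomain.div_add_mod (u i) p]
      exact ⟨-((u i) / p), by rw [EuclideanDomain.div_add_mod]; linear_combination EuclideanDomain.div_add_mod (u i) p⟩
    have hvd : ∀ i, (v i).natDegree < d := by
      intro i
      rw [← hd]
      exact natDegree_mod_lt _ (by omega)
    have hv0 : v ≠ 0 := by
      intro h; apply hx0; rw [← hv, h]; funext i; simp
    have hmk : ∀ z : K[X], AdjoinRoot.mk p z = 0 ↔ p ∣ z := fun z => AdjoinRoot.mk_eq_zero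
    have hof : (AdjoinRoot.mk p).comp C = AdjoinRoot.of p := by ext; simp
    rw [← hof, ← hv] at hx
    have hqm : q.map ((AdjoinRoot.mk p).comp C) = (q.map C).map (AdjoinRoot.mk p) := by
      ext i j; simp
    have hev : p ∣ ev (q.map C) v := by
      rw [← hmk, ← ev_map, ← hqm]; exact hx.1
    have hL : ∀ l ∈ L, (C ∘ l) ⬝ᵥ v = 0 := by
      intro l hl
      have h1 : p ∣ (C ∘ l) ⬝ᵥ v := by
        rw [← hmk, ← dot_map]; exact hx.2 l hl
      refine eq_zero_of_dvd_of_natDegree_lt h1 ?_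
      refine lt_of_le_of_lt (b := d - 1) ?_ (by omega)
      refine natDegree_sum_le_of_forall_le _ _ fun i _ => ?_
      refine natDegree_mul_le.trans ?_
      simp only [Function.comp, natDegree_C]
      have := hvd i; omega
    have hne : (Finset.univ : Finset (Fin n)).Nonempty := by
      obtain ⟨i, hi⟩ := Function.ne_iff.1 hv0
      exact ⟨i, Finset.mem_univ i⟩
    obtain ⟨w, hw1, hw2⟩ := Finset.extract_gcd v hne
    set g := Finset.univ.gcd v with hg
    have hvw : v = g • w := by
      funext i; simpa using hw1 i (Finset.mem_univ i)
    have hg0 : g ≠ 0 := by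
      intro h; apply hv0; rw [hvw, h, zero_smul]
    have hw0 : w ≠ 0 := by
      intro h; apply hv0; rw [hvw, h, smul_zero]
    obtain ⟨i0, hi0⟩ := Function.ne_iff.1 hw0
    have hpg : ¬ p ∣ g := by
      intro h
      have h1 : p ∣ v i0 := by rw [hvw]; exact h.mul_right _
      have h2 := eq_zero_of_dvd_of_natDegree_lt h1 (by rw [hd]; exact hvd i0)
      rw [hvw] at h2
      simp only [Pi.smul_apply, smul_eq_mul, mul_eq_zero] at h2
      exact h2.elim hg0 hi0
    have hwd : ∀ i, (w i).natDegree < d := by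
      intro i
      by_cases h : w i = 0
      · rw [h]; simpa using hdpos
      · have := hvd i
        rw [hvw, Pi.smul_apply, smul_eq_mul, natDegree_mul hg0 h] at this
        omega
    have hLw : ∀ l ∈ L, (C ∘ l) ⬝ᵥ w = 0 := by
      intro l hl
      have := hL l hl
      rw [hvw, dotProduct_smul, smul_eq_mul, mul_eq_zero] at this
      exact this.resolve_left hg0
    have hevw : p ∣ ev (q.map C) w := by
      rw [hvw, ev_smul] at hev
      refine (hp.prime.dvd_or_dvd hev).resolve_left fun h => hpg (hp.prime.dvd_of_dvd_pow h)
    -- the degree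
    obtain ⟨j, -, hj⟩ := Finset.exists_max_image Finset.univ (fun i => (w i).degree) hne
    have hjne : w j ≠ 0 := by
      intro h
      have := hj i0 (Finset.mem_univ _)
      rw [h, degree_zero, le_bot_iff, degree_eq_bot] at this
      exact hi0 this
    have hdeg := ev_degree q L hno w (w j).natDegree
      (fun i => natDegree_le_natDegree (hj i (Finset.mem_univ _)))
      ⟨j, by simpa using hjne⟩ hLw
    have hnz : ev (q.map C) w ≠ 0 := by
      intro h0
      rw [h0, natDegree_zero] at hdeg
      have h1 : ∀ i, w i = C ((w i).coeff 0) := fun i => by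
        apply eq_C_of_natDegree_le_zero
        have := natDegree_le_natDegree (hj i (Finset.mem_univ _)); omega
      have h2 : w = C ∘ (fun i => (w i).coeff 0) := funext h1
      have h3 := hno (fun i => (w i).coeff 0) ?_
      · apply hi0; rw [h1 i0]; simpa using congrFun h3 i0
      · refine SolH.of_map (C : K →+* K[X]) C_injective ?_
        rw [← h2]
        exact ⟨h0, hLw⟩
    obtain ⟨h, hh⟩ := hevw
    have hh0 : h ≠ 0 := by rintro rfl; exact hnz (by simpa using hh)
    rw [hh, natDegree_mul hp.ne_zero hh0, hd] at hdeg
    have hjd := hwd j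
    have hho : Odd h.natDegree := by
      obtain ⟨a, ha⟩ := hodd
      exact ⟨(w j).natDegree - a - 1, by omega⟩
    obtain ⟨p', hp', hdvd, hodd'⟩ := odd_factor _ h rfl hho
    have hle : p'.natDegree ≤ h.natDegree := natDegree_le_of_dvd hdvd hh0
    have hof' : (AdjoinRoot.mk p').comp C = AdjoinRoot.of p' := by ext; simp
    have hqm' : q.map ((AdjoinRoot.mk p').comp C) = (q.map C).map (AdjoinRoot.mk p') := by
      ext i j; simp
    have := ih p'.natDegree (by omega) p' hp' rfl hodd' (AdjoinRoot.mk p' ∘ w) (by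
      rw [← hof']
      refine ⟨?_, fun l hl => ?_⟩
      · rw [hqm', ev_map, hh, AdjoinRoot.mk_eq_zero]
        exact hdvd.mul_left _
      · have := dot_map (AdjoinRoot.mk p') (C ∘ l) w
        rw [hLw l hl, map_zero] at this
        exact this)
    have h1 : p' ∣ Finset.univ.gcd w := by
      refine Finset.dvd_gcd fun i _ => ?_
      have := congrFun this i
      exact AdjoinRoot.mk_eq_zero.1 this
    rw [hw2] at h1
    exact hp'.not_isUnit (isUnit_of_dvd_one h1)

theorem springer_deg : ∀ (d : ℕ) {K K2 : Type} [Field K] [Field K2] [Algebra K K2]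
    [FiniteDimensional K K2] (_ : Module.finrank K K2 = d) (_ : Odd d)
    (q : Matrix (Fin n) (Fin n) K) (L : Set (Fin n → K)) (_ : Iso (algebraMap K K2) q L 1),
    Iso (RingHom.id K) q L 1 := by
  intro d
  induction d using Nat.strong_induction_on with
  | _ d ih =>
    intro K K2 _ _ _ _ hd hodd q L h
    by_cases hd1 : d = 1
    · subst hd1
      have hsurj : Function.Surjective (algebraMap K K2) := by
        have := (Subalgebra.bot_eq_top_iff_finrank_eq_one (F := K) (E := K2)).2 hd
        rw [Algebra.surjective_algebraMap_iff]
        exact this.symm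
      let e : K ≃+* K2 := RingEquiv.ofBijective _ ⟨(algebraMap K K2).injective, hsurj⟩
      have h1 := h.map (e.symm : K2 →+* K)
      have h2 : (e.symm : K2 →+* K).comp (algebraMap K K2) = RingHom.id K := by
        ext x
        exact e.symm_apply_apply x
      rwa [h2] at h1
    · have : ∃ α : K2, α ∉ (⊥ : IntermediateField K K2) := by
        by_contra hc
        push Not at hc
        have : (⊥ : IntermediateField K K2) = ⊤ := by
          rw [eq_top_iff]; intro x _; exact hc x
        have h1 := IntermediateField.finrank_bot (F := K) (E := K2)
        rw [this, IntermediateField.finrank_top', hd] at h1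
        exact hd1 h1
      obtain ⟨α, hα⟩ := this
      have hmul := Module.finrank_mul_finrank K (IntermediateField.adjoin K {α}) K2
      rw [hd] at hmul
      have hne1 : Module.finrank K (IntermediateField.adjoin K {α}) ≠ 1 := by
        intro h1
        rw [IntermediateField.finrank_eq_one_iff] at h1
        exact hα (h1 ▸ IntermediateField.mem_adjoin_simple_self K α)
      rw [← hmul] at hodd
      obtain ⟨ho1, ho2⟩ := Nat.odd_mul.1 hodd
      have hlt : Module.finrank (IntermediateField.adjoin K {α}) K2 < d := by
        have := ho1.pos; have := ho2.pos
        rw [← hmul]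
        have : 2 ≤ Module.finrank K (IntermediateField.adjoin K {α}) := by omega
        nlinarith
      have hc : (algebraMap (IntermediateField.adjoin K {α}) K2).comp
          (algebraMap K (IntermediateField.adjoin K {α})) = algebraMap K K2 := rfl
      rw [← hc, iso_comp] at h
      have h1 := ih _ hlt rfl ho2 _ _ h
      rw [← iso_comp, RingHom.id_comp] at h1
      have hinteg : IsIntegral K α := Algebra.IsIntegral.isIntegral α
      let e := IntermediateField.adjoinRootEquivAdjoin K hinteg
      have hirr : Fact (Irreducible (minpoly K α)) := ⟨minpoly.irreducible hinteg⟩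
      have h2 := h1.map (e.symm : IntermediateField.adjoin K {α} →+* AdjoinRoot (minpoly K α))
      by_contra hcon
      rw [iso_one] at hcon
      push Not at hcon
      have hno : ∀ x, SolH (RingHom.id K) q L x → x = 0 := by
        intro x hx
        by_contra h0
        exact hcon x h0 hx
      have h3 := springer_aux q L hno _ (minpoly K α) (minpoly.irreducible hinteg) rfl (by
        rw [← IntermediateField.adjoin.finrank hinteg]; exact ho1)
      have h4 : (e.symm : IntermediateField.adjoin K {α} →+* AdjoinRoot (minpoly K α)).comp
          (algebraMap K (IntermediateField.adjoin K {α})) = AdjoinRoot.of (minpoly K α) :=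
        RingHom.ext fun y => e.symm.commutes y
      rw [h4, iso_one] at h2
      obtain ⟨x, hx0, hx⟩ := h2
      exact hx0 (h3 x hx)

theorem springer {K K2 : Type} [Field K] [Field K2] [Algebra K K2]
    [FiniteDimensional K K2] (hodd : Odd (Module.finrank K K2))
    (q : Matrix (Fin n) (Fin n) K) (L : Set (Fin n → K)) (h : Iso (algebraMap K K2) q L 1) :
    Iso (RingHom.id K) q L 1 := springer_deg _ rfl hodd q L h

end springer
end S3

namespace S3

section parity

set_option linter.deprecated false in
theorem parity {R S Q M O E : Type} [CommRing R] [IsDedekindDomain R] [CommRing S]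
    [IsDedekindDomain S] [Field Q] [Field M] [CommRing O] [IsDomain O] [Field E]
    [Algebra R S] [Algebra R Q] [IsFractionRing R Q] [Algebra S M] [IsFractionRing S M]
    [Algebra Q M] [Algebra R M] [IsScalarTower R S M] [IsScalarTower R Q M] [Module.Finite R S]
    [Module.IsTorsionFree R S]
    (j : S →+* O) (res : O →+* E) (s : O)
    (hres : ∀ x, res x = 0 ↔ s ∣ x) (hs0 : s ≠ 0)
    (hsurj : Function.Surjective (res.comp (j.comp (algebraMap R S))))
    (p : Ideal R) (hpm : p.IsMaximal)
    (hp : p = RingHom.ker (res.comp (j.comp (algebraMap R S)))) (G : R) (hG : G ∈ p)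
    (hG0 : G ≠ 0)
    (u : O) (hu : res u ≠ 0) (hGu : j (algebraMap R S G) = s * u)
    (hP : ∀ P : Ideal S, P.IsPrime → ∀ _ : P.LiesOver p, P ≠ RingHom.ker (res.comp j) →
      Even (Module.finrank (R ⧸ p) (S ⧸ P))) :
    Odd (Module.finrank Q M) := by
  classical
  have hp0 : p ≠ ⊥ := by
    rintro rfl
    exact hG0 (by simpa using hG)
  have hP0 : (RingHom.ker (res.comp j)).IsPrime := RingHom.ker_isPrime _
  have hlo : (RingHom.ker (res.comp j)).LiesOver p := ⟨by
    rw [hp]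
    ext x
    simp [RingHom.mem_ker]⟩
  rw [← Ideal.sum_ramification_inertia (R := R) S Q M hp0]
  have hmem : RingHom.ker (res.comp j) ∈ IsDedekindDomain.primesOverFinset p S :=
    (IsDedekindDomain.mem_primesOverFinset_iff hp0 _).mpr ⟨hP0, hlo⟩
  rw [← Finset.add_sum_erase _ _ hmem]
  refine Odd.add_even ?_ ?_
  · have h1 : Ideal.ramificationIdx' p (RingHom.ker (res.comp j)) = 1 := by
      refine Ideal.ramificationIdx'_spec ?_ ?_
      · rw [pow_one, Ideal.map_le_iff_le_comap]
        exact le_of_eq hlo.over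
      · intro hle
        have h2 : algebraMap R S G ∈ RingHom.ker (res.comp j) ^ 2 :=
          hle (Ideal.mem_map_of_mem _ hG)
        have h3 : Ideal.map j (RingHom.ker (res.comp j)) ≤ Ideal.span {s} := by
          rw [Ideal.map_le_iff_le_comap]
          intro x hx
          rw [Ideal.mem_comap, Ideal.mem_span_singleton, ← hres]
          exact hx
        have h4 : j (algebraMap R S G) ∈ Ideal.span {s} ^ 2 := by
          have := Ideal.mem_map_of_mem j h2
          rw [Ideal.map_pow] at this
          exact Ideal.pow_right_mono h3 2 this
        rw [Ideal.span_singleton_pow, Ideal.mem_span_singleton, hGu, pow_two] at h4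
        exact hu ((hres u).2 ((mul_dvd_mul_iff_left hs0).1 h4))
    have h2 : Ideal.inertiaDeg' p (RingHom.ker (res.comp j)) = 1 := by
      rw [Ideal.inertiaDeg'_algebraMap]
      let _ : Field (R ⧸ p) := Ideal.Quotient.field p
      have hnt : Nontrivial (S ⧸ RingHom.ker (res.comp j)) :=
        Ideal.Quotient.nontrivial_iff.2 hP0.ne_top
      rw [← Subalgebra.bot_eq_top_iff_finrank_eq_one, eq_comm, ← Algebra.surjective_algebraMap_iff]
      intro y
      obtain ⟨x, rfl⟩ := Ideal.Quotient.mk_surjective y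
      obtain ⟨r, hr⟩ := hsurj (res (j x))
      refine ⟨Ideal.Quotient.mk p r, ?_⟩
      rw [Ideal.Quotient.algebraMap_mk_of_liesOver, Ideal.Quotient.eq, RingHom.mem_ker]
      simp only [map_sub, RingHom.comp_apply] at hr ⊢
      rw [hr, sub_self]
    rw [h1, h2]
    decide
  · refine Finset.even_sum _ fun P hPm => ?_
    rw [Finset.mem_erase] at hPm
    obtain ⟨hne, hPm⟩ := hPm
    obtain ⟨hpr, hlo'⟩ := (IsDedekindDomain.mem_primesOverFinset_iff hp0 _).1 hPm
    refine Even.mul_left ?_ _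
    rw [Ideal.inertiaDeg'_algebraMap]
    exact hP P hpr hlo' hne

end parity
end S3

namespace S3

section setup
open Polynomial
variable {n : ℕ}

/-- generic zero of a quadratic form, written as `a + T b` -/
structure GenZ {F E : Type} [Field F] [Field E] (ι : F →+* E) (q : Matrix (Fin n) (Fin n) F)
    (b : Fin n → F) (a : Fin n → E) (T : E) : Prop where
  indep : Function.Injective (MvPolynomial.eval₂Hom ι a)
  zero : ev (q.map ι) (a + T • (ι ∘ b)) = 0
  gen : ∀ S : Subfield E, (∀ x, ι x ∈ S) → (∀ i, a i ∈ S) → T ∈ S → ∀ e, e ∈ S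

/-- a local ring of the projective line over `E` -/
structure Loc {E O : Type} [Field E] [CommRing O] (c : E →+* O) (s : O) (res : O →+* E) :
    Prop where
  res_c : ∀ e, res (c e) = e
  res_s : ∀ x, res x = 0 ↔ s ∣ x
  s_ne : s ≠ 0
  unit : ∀ x, res x ≠ 0 → IsUnit x
  frac : ∀ o : O, ∃ N D : E[X], D.eval 0 ≠ 0 ∧ (D.eval₂ c s) * o = N.eval₂ c s

theorem exists_loc (E : Type) [Field E] : ∃ (O : Type) (_ : CommRing O) (_ : IsDomain O)
    (_ : ValuationRing O) (c : E →+* O) (s : O) (res : O →+* E), Loc c s res := by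
  let ρ : E[X] →+* E := Polynomial.evalRingHom 0
  have hP : (RingHom.ker ρ).IsPrime := RingHom.ker_isPrime _
  have hX : (X : E[X]) ∈ RingHom.ker ρ := by simp [ρ, RingHom.mem_ker]
  have hbot : RingHom.ker ρ ≠ ⊥ := by
    intro h; rw [h] at hX; simp at hX
  have hdom : IsDomain (Localization.AtPrime (RingHom.ker ρ)) :=
    IsLocalization.isDomain_localization (Ideal.primeCompl_le_nonZeroDivisors _)
  have hdvr : IsDiscreteValuationRing (Localization.AtPrime (RingHom.ker ρ)) :=
    IsLocalization.AtPrime.isDiscreteValuationRing_of_dedekind_domain E[X] hbot _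
  have hunit : ∀ y : (RingHom.ker ρ).primeCompl, IsUnit (ρ y) := by
    intro y
    exact isUnit_iff_ne_zero.2 y.2
  let res : Localization.AtPrime (RingHom.ker ρ) →+* E := IsLocalization.lift hunit
  let al := algebraMap E[X] (Localization.AtPrime (RingHom.ker ρ))
  have hres : ∀ a, res (al a) = ρ a := fun a => IsLocalization.lift_eq hunit a
  have hinj : Function.Injective al :=
    IsLocalization.injective _ (Ideal.primeCompl_le_nonZeroDivisors (RingHom.ker ρ))
  have hev : ∀ N : E[X], N.eval₂ (al.comp C) (al X) = al N := by
    intro N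
    rw [← hom_eval₂, eval₂_C_X]
  refine ⟨Localization.AtPrime (RingHom.ker ρ), inferInstance, hdom, inferInstance, al.comp C, al X,
    res, ⟨?_, ?_, ?_, ?_, ?_⟩⟩
  · intro e; simp [hres, ρ]
  · intro x
    constructor
    · intro hx
      obtain ⟨a, d, rfl⟩ := IsLocalization.exists_mk'_eq (RingHom.ker ρ).primeCompl x
      have h1 : res (IsLocalization.mk' _ a d) * res (al d) = res (al a) := by
        rw [← map_mul]; congr 1; exact IsLocalization.mk'_spec _ a d
      rw [hx, zero_mul, hres] at h1
      have h2 : X ∣ a := by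
        rw [X_dvd_iff, coeff_zero_eq_eval_zero]; exact h1.symm
      have h3 : IsLocalization.mk' (Localization.AtPrime (RingHom.ker ρ)) a d
          = al a * IsLocalization.mk' _ 1 d := IsLocalization.mk'_eq_mul_mk'_one a d
      rw [h3]
      exact (map_dvd al h2).mul_right _
    · rintro ⟨y, rfl⟩
      rw [map_mul, hres]; simp [ρ]
  · intro h
    exact X_ne_zero (hinj (by rw [h, map_zero]))
  · intro x hx
    obtain ⟨a, d, rfl⟩ := IsLocalization.exists_mk'_eq (RingHom.ker ρ).primeCompl x
    have h1 : res (IsLocalization.mk' _ a d) * res (al d) = res (al a) := by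
      rw [← map_mul]; congr 1; exact IsLocalization.mk'_spec _ a d
    have ha : a ∈ (RingHom.ker ρ).primeCompl := by
      intro h
      rw [hres a, (show ρ a = 0 from h), hres] at h1
      exact (mul_ne_zero hx d.2) h1
    have h2 : IsUnit (al a) := IsLocalization.map_units _ (⟨a, ha⟩ : (RingHom.ker ρ).primeCompl)
    have h4 : IsLocalization.mk' (Localization.AtPrime (RingHom.ker ρ)) a d * al d = al a :=
      IsLocalization.mk'_spec _ a d
    rw [← h4] at h2
    exact isUnit_of_mul_isUnit_left h2
  · intro x
    obtain ⟨a, d, rfl⟩ := IsLocalization.exists_mk'_eq (RingHom.ker ρ).primeCompl x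
    refine ⟨a, d, d.2, ?_⟩
    rw [hev, hev, mul_comm]
    exact IsLocalization.mk'_spec _ a d

theorem exists_max {O M : Type} [CommRing O] [IsDomain O] [ValuationRing O] [Field M] [Algebra O M]
    [IsFractionRing O M] {J : Type} [Fintype J] (y : J → M) (hy : ∃ j, y j ≠ 0) :
    ∃ j, y j ≠ 0 ∧ ∀ i, ∃ o : O, y i = algebraMap O M o * y j := by
  obtain ⟨j0, hj0⟩ := hy
  obtain ⟨j, -, hj⟩ := Finset.exists_max_image Finset.univ
    (fun i => ValuationRing.valuation O M (y i)) ⟨j0, Finset.mem_univ _⟩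
  have hjne : y j ≠ 0 := by
    intro h
    have := hj j0 (Finset.mem_univ _)
    rw [h, map_zero, le_zero_iff, map_eq_zero] at this
    exact hj0 this
  refine ⟨j, hjne, fun i => ?_⟩
  have h1 : ValuationRing.valuation O M (y i / y j) ≤ 1 := by
    rw [map_div₀]
    refine div_le_one_of_le₀ (hj i (Finset.mem_univ _)) zero_le
  obtain ⟨o, ho⟩ := (ValuationRing.mem_integer_iff O M _).1 h1
  exact ⟨o, by rw [ho, div_mul_cancel₀ _ hjne]⟩

theorem deriv_ev {M : Type} [Field M] (D : Derivation ℤ M M) (q : Matrix (Fin n) (Fin n) M)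
    (hq : ∀ i j, D (q i j) = 0) (x : Fin n → M) : D (ev q x) = bv q x ⬝ᵥ (D ∘ x) := by
  rw [bv_dot]
  simp only [ev, map_sum]
  refine Finset.sum_congr rfl fun i _ => Finset.sum_congr rfl fun j _ => ?_
  simp only [Derivation.leibniz, hq, smul_eq_mul, Function.comp]
  ring

theorem deriv_gen {E O M : Type} [Field E] [CommRing O] [IsDomain O] [Field M] [Algebra O M]
    [IsFractionRing O M] {c : E →+* O} {s : O} {res : O →+* E} (hl : Loc c s res)
    (S : Subfield M) (hc : ∀ e, algebraMap O M (c e) ∈ S) (hs : algebraMap O M s ∈ S) :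
    ∀ m, m ∈ S := by
  have h1 : ∀ N : E[X], algebraMap O M (N.eval₂ c s) ∈ S := by
    intro N
    rw [eval₂_eq_sum_range, map_sum]
    refine S.sum_mem fun i _ => ?_
    rw [map_mul, map_pow]
    exact S.mul_mem (hc _) (S.pow_mem hs _)
  have hDu : ∀ D : E[X], D.eval 0 ≠ 0 → D.eval₂ c s ≠ 0 := by
    intro D hD h
    have h2 : res (D.eval₂ c s) = D.eval 0 := by
      rw [hom_eval₂, (hl.res_s s).2 dvd_rfl]
      have : res.comp c = RingHom.id E := RingHom.ext hl.res_c
      rw [this]; rfl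
    rw [h, map_zero] at h2
    exact hD h2.symm
  have h2 : ∀ o : O, algebraMap O M o ∈ S := by
    intro o
    obtain ⟨N, D, hD, h⟩ := hl.frac o
    have h3 : algebraMap O M (D.eval₂ c s) ≠ 0 := by
      simpa using hDu D hD
    have h4 : algebraMap O M o = algebraMap O M (N.eval₂ c s) / algebraMap O M (D.eval₂ c s) := by
      rw [← h, map_mul, mul_div_cancel_left₀ _ h3]
    rw [h4]; exact S.div_mem (h1 N) (h1 D)
  intro m
  obtain ⟨x, y, hy, rfl⟩ := IsFractionRing.div_surjective (A := O) m
  exact S.div_mem (h2 x) (h2 y)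

theorem deriv_zero {F E O M : Type} [Field F] [Field E] [CommRing O] [IsDomain O] [ValuationRing O]
    [Field M] [Algebra O M] [IsFractionRing O M]
    {c : E →+* O} {s : O} {res : O →+* E} (hl : Loc c s res)
    {ι : F →+* E} {q : Matrix (Fin n) (Fin n) F} {b : Fin n → F} {a : Fin n → E} {T : E}
    (hz : GenZ ι q b a T) (f : Fin n → E)
    (hB : bv (q.map ι) (a + T • (ι ∘ b)) ⬝ᵥ f ≠ 0)
    (D : Derivation ℤ M M) (hD1 : ∀ x, D (algebraMap O M (c (ι x))) = 0)
    (hD2 : ∀ i, D (algebraMap O M (c (a i) + s * c (f i))) = 0)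
    (hD3 : D (algebraMap O M (c T)) = 0) : D = 0 := by
  set α := algebraMap O M with hα
  have hαi : Function.Injective α := IsFractionRing.injective O M
  by_cases h0 : (∀ i, D (α (c (a i))) = 0) ∧ D (α s) = 0
  · let S : Subfield M :=
      { carrier := {m | D m = 0}
        mul_mem' := by
          intro x y hx hy
          simp only [Set.mem_ofPred_eq] at *
          rw [D.leibniz, hx, hy]; simp
        one_mem' := by simp
        add_mem' := by
          intro x y hx hy
          simp only [Set.mem_ofPred_eq] at *
          rw [map_add, hx, hy, add_zero]
        zero_mem' := by simp
        neg_mem' := by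
          intro x hx
          simp only [Set.mem_ofPred_eq] at *
          rw [map_neg, hx, neg_zero]
        inv_mem' := by
          intro x hx
          simp only [Set.mem_ofPred_eq] at *
          rw [D.leibniz_inv, hx, smul_zero] }
    have hS : ∀ m, m ∈ S := by
      refine deriv_gen hl S (fun e => ?_) h0.2
      have := hz.gen (S.comap (α.comp c)) hD1 h0.1 hD3 e
      exact this
    ext m
    exact hS m
  exfalso
  let y : Option (Fin n) → M := fun i => i.elim (D (α s)) (fun i => D (α (c (a i))))
  have hy : ∃ j, y j ≠ 0 := by
    by_contra hc
    push Not at hc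
    exact h0 ⟨fun i => hc (some i), hc none⟩
  obtain ⟨j, hj, hmax⟩ := exists_max (O := O) y hy
  choose o ho using hmax
  let D' : Derivation ℤ M M := (y j)⁻¹ • D
  have hD' : ∀ m, D' m = (y j)⁻¹ * D m := fun m => rfl
  have hD'z : ∀ m, D m = 0 → D' m = 0 := fun m hm => by rw [hD', hm, mul_zero]
  have h1 : D' (α s) = α (o none) := by
    rw [hD']
    have : D (α s) = y none := rfl
    rw [this, ho none, mul_comm, mul_assoc, mul_inv_cancel₀ hj, mul_one]
  have h2 : ∀ i, D' (α (c (a i))) = α (o (some i)) := by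
    intro i
    rw [hD']
    have : D (α (c (a i))) = y (some i) := rfl
    rw [this, ho (some i), mul_comm, mul_assoc, mul_inv_cancel₀ hj, mul_one]
  have hoj : o j = 1 := by
    apply hαi
    have := ho j
    rw [map_one]
    exact (mul_right_cancel₀ hj (by rw [one_mul]; exact this)).symm
  have h3 : ∀ e, ∃ z : O, D' (α (c e)) = α z := by
    let S : Subfield E :=
      { carrier := {e | ∃ z : O, D' (α (c e)) = α z}
        mul_mem' := by
          rintro x y ⟨z, hz⟩ ⟨w, hw⟩
          refine ⟨c x * w + c y * z, ?_⟩
          rw [map_mul, map_mul, D'.leibniz, hz, hw]; simp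
        one_mem' := ⟨0, by simp⟩
        add_mem' := by
          rintro x y ⟨z, hz⟩ ⟨w, hw⟩
          exact ⟨z + w, by rw [map_add, map_add, map_add, hz, hw, map_add]⟩
        zero_mem' := ⟨0, by simp⟩
        neg_mem' := by
          rintro x ⟨z, hz⟩
          exact ⟨-z, by rw [map_neg, map_neg, map_neg, hz, map_neg]⟩
        inv_mem' := by
          rintro x ⟨z, hz⟩
          refine ⟨-(c x⁻¹) ^ 2 * z, ?_⟩
          have : α (c x⁻¹) = (α (c x))⁻¹ := by
            rw [← RingHom.comp_apply, map_inv₀]; rfl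
          rw [this, D'.leibniz_inv, hz]
          simp [this] }
    exact hz.gen S (fun x => ⟨0, by rw [hD'z _ (hD1 x), map_zero]⟩) (fun i => ⟨_, h2 i⟩)
      ⟨0, by rw [hD'z _ hD3, map_zero]⟩
  choose φ hφ using fun i => h3 (f i)
  have h4 : ∀ i, res (o (some i)) = - (res (o none) * f i) := by
    intro i
    have h5 := hD'z _ (hD2 i)
    rw [map_add, map_mul, map_add, D'.leibniz, h1, h2, hφ] at h5
    have h6 : o (some i) + (s * φ i + c (f i) * o none) = 0 := by
      apply hαi; simpa using h5
    have h7 := congrArg res h6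
    simp only [map_add, map_mul, hl.res_c, (hl.res_s s).2 dvd_rfl, map_zero, zero_mul,
      zero_add] at h7
    linear_combination h7
  set x0 := a + T • (ι ∘ b) with hx0
  have hqq : ((q.map ι).map c).map α = q.map (α.comp (c.comp ι)) := by ext; simp
  have h5 : D' (ev (((q.map ι).map c).map α) (α ∘ (c ∘ x0))) = 0 := by
    rw [ev_map, ev_map, hz.zero]; simp
  rw [deriv_ev D' _ (fun i j => by simp only [Matrix.map_apply]; exact hD'z _ (hD1 _))] at h5
  have h6 : D' ∘ (α ∘ (c ∘ x0)) = α ∘ (fun i => o (some i)) := by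
    funext i
    simp only [Function.comp, hx0, Pi.add_apply, Pi.smul_apply, smul_eq_mul, map_add, map_mul,
      D'.leibniz, hD'z _ hD3, hD'z _ (hD1 _), h2]
    simp
  rw [h6, bv_map, bv_map, dot_map] at h5
  have h7 : (c ∘ bv (q.map ι) x0) ⬝ᵥ (fun i => o (some i)) = 0 := hαi (by rw [h5, map_zero])
  have h8 := congrArg res h7
  rw [← dot_map, map_zero] at h8
  have h9 : res ∘ (c ∘ bv (q.map ι) x0) = bv (q.map ι) x0 := by
    funext i; simp [hl.res_c]
  have h10 : (res ∘ fun i => o (some i)) = (-(res (o none))) • f := by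
    funext i; simp [h4]
  rw [h9, h10, dotProduct_smul, smul_eq_mul, mul_eq_zero] at h8
  have h11 : res (o none) = 0 := by
    rcases h8 with h | h
    · simpa using h
    · exact absurd h hB
  have h12 : ∀ i, res (o i) = 0 := by
    intro i
    cases i with
    | none => exact h11
    | some i => rw [h4, h11]; simp
  have := h12 j
  rw [hoj, map_one] at this
  exact one_ne_zero this

end setup
end S3

namespace S3

section evenP
open Polynomial
variable {n : ℕ}

theorem dedekind_val {S : Type} [CommRing S] [IsDedekindDomain S] (P : Ideal S) [hP : P.IsPrime]
    (hP0 : P ≠ ⊥) (x y : S) : ∃ a d, d ∉ P ∧ (d * y = x * a ∨ d * x = y * a) := by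
  have hdom : IsDomain (Localization.AtPrime P) :=
    IsLocalization.isDomain_localization (Ideal.primeCompl_le_nonZeroDivisors _)
  have hdvr : IsDiscreteValuationRing (Localization.AtPrime P) :=
    IsLocalization.AtPrime.isDiscreteValuationRing_of_dedekind_domain S hP0 _
  have hinj : Function.Injective (algebraMap S (Localization.AtPrime P)) :=
    IsLocalization.injective _ (Ideal.primeCompl_le_nonZeroDivisors P)
  obtain ⟨z, hz⟩ := ValuationRing.cond (algebraMap S (Localization.AtPrime P) x)
    (algebraMap S (Localization.AtPrime P) y)
  obtain ⟨a, d, rfl⟩ := IsLocalization.exists_mk'_eq P.primeCompl z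
  refine ⟨a, d, d.2, ?_⟩
  have hs : IsLocalization.mk' (Localization.AtPrime P) a d * algebraMap S _ d = algebraMap S _ a :=
    IsLocalization.mk'_spec _ a d
  rcases hz with hz | hz
  · left
    apply hinj
    rw [map_mul, map_mul, ← hz, ← hs]; ring
  · right
    apply hinj
    rw [map_mul, map_mul, ← hz, ← hs]; ring

/-- the valuation ring of a prime of a Dedekind domain -/
theorem exists_V {S M : Type} [CommRing S] [IsDedekindDomain S] [Field M] [Algebra S M]
    [IsFractionRing S M] (P : Ideal S) [hP : P.IsPrime] (hP0 : P ≠ ⊥) :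
    ∃ V : ValuationSubring M, ∀ x, x ∈ V ↔ ∃ a d : S, d ∉ P ∧
      algebraMap S M d * x = algebraMap S M a := by
  have hinj : Function.Injective (algebraMap S M) := IsFractionRing.injective S M
  have h1P : (1 : S) ∉ P := fun h => hP.ne_top ((Ideal.eq_top_iff_one _).2 h)
  refine ⟨{ carrier := {x | ∃ a d : S, d ∉ P ∧ algebraMap S M d * x = algebraMap S M a}
            mul_mem' := ?_
            one_mem' := ⟨1, 1, h1P, by simp⟩
            add_mem' := ?_
            zero_mem' := ⟨0, 1, h1P, by simp⟩
            neg_mem' := ?_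
            mem_or_inv_mem' := ?_ }, fun x => Iff.rfl⟩
  · rintro x y ⟨a, d, hd, h⟩ ⟨a', d', hd', h'⟩
    refine ⟨a * a', d * d', fun hh => (hP.mem_or_mem hh).elim hd hd', ?_⟩
    rw [map_mul, map_mul, ← h, ← h']; ring
  · rintro x y ⟨a, d, hd, h⟩ ⟨a', d', hd', h'⟩
    refine ⟨a * d' + a' * d, d * d', fun hh => (hP.mem_or_mem hh).elim hd hd', ?_⟩
    rw [map_mul, map_add, map_mul, map_mul, ← h, ← h']; ring
  · rintro x ⟨a, d, hd, h⟩
    exact ⟨-a, d, hd, by rw [map_neg, ← h]; ring⟩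
  · intro z
    obtain ⟨x, y, hy, rfl⟩ := IsFractionRing.div_surjective (A := S) z
    have hy0 : algebraMap S M y ≠ 0 := by
      have := nonZeroDivisors.ne_zero hy
      simpa using this
    obtain ⟨a, d, hd, h | h⟩ := dedekind_val P hP0 x y
    · right
      by_cases hx : algebraMap S M x = 0
      · exact ⟨0, 1, h1P, by simp [hx]⟩
      refine ⟨a, d, hd, ?_⟩
      have := congrArg (algebraMap S M) h
      rw [map_mul, map_mul] at this
      field_simp
      linear_combination this
    · left
      refine ⟨a, d, hd, ?_⟩
      have := congrArg (algebraMap S M) h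
      rw [map_mul, map_mul] at this
      field_simp
      linear_combination this

theorem evenP {F E O M R S : Type} [Field F] [Field E] [CommRing O] [IsDomain O] [ValuationRing O]
    [Field M] [Algebra O M] [IsFractionRing O M]
    {c : E →+* O} {s : O} {res : O →+* E} (hl : Loc c s res)
    {ι : F →+* E} {q : Matrix (Fin n) (Fin n) F} {b : Fin n → F} {a : Fin n → E} {T : E}
    (hz : GenZ ι q b a T) (L : Set (Fin n → F)) (f : Fin n → E) (hf0 : f ≠ 0)
    (hf : SolH ι q L f)
    [CommRing R] [CommRing S] [IsDedekindDomain S] [Algebra S M] [IsFractionRing S M]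
    [Algebra R S] (j : S →+* O) (hj : (algebraMap O M).comp j = algebraMap S M)
    (p : Ideal R) [hpm : p.IsMaximal] (κ : F →+* R) (x : Fin n → R) (t : R)
    (hx : ∀ i, j (algebraMap R S (x i)) = c (a i) + s * c (f i))
    (ht : j (algebraMap R S t) = c T) (hκ : ∀ y, j (algebraMap R S (κ y)) = c (ι y))
    (hG : ev (q.map κ) (x + t • (κ ∘ b)) ∈ p)
    (hG0 : j (algebraMap R S (ev (q.map κ) (x + t • (κ ∘ b)))) ≠ 0)
    (hGs : res (j (algebraMap R S (ev (q.map κ) (x + t • (κ ∘ b))))) = 0)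
    (hunit : ∀ z : MvPolynomial (Fin n) F, z ≠ 0 → IsUnit (MvPolynomial.eval₂Hom κ x z))
    (hE : ∀ S : Subring E, (∀ x, ι x ∈ S) → (∀ i, a i ∈ S) → T ∈ S →
      (∀ z : MvPolynomial (Fin n) F, z ≠ 0 → (MvPolynomial.eval₂Hom ι a z)⁻¹ ∈ S) → ∀ e, e ∈ S)
    (hcon : ∀ g : Fin n → R ⧸ p, SolH ((Ideal.Quotient.mk p).comp κ) q L g →
      (Ideal.Quotient.mk p ∘ bv (q.map κ) (x + t • (κ ∘ b))) ⬝ᵥ g = 0 → g = 0)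
    (P : Ideal S) (hP : P.IsPrime) (hlo : P.LiesOver p) (hne : P ≠ RingHom.ker (res.comp j)) :
    Even (Module.finrank (R ⧸ p) (S ⧸ P)) := by
  classical
  set ν := x + t • (κ ∘ b) with hν
  set G := ev (q.map κ) ν with hGdef
  let αS := algebraMap S M
  let αO := algebraMap O M
  let ρ := algebraMap R S
  have hαi : Function.Injective αS := IsFractionRing.injective S M
  have hαO : Function.Injective αO := IsFractionRing.injective O M
  have hjα : ∀ y, αS y = αO (j y) := fun y => by
    change algebraMap S M y = _; rw [← hj]; rfl
  have hGP : ρ G ∈ P := by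
    have := hlo.over
    rw [this] at hG; exact hG
  have hP0 : P ≠ ⊥ := by
    rintro rfl
    apply hG0
    rw [Ideal.mem_bot] at hGP
    change j (ρ G) = 0
    rw [hGP, map_zero]
  have hPm : P.IsMaximal := hP.isMaximal hP0
  obtain ⟨V, hV⟩ := exists_V (M := M) P hP0
  -- the vector `F_i`
  let Fv : Fin n → M := fun i => αO (c (f i))
  obtain ⟨i0, hi0⟩ := Function.ne_iff.1 hf0
  have hcinj : Function.Injective c := c.injective
  have hFv0 : ∀ i, f i ≠ 0 → Fv i ≠ 0 := fun i hi => by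
    simp only [Fv]
    rw [map_ne_zero_iff _ hαO, map_ne_zero_iff _ hcinj]; exact hi
  obtain ⟨k, hk, hmax⟩ := exists_max (O := V) Fv ⟨i0, hFv0 i0 hi0⟩
  choose o ho using hmax
  choose av dv hdv hav using fun i => (hV (o i)).1 (o i).2
  let d : S := ∏ i, dv i
  have hdP : d ∉ P := by
    intro h
    obtain ⟨i, -, hi⟩ := Ideal.IsPrime.prod_mem_iff.1 h
    exact hdv i hi
  have hg : ∀ i, ∃ g : S, αS g * Fv k = αS d * Fv i := by
    intro i
    refine ⟨(∏ l ∈ Finset.univ.erase i, dv l) * av i, ?_⟩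
    have : d = dv i * ∏ l ∈ Finset.univ.erase i, dv l :=
      (Finset.mul_prod_erase _ _ (Finset.mem_univ i)).symm
    have h1 := hav i
    have h2 := ho i
    change _ = (o i : M) * _ at h2
    rw [h2, this, map_mul, map_mul]
    change _ * algebraMap S M (av i) * _ = _
    rw [← h1]
    ring
  choose g hg using hg
  have hgk : g k = d := by
    apply hαi
    exact mul_right_cancel₀ hk (hg k)
  have hcomp : αS.comp (ρ.comp κ) = αO.comp (c.comp ι) := by
    ext y
    simp only [RingHom.comp_apply, hjα]
    rw [hκ]
  have hsolM : SolH (αS.comp (ρ.comp κ)) q L (αS ∘ g) := by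
    rw [hcomp]
    have h1 := ((hf.map (αO.comp c)).smul (αS d)).smul (Fv k)⁻¹
    have h2 : αS ∘ g = (Fv k)⁻¹ • (αS d • ((αO.comp c) ∘ f)) := by
      funext i
      simp only [Pi.smul_apply, Function.comp, smul_eq_mul]
      change _ = (Fv k)⁻¹ * (αS d * Fv i)
      rw [← hg i]
      field_simp
    rw [h2]; exact h1
  have hsol : SolH (ρ.comp κ) q L g := hsolM.of_map αS hαi
  let β : S := (ρ ∘ bv (q.map κ) ν) ⬝ᵥ g
  by_cases hβ : β ∈ P
  · by_contra hodd
    rw [Nat.not_even_iff_odd] at hodd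
    let _ : Field (R ⧸ p) := Ideal.Quotient.field p
    let _ : Field (S ⧸ P) := Ideal.Quotient.field P
    have : FiniteDimensional (R ⧸ p) (S ⧸ P) := Module.finite_of_finrank_pos hodd.pos
    let mR := Ideal.Quotient.mk p
    let mS := Ideal.Quotient.mk P
    have hmm : (algebraMap (R ⧸ p) (S ⧸ P)).comp mR = mS.comp ρ := by
      ext r; rfl
    have h1 : Iso (algebraMap (R ⧸ p) (S ⧸ P)) (q.map (mR.comp κ))
        ((fun l => (mR.comp κ) ∘ l) '' L ∪ {mR ∘ bv (q.map κ) ν}) 1 := by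
      rw [iso_one]
      refine ⟨mS ∘ g, ?_, ?_, ?_⟩
      · intro h0
        have := congrFun h0 k
        simp only [Function.comp, hgk, Pi.zero_apply] at this
        exact hdP (Ideal.Quotient.eq_zero_iff_mem.1 this)
      · have := (hsol.map mS).1
        have e : (q.map (mR.comp κ)).map (algebraMap (R ⧸ p) (S ⧸ P))
            = q.map (mS.comp (ρ.comp κ)) := by
          ext; simp only [Matrix.map_apply, RingHom.comp_apply]; rfl
        rw [e]; exact this
      · rintro l (⟨l, hl', rfl⟩ | rfl)
        · exact (hsol.map mS).2 l hl'
        · have : mS β = 0 := Ideal.Quotient.eq_zero_iff_mem.2 hβ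
          rw [← this]
          exact (dot_map mS _ _)
    have h2 := springer hodd _ _ h1
    rw [iso_one] at h2
    obtain ⟨y, hy0, hy1, hy2⟩ := h2
    apply hy0
    apply hcon y
    · refine ⟨?_, fun l hl' => ?_⟩
      · have e : (q.map (mR.comp κ)).map (RingHom.id (R ⧸ p)) = q.map (mR.comp κ) := by
          ext; simp
        rw [e] at hy1; exact hy1
      · exact hy2 _ (Or.inl ⟨l, hl', rfl⟩)
    · exact hy2 _ (Or.inr rfl)
  exfalso
  -- the main identity
  have hkey : αS β * (αO s * Fv k) = αS (d * ρ G) := by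
    have hsx : ev (q.map ι) (a + T • (ι ∘ b)) = 0 := hz.zero
    have hff : ev (q.map ι) f = 0 := hf.1
    have hvj : (αS.comp ρ) ∘ ν = (αO.comp c) ∘ (a + T • (ι ∘ b)) + αO s • Fv := by
      funext i
      simp only [hν, Function.comp, RingHom.comp_apply, Pi.add_apply, Pi.smul_apply, smul_eq_mul,
        map_add, map_mul, hjα, Fv]
      change αO (j (algebraMap R S (x i))) + αO (j (algebraMap R S t))
        * αO (j (algebraMap R S (κ (b i)))) = _
      rw [hx, ht, hκ, map_add, map_mul]; ring
    have hqq : (q.map κ).map (αS.comp ρ) = (q.map ι).map (αO.comp c) := by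
      ext i l
      exact congrArg (fun h => h (q i l)) hcomp
    have hFv : Fv = (αO.comp c) ∘ f := rfl
    have hG1 : αS (ρ G) = ev ((q.map κ).map (αS.comp ρ)) ((αS.comp ρ) ∘ ν) := by
      rw [ev_map]; rfl
    have hB1 : αS β = bv ((q.map κ).map (αS.comp ρ)) ((αS.comp ρ) ∘ ν) ⬝ᵥ (αS ∘ g) := by
      rw [bv_map]
      exact (dot_map αS _ _).symm
    have hgF : Fv k • (αS ∘ g) = αS d • Fv := by
      funext i
      simp only [Pi.smul_apply, Function.comp, smul_eq_mul]
      rw [mul_comm]; exact hg i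
    have hB2 : αS β * Fv k = αS d * (bv ((q.map κ).map (αS.comp ρ)) ((αS.comp ρ) ∘ ν) ⬝ᵥ Fv) := by
      rw [← smul_eq_mul (αS d), ← dotProduct_smul, ← hgF, dotProduct_smul, hB1, smul_eq_mul,
        mul_comm]
    have hB3 : bv ((q.map κ).map (αS.comp ρ)) ((αS.comp ρ) ∘ ν) ⬝ᵥ Fv
        = bv ((q.map ι).map (αO.comp c)) ((αO.comp c) ∘ (a + T • (ι ∘ b))) ⬝ᵥ Fv := by
      rw [hqq, hvj, bv_add, add_dotProduct, bv_smul, smul_dotProduct, bv_self, hFv, ev_map, hff]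
      simp
    have hG2 : αS (ρ G) = αO s *
        (bv ((q.map ι).map (αO.comp c)) ((αO.comp c) ∘ (a + T • (ι ∘ b))) ⬝ᵥ Fv) := by
      rw [hG1, hqq, hvj, ev_add, ev_smul, ev_map, hsx, hFv, ev_map, hff, dotProduct_smul]
      simp
    rw [map_mul, hG2, ← hB3]
    linear_combination (αO s) * hB2
  -- the valuation ring
  have h1P : (1 : S) ∉ P := fun h => hP.ne_top ((Ideal.eq_top_iff_one _).2 h)
  have hSV : ∀ y, αS y ∈ V := fun y => (hV _).2 ⟨y, 1, h1P, by simp [αS]⟩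
  let σ : S →+* V := αS.codRestrict V hSV
  have hσ : ∀ y, ((σ y : V) : M) = αS y := fun y => rfl
  have hσu : ∀ y, y ∉ P → IsUnit (σ y) := by
    intro y hy
    have hy0 : αS y ≠ 0 := by
      rw [map_ne_zero_iff _ hαi]; rintro rfl; exact hy P.zero_mem
    have hm : (αS y)⁻¹ ∈ V := (hV _).2 ⟨1, y, hy, by
      rw [map_one]; exact mul_inv_cancel₀ hy0⟩
    refine IsUnit.of_mul_eq_one ⟨_, hm⟩ ?_
    apply Subtype.ext
    exact mul_inv_cancel₀ hy0
  have hσn : ∀ y, y ∈ P → ¬ IsUnit (σ y) := by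
    intro y hy hu
    obtain ⟨w, hw⟩ := hu.exists_right_inv
    obtain ⟨e, d', hd', h⟩ := (hV w).1 w.2
    have h1 : αS y * (w : M) = 1 := congrArg Subtype.val hw
    have h2 : y * e = d' := by
      apply hαi
      rw [map_mul]
      change αS y * algebraMap S M e = αS d'
      rw [← h]
      linear_combination (αS d') * h1
    exact hd' (h2 ▸ P.mul_mem_right _ hy)
  let rV := IsLocalRing.residue V
  have hr0 : ∀ y, y ∈ P → rV (σ y) = 0 := fun y hy => by
    by_contra h
    exact hσn y hy ((IsLocalRing.residue_ne_zero_iff_isUnit _).1 h)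
  have hr1 : ∀ y, y ∉ P → rV (σ y) ≠ 0 := fun y hy =>
    (IsLocalRing.residue_ne_zero_iff_isUnit _).2 (hσu y hy)
  -- `s F_i` lies in the maximal ideal
  have hsF : ∀ i, ∃ w : V, (w : M) = αO s * Fv i ∧ rV w = 0 := by
    intro i
    have h1 : αS (d * β) * (αO s * Fv i) = αS (g i * (d * ρ G)) := by
      rw [map_mul, map_mul αS (g i), ← hkey]
      have := hg i
      linear_combination (-(αS β * αO s)) * this
    have hdb : d * β ∉ P := fun h => (hP.mem_or_mem h).elim hdP hβ
    have hm : αO s * Fv i ∈ V := (hV _).2 ⟨_, _, hdb, h1⟩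
    refine ⟨⟨_, hm⟩, rfl, ?_⟩
    have h2 : σ (d * β) * ⟨_, hm⟩ = σ (g i * (d * ρ G)) := Subtype.ext h1
    have h3 := congrArg rV h2
    rw [map_mul, hr0 (g i * (d * ρ G)) (P.mul_mem_left _ (P.mul_mem_left _ hGP))] at h3
    exact (mul_eq_zero.1 h3).resolve_left (hr1 _ hdb)
  choose w hw hw0 using hsF
  let A : Fin n → V := fun i => σ (ρ (x i)) - w i
  have hA : ∀ i, ((A i : V) : M) = αO (c (a i)) := by
    intro i
    change αS (ρ (x i)) - (w i : M) = _
    rw [hw, hjα]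
    change αO (j (algebraMap R S (x i))) - _ = _
    rw [hx, map_add, map_mul]
    simp only [Fv]; ring
  have hAe : ∀ z, ((MvPolynomial.eval₂Hom (σ.comp (ρ.comp κ)) A z : V) : M)
      = αO (c (MvPolynomial.eval₂Hom ι a z)) := by
    intro z
    have : V.subtype.comp (MvPolynomial.eval₂Hom (σ.comp (ρ.comp κ)) A)
        = αO.comp (c.comp (MvPolynomial.eval₂Hom ι a)) := by
      apply MvPolynomial.ringHom_ext
      · intro r
        simp only [RingHom.comp_apply, MvPolynomial.coe_eval₂Hom, MvPolynomial.eval₂_C]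
        exact congrArg (fun h => h r) hcomp
      · intro i
        simp only [RingHom.comp_apply, MvPolynomial.coe_eval₂Hom, MvPolynomial.eval₂_X]
        exact hA i
    exact congrArg (fun h => h z) this
  have hAu : ∀ z, z ≠ 0 → IsUnit (MvPolynomial.eval₂Hom (σ.comp (ρ.comp κ)) A z) := by
    intro z hz'
    rw [← IsLocalRing.residue_ne_zero_iff_isUnit]
    have : rV.comp (MvPolynomial.eval₂Hom (σ.comp (ρ.comp κ)) A)
        = rV.comp ((σ.comp ρ).comp (MvPolynomial.eval₂Hom κ x)) := by
      apply MvPolynomial.ringHom_ext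
      · intro r
        simp only [RingHom.comp_apply, MvPolynomial.coe_eval₂Hom, MvPolynomial.eval₂_C]
      · intro i
        simp only [RingHom.comp_apply, MvPolynomial.coe_eval₂Hom, MvPolynomial.eval₂_X, A, map_sub,
          hw0, sub_zero]
    have h2 := congrArg (fun h => h z) this
    simp only [RingHom.comp_apply] at h2
    change rV _ ≠ 0
    rw [h2]
    exact (((hunit z hz').map (σ.comp ρ)).map rV).ne_zero
  have hEV : ∀ e, αO (c e) ∈ V := by
    refine hE (V.toSubring.comap (αO.comp c)) ?_ ?_ ?_ ?_
    · intro y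
      change αO (c (ι y)) ∈ V
      have := hSV (ρ (κ y))
      rw [hjα] at this
      change αO (j (algebraMap R S (κ y))) ∈ V at this
      rwa [hκ] at this
    · intro i
      change αO (c (a i)) ∈ V
      rw [← hA]; exact (A i).2
    · change αO (c T) ∈ V
      have := hSV (ρ t)
      rw [hjα] at this
      change αO (j (algebraMap R S t)) ∈ V at this
      rwa [ht] at this
    · intro z hz'
      change (αO.comp c) _ ∈ V
      rw [map_inv₀]
      change (αO (c (MvPolynomial.eval₂Hom ι a z)))⁻¹ ∈ V
      rw [← hAe]
      obtain ⟨u, hu⟩ := (hAu z hz').exists_right_inv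
      have : ((MvPolynomial.eval₂Hom (σ.comp (ρ.comp κ)) A z : V) : M)⁻¹ = (u : M) := by
        apply inv_eq_of_mul_eq_one_right
        exact congrArg Subtype.val hu
      rw [this]; exact u.2
  let cV : E →+* V := (αO.comp c).codRestrict V hEV
  obtain ⟨sV, hsV, hsV0⟩ : ∃ sV : V, (sV : M) = αO s ∧ rV sV = 0 := by
    refine ⟨w i0 * cV (f i0)⁻¹, ?_, ?_⟩
    · change (w i0 : M) * (αO.comp c) (f i0)⁻¹ = _
      rw [hw, map_inv₀]
      change αO s * Fv i0 * (Fv i0)⁻¹ = _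
      rw [mul_assoc, mul_inv_cancel₀ (hFv0 i0 hi0), mul_one]
    · rw [map_mul, hw0, zero_mul]
  have heval : ∀ N : E[X], ((N.eval₂ cV sV : V) : M) = αO (N.eval₂ c s) := by
    intro N
    change V.subtype _ = _
    rw [hom_eval₂, hom_eval₂, ← hsV]; rfl
  have hOV : ∀ y, αO y ∈ V := by
    intro y
    obtain ⟨N, D, hD, h⟩ := hl.frac y
    have hDu : IsUnit (D.eval₂ cV sV) := by
      rw [← IsLocalRing.residue_ne_zero_iff_isUnit]
      change rV _ ≠ 0
      rw [hom_eval₂, hsV0, eval₂_at_zero, coeff_zero_eq_eval_zero]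
      exact (_root_.map_ne_zero _).2 hD
    obtain ⟨u, hu⟩ := hDu.exists_right_inv
    have h1 : αO y = ((u * N.eval₂ cV sV : V) : M) := by
      change _ = (u : M) * ((N.eval₂ cV sV : V) : M)
      rw [heval, ← h, map_mul, ← heval]
      have : ((D.eval₂ cV sV : V) : M) * (u : M) = 1 := congrArg Subtype.val hu
      linear_combination (-(αO y)) * this
    rw [h1]; exact Subtype.property _
  let oV : O →+* V := αO.codRestrict V hOV
  have hle : RingHom.ker (res.comp j) ≤ P := by
    intro y hy
    by_contra hyP
    apply hr1 y hyP
    obtain ⟨e, he⟩ := (hl.res_s (j y)).1 hy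
    have : σ y = sV * oV e := by
      apply Subtype.ext
      change αS y = (sV : M) * αO e
      rw [hsV, hjα, he, map_mul]
    rw [this, map_mul, hsV0, zero_mul]
  have hk0 : RingHom.ker (res.comp j) ≠ ⊥ := by
    intro h
    have h1 : ρ G ∈ RingHom.ker (res.comp j) := hGs
    rw [h, Ideal.mem_bot] at h1
    apply hG0
    change j (ρ G) = 0
    rw [h1, map_zero]
  have hkp : (RingHom.ker (res.comp j)).IsPrime := RingHom.ker_isPrime _
  exact hne ((hkp.isMaximal hk0).eq_of_le hP.ne_top hle).symm

end evenP
end S3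

namespace S3

section coreA
open Polynomial
variable {n : ℕ}

theorem unram_of_der {Q M : Type} [Field Q] [Field M] [Algebra Q M]
    (h : ∀ D : Derivation Q M M, D = 0) : Algebra.FormallyUnramified Q M := by
  refine ⟨⟨fun x y => ?_⟩⟩
  have key : ∀ x : Ω[M⁄Q], x = 0 := by
    intro x
    rw [← Module.forall_dual_apply_eq_zero_iff M]
    intro φ
    have : φ = 0 := by
      apply (KaehlerDifferential.linearMapEquivDerivation Q M).injective
      rw [map_zero]; exact h _
    rw [this]; rfl
  rw [key x, key y]

theorem finSep {F E O M Q : Type} [Field F] [Field E] [CommRing O] [IsDomain O] [ValuationRing O]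
    [Field M] [Algebra O M] [IsFractionRing O M] [Field Q] [Algebra Q M]
    {c : E →+* O} {s : O} {res : O →+* E} (hl : Loc c s res)
    {ι : F →+* E} {q : Matrix (Fin n) (Fin n) F} {b : Fin n → F} {a : Fin n → E} {T : E}
    (hz : GenZ ι q b a T) (f : Fin n → E)
    (hB : bv (q.map ι) (a + T • (ι ∘ b)) ⬝ᵥ f ≠ 0)
    (h1 : ∀ x, ∃ y : Q, algebraMap Q M y = algebraMap O M (c (ι x)))
    (h2 : ∀ i, ∃ y : Q, algebraMap Q M y = algebraMap O M (c (a i) + s * c (f i)))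
    (h3 : ∃ y : Q, algebraMap Q M y = algebraMap O M (c T)) :
    FiniteDimensional Q M ∧ Algebra.IsSeparable Q M := by
  classical
  have hu : Algebra.FormallyUnramified Q M := by
    apply unram_of_der
    intro D
    have h4 : D.restrictScalars ℤ = 0 := by
      refine deriv_zero hl hz f hB _ (fun x => ?_) (fun i => ?_) ?_
      · obtain ⟨y, hy⟩ := h1 x
        rw [← hy]; exact D.map_algebraMap y
      · obtain ⟨y, hy⟩ := h2 i
        rw [← hy]; exact D.map_algebraMap y
      · obtain ⟨y, hy⟩ := h3
        rw [← hy]; exact D.map_algebraMap y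
    ext m
    exact congrArg (fun D' => D' m) h4
  have he : Algebra.EssFiniteType Q M := by
    rw [← IntermediateField.fg_top_iff]
    refine ⟨insert (algebraMap O M s) (Finset.univ.image fun i => algebraMap O M (c (a i))), ?_⟩
    rw [eq_top_iff]
    intro m _
    set K := IntermediateField.adjoin Q ((insert (algebraMap O M s)
      (Finset.univ.image fun i => algebraMap O M (c (a i))) : Finset M) : Set M) with hK
    have hs : algebraMap O M s ∈ K := IntermediateField.subset_adjoin _ _ (by simp)
    refine deriv_gen hl K.toSubfield (fun e => ?_) hs m
    refine hz.gen (K.toSubfield.comap ((algebraMap O M).comp c)) (fun x => ?_) (fun i => ?_) ?_ e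
    · obtain ⟨y, hy⟩ := h1 x
      change algebraMap O M (c (ι x)) ∈ K
      rw [← hy]; exact K.algebraMap_mem y
    · exact IntermediateField.subset_adjoin _ _ (by simp)
    · obtain ⟨y, hy⟩ := h3
      change algebraMap O M (c T) ∈ K
      rw [← hy]; exact K.algebraMap_mem y
  exact ⟨Algebra.FormallyUnramified.finite_of_free Q M,
    (Algebra.FormallyUnramified.iff_isSeparable Q M).1 hu⟩

theorem coreA {F E O R : Type} [Field F] [Field E] [CommRing O] [IsDomain O] [ValuationRing O]
    {c : E →+* O} {s : O} {res : O →+* E} (hl : Loc c s res)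
    {ι : F →+* E} {q : Matrix (Fin n) (Fin n) F} {b : Fin n → F} {a : Fin n → E} {T : E}
    (hz : GenZ ι q b a T) (L : Set (Fin n → F)) (f : Fin n → E) (hf0 : f ≠ 0)
    (hf : SolH ι q L f) (hB : bv (q.map ι) (a + T • (ι ∘ b)) ⬝ᵥ f ≠ 0)
    [CommRing R] [IsDedekindDomain R]
    (τ : R →+* O) (hτ : Function.Injective τ)
    (κ : F →+* R) (x : Fin n → R) (t : R)
    (hx : ∀ i, τ (x i) = c (a i) + s * c (f i))
    (ht : τ t = c T) (hκ : ∀ y, τ (κ y) = c (ι y))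
    (hsurj : Function.Surjective (res.comp τ))
    (hunit : ∀ z : MvPolynomial (Fin n) F, z ≠ 0 → IsUnit (MvPolynomial.eval₂Hom κ x z))
    (hE : ∀ S : Subring E, (∀ x, ι x ∈ S) → (∀ i, a i ∈ S) → T ∈ S →
      (∀ z : MvPolynomial (Fin n) F, z ≠ 0 → (MvPolynomial.eval₂Hom ι a z)⁻¹ ∈ S) → ∀ e, e ∈ S)
    (hcon : ∀ g : Fin n → E, SolH ι q L g →
      bv (q.map ι) (a + T • (ι ∘ b)) ⬝ᵥ g = 0 → g = 0) :
    Iso ((algebraMap R (FractionRing R)).comp κ) q ∅ 1 := by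
  let M := FractionRing O
  let Q := FractionRing R
  let αO := algebraMap O M
  have hαO : Function.Injective αO := IsFractionRing.injective O M
  have hinj : Function.Injective (αO.comp τ) := hαO.comp hτ
  let _ : Algebra R M := (αO.comp τ).toAlgebra
  let _ : Algebra Q M := (IsFractionRing.lift hinj : Q →+* M).toAlgebra
  have hRQ : ∀ r : R, algebraMap Q M (algebraMap R Q r) = αO (τ r) := fun r =>
    IsFractionRing.lift_algebraMap hinj r
  have : IsScalarTower R Q M := IsScalarTower.of_algebraMap_eq fun r => (hRQ r).symm
  obtain ⟨hfd, hsep⟩ := finSep (Q := Q) (M := M) hl hz f hB (fun y => ⟨algebraMap R Q (κ y), by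
    rw [hRQ, hκ]⟩) (fun i => ⟨algebraMap R Q (x i), by rw [hRQ, hx]⟩)
    ⟨algebraMap R Q t, by rw [hRQ, ht]⟩
  let S := integralClosure R M
  have hD : IsDedekindDomain S := integralClosure.isDedekindDomain (A := R) (K := Q) (L := M)
  have hSf : IsFractionRing S M := IsIntegralClosure.isFractionRing_of_finite_extension R Q M S
  have hfin : Module.Finite R S := IsIntegralClosure.finite R Q M S
  have hRM : ∀ r : R, algebraMap R M r = αO (τ r) := fun r => rfl
  have hRS : Function.Injective (algebraMap R S) := by
    intro r r' h
    exact hinj (congrArg (algebraMap S M) h)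
  have htf : Module.IsTorsionFree R S := Module.isTorsionFree_iff_algebraMap_injective.2 hRS
  -- the map to `O`
  have hSO : ∀ y : S, ∃ z : O, αO z = (y : M) := by
    intro y
    have h1 : IsIntegral R (y : M) := y.2
    have h2 : IsIntegral O (y : M) := by
      obtain ⟨P, hP, hP'⟩ := h1
      refine ⟨P.map τ, hP.map τ, ?_⟩
      rw [eval₂_map]; exact hP'
    exact IsIntegrallyClosed.isIntegral_iff.1 h2
  choose jf hjf using hSO
  let j : S →+* O :=
    { toFun := jf
      map_one' := hαO (by rw [hjf, map_one]; rfl)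
      map_mul' := fun y z => hαO (by rw [hjf, map_mul, hjf, hjf]; rfl)
      map_zero' := hαO (by rw [hjf, map_zero]; rfl)
      map_add' := fun y z => hαO (by rw [hjf, map_add, hjf, hjf]; rfl) }
  have hj : αO.comp j = algebraMap S M := by
    ext y; exact hjf y
  have hjR : ∀ r, j (algebraMap R S r) = τ r := fun r => hαO (hjf (algebraMap R S r))
  have hjc : res.comp (j.comp (algebraMap R S)) = res.comp τ := by
    ext r; simp [hjR]
  set ν := x + t • (κ ∘ b) with hν
  have hrx : ∀ i, res (τ (x i)) = a i := fun i => by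
    rw [hx, map_add, map_mul, hl.res_c, (hl.res_s s).2 dvd_rfl, zero_mul, add_zero]
  have hrt : res (τ t) = T := by rw [ht, hl.res_c]
  have hrκ : ∀ y, res (τ (κ y)) = ι y := fun y => by rw [hκ, hl.res_c]
  have hrν : (res.comp τ) ∘ ν = a + T • (ι ∘ b) := by
    funext i
    simp [hν, hrx, hrt, hrκ]
  have hcκ : (res.comp τ).comp κ = ι := by ext y; simp [hrκ]
  have hqι : (q.map κ).map (res.comp τ) = q.map ι := by ext i k; simp [hrκ]
  set G := ev (q.map κ) ν with hG
  have hresG : res (τ G) = 0 := by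
    have := ev_map (res.comp τ) (q.map κ) ν
    rw [hrν, hqι, hz.zero] at this
    exact this.symm
  set u : O := c (bv (q.map ι) (a + T • (ι ∘ b)) ⬝ᵥ f) with hu
  have hτG : τ G = s * u := by
    have h1 : τ ∘ ν = c ∘ (a + T • (ι ∘ b)) + s • (c ∘ f) := by
      funext i
      simp only [hν, Function.comp, Pi.add_apply, Pi.smul_apply, smul_eq_mul, map_add, map_mul, hx,
        ht, hκ]
      ring
    have h2 : (q.map κ).map τ = (q.map ι).map c := by ext i k; simp [hκ]
    rw [hG, ← ev_map, h1, h2, ev_add, ev_smul, ev_map, ev_map, hz.zero, hf.1, bv_map,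
      dotProduct_smul, dot_map]
    simp [hu]
  have hur : res u ≠ 0 := by rw [hu, hl.res_c]; exact hB
  have hu0 : u ≠ 0 := by intro h; rw [h, map_zero] at hur; exact hur rfl
  have hτG0 : τ G ≠ 0 := by rw [hτG]; exact mul_ne_zero hl.s_ne hu0
  have hG0 : G ≠ 0 := by intro h; rw [h, map_zero] at hτG0; exact hτG0 rfl
  have hpm : (RingHom.ker (res.comp τ)).IsMaximal := RingHom.ker_isMaximal_of_surjective _ hsurj
  have hodd : Odd (Module.finrank Q M) := by
    refine parity (R := R) (S := S) j res s hl.res_s hl.s_ne (by rw [hjc]; exact hsurj)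
      (RingHom.ker (res.comp τ)) hpm (by rw [hjc]) G hresG hG0 u hur (by rw [hjR, hτG]) ?_
    intro P hP hlo hne
    refine evenP (M := M) hl hz L f hf0 hf j hj _ κ x t (fun i => by rw [hjR, hx])
      (by rw [hjR, ht]) (fun y => by rw [hjR, hκ]) hresG (by rw [hjR]; exact hτG0)
      (by rw [hjR]; exact hresG) hunit hE ?_ P hP hlo hne
    intro g hg1 hg2
    let kl := RingHom.kerLift (res.comp τ)
    have hkli : Function.Injective kl := RingHom.kerLift_injective _
    have hkm : kl.comp (Ideal.Quotient.mk (RingHom.ker (res.comp τ))) = res.comp τ := by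
      ext r; rfl
    have h1 : SolH ι q L (kl ∘ g) := by
      have := hg1.map kl
      rw [← RingHom.comp_assoc, hkm, hcκ] at this
      exact this
    have h2 : bv (q.map ι) (a + T • (ι ∘ b)) ⬝ᵥ (kl ∘ g) = 0 := by
      have h3 : bv (q.map ι) (a + T • (ι ∘ b)) =
          kl ∘ (Ideal.Quotient.mk (RingHom.ker (res.comp τ)) ∘ bv (q.map κ) ν) := by
        rw [← hrν, ← hqι, bv_map]; rfl
      rw [h3, dot_map, hg2, map_zero]
    have h3 := hcon _ h1 h2
    funext i
    apply hkli
    rw [Pi.zero_apply, map_zero]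
    exact congrFun h3 i
  have hM : Iso (algebraMap Q M) (q.map ((algebraMap R Q).comp κ)) ∅ 1 := by
    rw [iso_one]
    refine ⟨(αO.comp c) ∘ f, ?_, ?_, by simp⟩
    · intro h
      apply hf0
      funext i
      have := congrFun h i
      exact c.injective (hαO (by simpa using this))
    · have h2 : (q.map ((algebraMap R Q).comp κ)).map (algebraMap Q M)
          = (q.map ι).map (αO.comp c) := by
        ext i k
        simp only [Matrix.map_apply, RingHom.comp_apply]
        rw [hRQ, hκ]
      rw [h2, ev_map, hf.1, map_zero]
  have h2 := springer hodd _ _ hM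
  have h3 : (algebraMap R Q).comp κ = (RingHom.id Q).comp ((algebraMap R Q).comp κ) := rfl
  rw [h3, iso_comp, Set.image_empty]
  exact h2

end coreA
end S3

namespace S3

section lemA
open Polynomial
variable {n : ℕ}

theorem lemA {F E : Type} [Field F] [Field E]
    {ι : F →+* E} {q : Matrix (Fin n) (Fin n) F} {b : Fin n → F} {a : Fin n → E} {T : E}
    (hz : GenZ ι q b a T) (hq : ∀ x, ev q x = 0 → x = 0) (L : Set (Fin n → F))
    (f : Fin n → E) (hf0 : f ≠ 0) (hf : SolH ι q L f) :
    ∃ g : Fin n → E, g ≠ 0 ∧ SolH ι q L g ∧ bv (q.map ι) (a + T • (ι ∘ b)) ⬝ᵥ g = 0 := by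
  by_contra hcon0
  have hcon : ∀ g : Fin n → E, SolH ι q L g →
      bv (q.map ι) (a + T • (ι ∘ b)) ⬝ᵥ g = 0 → g = 0 := by
    intro g h1 h2
    by_contra h3
    exact hcon0 ⟨g, h3, h1, h2⟩
  have hB : bv (q.map ι) (a + T • (ι ∘ b)) ⬝ᵥ f ≠ 0 := fun h => hf0 (hcon f hf h)
  obtain ⟨O, _, _, _, c, s, res, hl⟩ := exists_loc E
  let P := MvPolynomial (Fin n) F
  let k := FractionRing P
  let al := algebraMap P k
  let θ : k →+* E := IsFractionRing.lift hz.indep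
  have hθ : ∀ z : P, θ (al z) = MvPolynomial.eval₂Hom ι a z := fun z =>
    IsFractionRing.lift_algebraMap hz.indep z
  let evE : k[X] →+* E := eval₂RingHom θ T
  let τ0 : P →+* O := MvPolynomial.eval₂Hom (c.comp ι) (fun i => c (a i) + s * c (f i))
  have hress : res s = 0 := (hl.res_s s).2 dvd_rfl
  have hrτ0 : ∀ z, res (τ0 z) = MvPolynomial.eval₂Hom ι a z := by
    intro z
    have : res.comp τ0 = MvPolynomial.eval₂Hom ι a := by
      apply MvPolynomial.ringHom_ext
      · intro r
        simp [τ0, hl.res_c]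
      · intro i
        simp [τ0, hl.res_c, hress]
    exact congrArg (fun h => h z) this
  have hτ0u : ∀ y : nonZeroDivisors P, IsUnit (τ0 y) := by
    intro y
    apply hl.unit
    rw [hrτ0, map_ne_zero_iff _ hz.indep]
    exact nonZeroDivisors.ne_zero y.2
  let τk : k →+* O := IsLocalization.lift hτ0u
  have hτk : ∀ z : P, τk (al z) = τ0 z := fun z => IsLocalization.lift_eq hτ0u z
  let τ : k[X] →+* O := eval₂RingHom τk (c T)
  have hrτk : res.comp τk = θ := by
    apply IsLocalization.ringHom_ext (nonZeroDivisors P)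
    ext z
    · simp only [RingHom.comp_apply]
      change res (τk (al _)) = θ (al _)
      rw [hτk, hrτ0, hθ]
    · simp only [RingHom.comp_apply]
      change res (τk (al _)) = θ (al _)
      rw [hτk, hrτ0, hθ]
  have hrτ : res.comp τ = evE := by
    apply Polynomial.ringHom_ext
    · intro z
      simp only [τ, evE, RingHom.comp_apply, coe_eval₂RingHom, eval₂_C]
      exact congrArg (fun h => h z) hrτk
    · simp only [τ, evE, RingHom.comp_apply, coe_eval₂RingHom, eval₂_X, hl.res_c]
  let κ : F →+* k[X] := C.comp (al.comp MvPolynomial.C)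
  let x : Fin n → k[X] := fun i => C (al (MvPolynomial.X i))
  have hx : ∀ i, τ (x i) = c (a i) + s * c (f i) := by
    intro i
    simp only [τ, x, coe_eval₂RingHom, eval₂_C, hτk]
    exact MvPolynomial.eval₂Hom_X' _ _ i
  have ht : τ X = c T := by simp [τ]
  have hκ : ∀ y, τ (κ y) = c (ι y) := by
    intro y
    simp only [τ, κ, coe_eval₂RingHom, RingHom.comp_apply, eval₂_C, hτk]
    exact MvPolynomial.eval₂Hom_C _ _ y
  let ν : Fin n → k[X] := x + (X : k[X]) • (κ ∘ b)
  let G := ev (q.map κ) ν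
  have hτG : τ G = s * c (bv (q.map ι) (a + T • (ι ∘ b)) ⬝ᵥ f) := by
    have h1 : τ ∘ ν = c ∘ (a + T • (ι ∘ b)) + s • (c ∘ f) := by
      funext i
      simp only [ν, Function.comp, Pi.add_apply, Pi.smul_apply, smul_eq_mul, map_add, map_mul, hx,
        ht, hκ]
      ring
    have h2 : (q.map κ).map τ = (q.map ι).map c := by ext i k; simp [hκ]
    change τ (ev (q.map κ) ν) = _
    rw [← ev_map, h1, h2, ev_add, ev_smul, ev_map, ev_map, hz.zero, hf.1, bv_map,
      dotProduct_smul, dot_map]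
    simp
  have hτG0 : τ G ≠ 0 := by
    rw [hτG]
    exact mul_ne_zero hl.s_ne ((map_ne_zero_iff _ c.injective).2 hB)
  have hG0 : G ≠ 0 := by intro h; rw [h, map_zero] at hτG0; exact hτG0 rfl
  have hGE : evE G = 0 := by
    rw [← hrτ, RingHom.comp_apply, hτG, map_mul, hress, zero_mul]
  have hpp : (RingHom.ker evE).IsPrime := RingHom.ker_isPrime _
  have hp0 : RingHom.ker evE ≠ ⊥ := fun h => hG0 (by
    have : G ∈ RingHom.ker evE := hGE
    rwa [h, Ideal.mem_bot] at this)
  have hpm : (RingHom.ker evE).IsMaximal := hpp.isMaximal hp0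
  have hsurj : Function.Surjective evE := by
    let _ : Field (k[X] ⧸ RingHom.ker evE) := Ideal.Quotient.field _
    let kl := RingHom.kerLift evE
    intro e
    have : e ∈ kl.fieldRange := by
      refine hz.gen _ (fun y => ?_) (fun i => ?_) ?_ e
      · refine ⟨Ideal.Quotient.mk _ (κ y), ?_⟩
        change evE (κ y) = _
        rw [← hrτ, RingHom.comp_apply, hκ, hl.res_c]
      · refine ⟨Ideal.Quotient.mk _ (x i), ?_⟩
        change evE (x i) = _
        rw [← hrτ, RingHom.comp_apply, hx, map_add, map_mul, hl.res_c, hress, zero_mul, add_zero]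
      · refine ⟨Ideal.Quotient.mk _ X, ?_⟩
        change evE X = _
        rw [← hrτ, RingHom.comp_apply, ht, hl.res_c]
    obtain ⟨y, hy⟩ := this
    obtain ⟨r, rfl⟩ := Ideal.Quotient.mk_surjective y
    exact ⟨r, hy⟩
  have hτi : Function.Injective τ := by
    rw [RingHom.injective_iff_ker_eq_bot]
    by_contra h0
    have h1 : (RingHom.ker τ).IsPrime := RingHom.ker_isPrime _
    have h2 := h1.isMaximal h0
    have h3 : RingHom.ker τ ≤ RingHom.ker evE := by
      intro r hr
      rw [RingHom.mem_ker] at hr ⊢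
      rw [← hrτ, RingHom.comp_apply, hr, map_zero]
    have h4 := h2.eq_of_le hpp.ne_top h3
    apply hτG0
    have : G ∈ RingHom.ker evE := hGE
    rw [← h4] at this
    exact this
  have hιx : ∀ z, MvPolynomial.eval₂Hom κ x z = C (al z) := by
    intro z
    have : MvPolynomial.eval₂Hom κ x = C.comp al := by
      apply MvPolynomial.ringHom_ext
      · intro r; simp [κ]
      · intro i; simp [x]
    exact congrArg (fun h => h z) this
  have hfin := coreA hl hz L f hf0 hf hB τ hτi κ x X hx ht hκ (by rw [hrτ]; exact hsurj)
    (fun z hz' => by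
      rw [hιx]
      refine (IsUnit.mk0 (al z) ?_).map C
      rw [map_ne_zero_iff _ (IsFractionRing.injective P k)]; exact hz')
    (by
      intro S h1 h2 h3 h4 e
      obtain ⟨r, rfl⟩ := hsurj e
      have h5 : ∀ z : P, MvPolynomial.eval₂Hom ι a z ∈ S := by
        intro z
        induction z using MvPolynomial.induction_on with
        | C r => simpa using h1 r
        | add p q hp hq => rw [map_add]; exact S.add_mem hp hq
        | mul_X p i hp => rw [map_mul]; exact S.mul_mem hp (by simpa using h2 i)
      have h6 : ∀ y : k, θ y ∈ S := by
        intro y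
        obtain ⟨z, w, hw, rfl⟩ := IsFractionRing.div_surjective (A := P) y
        change θ (al z / al w) ∈ S
        rw [map_div₀, hθ, hθ, div_eq_mul_inv]
        exact S.mul_mem (h5 z) (h4 w (nonZeroDivisors.ne_zero hw))
      change r.eval₂ θ T ∈ S
      rw [eval₂_eq_sum_range]
      exact S.sum_mem fun i _ => S.mul_mem (h6 _) (S.pow_mem h3 _))
    hcon
  have h1 := hfin.spec (evalRingHom (0 : k))
  have h2 : (evalRingHom (0 : k)).comp κ = al.comp MvPolynomial.C := by
    ext y; simp [κ]
  rw [h2] at h1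
  have h3 := h1.specMv
  rw [iso_one] at h3
  obtain ⟨y, hy0, hy1, -⟩ := h3
  apply hy0
  apply hq
  have h4 : q.map (MvPolynomial.constantCoeff.comp (MvPolynomial.C (σ := Fin n))) = q := by
    ext; simp
  rwa [h4] at hy1

end lemA
end S3

namespace S3

section claimH
variable {n : ℕ}

theorem specGen {E : Type} [Field E] {Q : Matrix (Fin n) (Fin n) (MvPolynomial (Fin n) E)}
    {LL : Set (Fin n → MvPolynomial (Fin n) E)} {r : ℕ}
    (h : Iso (algebraMap _ (FractionRing (MvPolynomial (Fin n) E))) Q LL r)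
    {K : Type} [Field K] (g : E →+* K) (c : Fin n → K) :
    Iso (MvPolynomial.eval₂Hom g c) Q LL r := by
  let A := MvPolynomial (Fin n) E
  let η : A →+* MvPolynomial (Fin n) K := MvPolynomial.eval₂Hom (MvPolynomial.C.comp g)
    (fun i => MvPolynomial.C (c i) + MvPolynomial.X i)
  let η' : MvPolynomial (Fin n) K →+* MvPolynomial (Fin n) K := MvPolynomial.eval₂Hom MvPolynomial.C
    (fun i => MvPolynomial.X i - MvPolynomial.C (c i))
  have h1 : η'.comp η = MvPolynomial.map g := by
    apply MvPolynomial.ringHom_ext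
    · intro r; simp [η, η']
    · intro i; simp [η, η']
  have hη : Function.Injective η := by
    have : Function.Injective (η'.comp η) := by
      rw [h1]; exact MvPolynomial.map_injective _ g.injective
    rw [RingHom.coe_comp] at this
    exact this.of_comp
  have h2 : Iso (((algebraMap _ (FractionRing (MvPolynomial (Fin n) K))).comp η).comp
      (RingHom.id A)) Q LL r := by
    refine Iso.liftInj (E := FractionRing A) (by simpa using h) _ ?_
    exact (IsFractionRing.injective _ _).comp hη
  rw [RingHom.comp_assoc] at h2
  have h3 := h2.specMv
  have h4 : MvPolynomial.constantCoeff.comp (η.comp (RingHom.id A)) = MvPolynomial.eval₂Hom g c := by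
    apply MvPolynomial.ringHom_ext
    · intro r; simp [η]
    · intro i; simp [η]
  rwa [h4] at h3

/-- adding the generic linear form to a system -/
def gL {E : Type} [Field E] (L : Set (Fin n → E)) : Set (Fin n → MvPolynomial (Fin n) E) :=
  insert MvPolynomial.X ((fun l => MvPolynomial.C ∘ l) '' L)

theorem solH_gL {E : Type} [Field E] {q : Matrix (Fin n) (Fin n) E} {L : Set (Fin n → E)}
    {K : Type} [CommRing K] (f : MvPolynomial (Fin n) E →+* K) (x : Fin n → K) :
    SolH f (q.map MvPolynomial.C) (gL L) x ↔ SolH (f.comp MvPolynomial.C) q L x ∧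
      (f ∘ MvPolynomial.X) ⬝ᵥ x = 0 := by
  have hq : q.map (f.comp MvPolynomial.C) = (q.map MvPolynomial.C).map f := by
    ext i j; simp
  simp only [SolH, gL, hq, Set.forall_mem_insert, Set.forall_mem_image]
  constructor
  · rintro ⟨h1, h2, h3⟩
    exact ⟨⟨h1, fun l hl => h3 hl⟩, h2⟩
  · rintro ⟨⟨h1, h2⟩, h3⟩
    exact ⟨h1, h3, fun l hl => h2 l hl⟩

theorem specGen' {E : Type} [Field E] {q : Matrix (Fin n) (Fin n) E}
    {L : Set (Fin n → E)} {r : ℕ}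
    (h : Iso (algebraMap _ (FractionRing (MvPolynomial (Fin n) E))) (q.map MvPolynomial.C) (gL L) r)
    {K : Type} [Field K] (g : E →+* K) (c : Fin n → K) :
    ∃ W : Submodule K (Fin n → K), r ≤ Module.finrank K W ∧ ∀ x ∈ W, SolH g q L x ∧ c ⬝ᵥ x = 0 := by
  obtain ⟨W, h1, h2⟩ := specGen h g c
  refine ⟨W, h1, fun x hx => ?_⟩
  have h3 := (solH_gL _ _).1 (h2 x hx)
  have h4 : (MvPolynomial.eval₂Hom g c).comp MvPolynomial.C = g := by ext; simp
  have h5 : ⇑(MvPolynomial.eval₂Hom g c) ∘ MvPolynomial.X = c := by funext; simp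
  rwa [h4, h5] at h3

theorem claimH {E : Type} [Field E] {q : Matrix (Fin n) (Fin n) E} {L : Set (Fin n → E)} {j : ℕ}
    (hj : 1 ≤ j)
    (h : Iso (algebraMap _ (FractionRing (MvPolynomial (Fin n) E))) (q.map MvPolynomial.C) (gL L) j) :
    Iso (RingHom.id E) q L (j + 1) := by
  obtain ⟨e, he0, he⟩ : ∃ e, e ≠ 0 ∧ SolH (RingHom.id E) q L e := by
    obtain ⟨W, h1, h2⟩ := specGen' h (RingHom.id E) 0
    have : Iso (RingHom.id E) q L 1 := ⟨W, hj.trans h1, fun x hx => (h2 x hx).1⟩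
    exact iso_one.1 this
  have hid : q.map (RingHom.id E) = q := by ext; simp
  by_cases hc : ∀ g, (∀ l ∈ L, l ⬝ᵥ g = 0) → bv q e ⬝ᵥ g = 0
  · obtain ⟨i, hi⟩ := Function.ne_iff.1 he0
    obtain ⟨W, h1, h2⟩ := specGen' h (RingHom.id E) (Pi.single i 1)
    refine Iso.extend (W := W) h1 (fun x hx => (h2 x hx).1) (e := e) ?_ he ?_
    · intro hW
      apply hi
      simpa using (h2 e hW).2
    · intro x hx
      rw [hid]
      exact hc x (fun l hl => (h2 x hx).1.2 l hl)
  · push Not at hc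
    obtain ⟨g0, hg0, hb0⟩ := hc
    have he1 : ev q e = 0 := by have := he.1; rwa [hid] at this
    have heL : ∀ l ∈ L, l ⬝ᵥ e = 0 := fun l hl => he.2 l hl
    obtain ⟨g, hgL, hbg, hgq⟩ : ∃ g, (∀ l ∈ L, l ⬝ᵥ g = 0) ∧ bv q e ⬝ᵥ g = 1 ∧ ev q g = 0 := by
      let g1 := (bv q e ⬝ᵥ g0)⁻¹ • g0
      have h1 : bv q e ⬝ᵥ g1 = 1 := by
        simp only [g1, dotProduct_smul, smul_eq_mul]
        exact inv_mul_cancel₀ hb0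
      have h2 : ∀ l ∈ L, l ⬝ᵥ g1 = 0 := fun l hl => by
        simp only [g1, dotProduct_smul, hg0 l hl, smul_zero]
      clear_value g1
      refine ⟨g1 + (- ev q g1) • e, fun l hl => ?_, ?_, ?_⟩
      · rw [dotProduct_add, dotProduct_smul, h2 l hl, heL l hl]; simp
      · rw [dotProduct_add, dotProduct_smul, h1, bv_self, he1]; simp
      · rw [ev_add, ev_smul, dotProduct_smul, bv_comm q g1 e, h1, he1]; simp
    let R := Polynomial E
    let K := FractionRing R
    let γ : Fin n → R := bv (q.map Polynomial.C)
      ((Polynomial.X : R) • (Polynomial.C ∘ g) - Polynomial.C ∘ e)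
    obtain ⟨W, h1, h2⟩ := specGen' h ((algebraMap R K).comp Polynomial.C) (algebraMap R K ∘ γ)
    obtain ⟨W', h3, h4⟩ := lemS (R := R) (E := K) (Polynomial.evalRingHom (0 : E))
      (fun y => ⟨Polynomial.C y, Polynomial.eval_C⟩) Polynomial.X Polynomial.X_ne_zero
      (fun r => by rw [Polynomial.X_dvd_iff, Polynomial.coeff_zero_eq_eval_zero]; rfl) W
    have hinj : Function.Injective (algebraMap R K) := IsFractionRing.injective R K
    have h5 : ∀ x : Fin n → R, algebraMap R K ∘ x ∈ W → SolH Polynomial.C q L x ∧ γ ⬝ᵥ x = 0 := by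
      intro x hx
      obtain ⟨h6, h7⟩ := h2 _ hx
      refine ⟨h6.of_map _ hinj, hinj ?_⟩
      rw [← dot_map, h7, map_zero]
    have hρC : (Polynomial.evalRingHom (0 : E)).comp Polynomial.C = RingHom.id E := by
      ext; simp
    have hρC2 : ∀ v : Fin n → E, Polynomial.evalRingHom (0 : E) ∘ (Polynomial.C ∘ v) = v := by
      intro v; funext i; simp
    have hqC : (q.map Polynomial.C).map (Polynomial.evalRingHom (0 : E)) = q := by
      ext; simp
    have hργ : Polynomial.evalRingHom (0 : E) ∘ γ = - bv q e := by
      have : Polynomial.evalRingHom (0 : E) ∘ ((Polynomial.X : R) • (Polynomial.C ∘ g)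
        - Polynomial.C ∘ e) = (-1 : E) • e := by funext i; simp
      simp only [γ]
      rw [← bv_map, hqC, this, bv_smul]; simp
    refine Iso.extend (W := W') (h1.trans h3) (fun y hy => ?_) (e := e) ?_ he ?_
    · obtain ⟨x, hx, rfl⟩ := h4 y hy
      have := (h5 x hx).1.map (Polynomial.evalRingHom (0 : E))
      rwa [hρC] at this
    · intro heW
      obtain ⟨x, hx, hxe⟩ := h4 e heW
      obtain ⟨hx1, hx2⟩ := h5 x hx
      have hdiv : ∀ i, (Polynomial.X : R) ∣ x i - Polynomial.C (e i) := by
        intro i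
        rw [Polynomial.X_dvd_iff, Polynomial.coeff_zero_eq_eval_zero]
        have := congrFun hxe i
        have h6 : Polynomial.eval 0 (x i) = e i := this
        rw [Polynomial.eval_sub, h6, Polynomial.eval_C, sub_self]
      choose x1 hx1' using hdiv
      have hxx : x = Polynomial.C ∘ e + (Polynomial.X : R) • x1 := by
        funext i
        have := hx1' i
        simp only [Pi.add_apply, Function.comp, Pi.smul_apply, smul_eq_mul, ← this]; ring
      have hbe : bv (q.map Polynomial.C) (Polynomial.C ∘ e) ⬝ᵥ x1
          = - (Polynomial.X : R) * ev (q.map Polynomial.C) x1 := by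
        have h6 := hx1.1
        rw [hxx, ev_add, ev_map, he1, ev_smul, dotProduct_smul, map_zero, smul_eq_mul] at h6
        have h7 : (Polynomial.X : R) * (Polynomial.X * ev (q.map Polynomial.C) x1 +
            bv (q.map Polynomial.C) (Polynomial.C ∘ e) ⬝ᵥ x1) = 0 := by
          rw [← h6]; ring
        have h8 := (mul_eq_zero.1 h7).resolve_left Polynomial.X_ne_zero
        linear_combination h8
      have hγ : γ = (Polynomial.X : R) • bv (q.map Polynomial.C) (Polynomial.C ∘ g)
          - bv (q.map Polynomial.C) (Polynomial.C ∘ e) := by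
        simp only [γ]
        rw [sub_eq_add_neg, ← neg_one_smul R (Polynomial.C ∘ e), bv_add, bv_smul, bv_smul,
          neg_one_smul, sub_eq_add_neg]
      rw [hγ, hxx, sub_dotProduct, smul_dotProduct, dotProduct_add, dotProduct_add,
        dotProduct_smul, dotProduct_smul, hbe, bv_map, bv_map, dot_map, dot_map, bv_self, he1,
        bv_comm, hbg] at hx2
      simp only [smul_eq_mul, map_one, mul_zero, map_zero] at hx2
      have h9 : (Polynomial.X : R) * (1 + Polynomial.X *
          ((Polynomial.C ∘ bv q g) ⬝ᵥ x1 + ev (q.map Polynomial.C) x1)) = 0 := by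
        rw [← hx2]; ring
      have h10 := (mul_eq_zero.1 h9).resolve_left Polynomial.X_ne_zero
      have h11 := congrArg (Polynomial.eval (0 : E)) h10
      simp at h11
    · intro y hy
      obtain ⟨x, hx, rfl⟩ := h4 y hy
      have h6 := (h5 x hx).2
      have h7 := dot_map (Polynomial.evalRingHom (0 : E)) γ x
      rw [h6, hργ, map_zero, neg_dotProduct, neg_eq_zero] at h7
      rw [hid]; exact h7

end claimH
end S3

namespace S3

section claim2b
variable {n : ℕ}

theorem solH_comp {A A' K : Type} [CommRing A] [CommRing A'] [CommRing K] (f : A →+* K)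
    (g : A' →+* A) {q : Matrix (Fin n) (Fin n) A'} {L : Set (Fin n → A')} (x : Fin n → K) :
    SolH (f.comp g) q L x ↔ SolH f (q.map g) ((fun l => g ∘ l) '' L) x := by
  have hq : q.map (f.comp g) = (q.map g).map f := by
    ext i j; simp
  unfold SolH
  rw [hq]
  simp only [Set.forall_mem_image, Function.comp_assoc, RingHom.coe_comp]

theorem swap_inj {F E : Type} [Field F] [Field E] {ι : F →+* E} {a : Fin n → E}
    (h : Function.Injective (MvPolynomial.eval₂Hom ι a)) :
    Function.Injective (MvPolynomial.eval₂Hom (MvPolynomial.map ι : MvPolynomial (Fin n) F →+* _)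
      (fun i => (MvPolynomial.C (a i) : MvPolynomial (Fin n) E))) := by
  have h1 : MvPolynomial.eval₂Hom (MvPolynomial.map ι : MvPolynomial (Fin n) F →+* _)
      (fun i => (MvPolynomial.C (a i) : MvPolynomial (Fin n) E)) =
      (MvPolynomial.map (MvPolynomial.eval₂Hom ι a)).comp
        (MvPolynomial.commAlgEquiv F (Fin n) (Fin n)).toRingEquiv.toRingHom := by
    apply MvPolynomial.ringHom_ext
    · intro p
      have : MvPolynomial.commAlgEquiv F (Fin n) (Fin n) (MvPolynomial.C p)
        = MvPolynomial.map MvPolynomial.C p := MvPolynomial.commAlgEquiv_C p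
      simp [this, MvPolynomial.map_map]
    · intro i
      have : MvPolynomial.commAlgEquiv F (Fin n) (Fin n) (MvPolynomial.X i)
        = MvPolynomial.C (MvPolynomial.X i) := MvPolynomial.commAlgEquiv_X i
      simp [this]
  rw [h1, RingHom.coe_comp]
  exact (MvPolynomial.map_injective _ h).comp (MvPolynomial.commAlgEquiv F (Fin n) (Fin n)).injective

theorem clearDen {R : Type} [CommRing R] [IsDomain R] (P : MvPolynomial (Fin n) (FractionRing R)) :
    ∃ d : R, d ≠ 0 ∧ ∃ P0 : MvPolynomial (Fin n) R,
      P * MvPolynomial.C (algebraMap R (FractionRing R) d) =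
        MvPolynomial.map (algebraMap R (FractionRing R)) P0 := by
  letI : Algebra (MvPolynomial (Fin n) R) (MvPolynomial (Fin n) (FractionRing R)) :=
    MvPolynomial.algebraMvPolynomial
  have : IsLocalization ((nonZeroDivisors R).map (MvPolynomial.C : _ →+* MvPolynomial (Fin n) R))
      (MvPolynomial (Fin n) (FractionRing R)) :=
      MvPolynomial.isLocalization _ _
  obtain ⟨⟨P0, ⟨_, d, hd, rfl⟩⟩, h1⟩ := IsLocalization.surj ((nonZeroDivisors R).map
      (MvPolynomial.C : _ →+* MvPolynomial (Fin n) R)) P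
  simp only [MvPolynomial.algebraMap_def] at h1
  refine ⟨d, nonZeroDivisors.ne_zero hd, P0, ?_⟩
  rw [← h1]
  congr 1
  exact (MvPolynomial.map_C _ _).symm

theorem GenZ.ext {F E : Type} [Field F] [Field E]
    {ι : F →+* E} {q : Matrix (Fin n) (Fin n) F} {b : Fin n → F} {a : Fin n → E} {T : E}
    (hz : GenZ ι q b a T)
    (ι' : FractionRing (MvPolynomial (Fin n) F) →+* FractionRing (MvPolynomial (Fin n) E))
    (hι' : ι'.comp (algebraMap (MvPolynomial (Fin n) F) (FractionRing (MvPolynomial (Fin n) F))) =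
      (algebraMap (MvPolynomial (Fin n) E) (FractionRing (MvPolynomial (Fin n) E))).comp (MvPolynomial.map ι)) :
    GenZ ι' ((q.map MvPolynomial.C).map (algebraMap (MvPolynomial (Fin n) F) (FractionRing (MvPolynomial (Fin n) F))))
      ((algebraMap (MvPolynomial (Fin n) F) (FractionRing (MvPolynomial (Fin n) F))) ∘ (MvPolynomial.C ∘ b))
      ((algebraMap (MvPolynomial (Fin n) E) (FractionRing (MvPolynomial (Fin n) E))) ∘ (MvPolynomial.C ∘ a))
      ((algebraMap (MvPolynomial (Fin n) E) (FractionRing (MvPolynomial (Fin n) E))) (MvPolynomial.C T)) := by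
  have hι : ∀ p, ι' ((algebraMap (MvPolynomial (Fin n) F) (FractionRing (MvPolynomial (Fin n) F))) p) =
      (algebraMap (MvPolynomial (Fin n) E) (FractionRing (MvPolynomial (Fin n) E))) (MvPolynomial.map ι p) :=
    fun p => RingHom.congr_fun hι' p
  set αF := algebraMap (MvPolynomial (Fin n) F) (FractionRing (MvPolynomial (Fin n) F)) with hαF
  set αE := algebraMap (MvPolynomial (Fin n) E) (FractionRing (MvPolynomial (Fin n) E)) with hαE
  have hiE : Function.Injective αE := IsFractionRing.injective _ _
  refine ⟨?_, ?_, ?_⟩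
  · rw [injective_iff_map_eq_zero]
    intro P hP
    obtain ⟨d, hd0, P0, h1⟩ := clearDen P
    have h2 : (MvPolynomial.eval₂Hom ι' (αE ∘ (MvPolynomial.C ∘ a))).comp (MvPolynomial.map αF)
        = αE.comp (MvPolynomial.eval₂Hom (MvPolynomial.map ι : MvPolynomial (Fin n) F →+* _)
      (fun i => (MvPolynomial.C (a i) : MvPolynomial (Fin n) E))) := by
      apply MvPolynomial.ringHom_ext
      · intro p; simp [hι]
      · intro i; simp
    have h3 := RingHom.congr_fun h2 P0
    simp only [RingHom.comp_apply] at h3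
    rw [hαF, ← h1, map_mul, hP, zero_mul] at h3
    have h4 : P0 = 0 := swap_inj hz.indep (hiE (by rw [← h3]; simp))
    rw [h4, map_zero] at h1
    refine (mul_eq_zero.1 h1).resolve_right ?_
    refine mt MvPolynomial.C_eq_zero.1 ?_
    exact (map_ne_zero_iff _ (IsFractionRing.injective _ _)).2 hd0
  · have h1 : αE ∘ (MvPolynomial.C ∘ a) + αE (MvPolynomial.C T) • (ι' ∘ (αF ∘ (MvPolynomial.C ∘ b)))
        = (αE.comp MvPolynomial.C) ∘ (a + T • (ι ∘ b)) := by
      funext i; simp [hι]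
    have h2 : ((q.map MvPolynomial.C).map αF).map ι' = (q.map ι).map (αE.comp MvPolynomial.C) := by
      ext i j; simp [hι]
    rw [h1, h2, ev_map, hz.zero, map_zero]
  · intro S hS1 hS2 hS3 e
    have h1 : ∀ x : E, αE (MvPolynomial.C x) ∈ S := by
      refine hz.gen (S.comap (αE.comp MvPolynomial.C)) (fun x => ?_) hS2 hS3
      have := hS1 (αF (MvPolynomial.C x))
      rw [hι, MvPolynomial.map_C] at this
      exact this
    have h2 : ∀ i, αE (MvPolynomial.X i) ∈ S := by
      intro i
      have := hS1 (αF (MvPolynomial.X i))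
      rwa [hι, MvPolynomial.map_X] at this
    have h3 : ∀ p, αE p ∈ S := by
      intro p
      induction p using MvPolynomial.induction_on with
      | C x => exact h1 x
      | add p q hp hq => rw [map_add]; exact S.add_mem hp hq
      | mul_X p i hp => rw [map_mul]; exact S.mul_mem hp (h2 i)
    obtain ⟨x, y, hy, rfl⟩ := IsFractionRing.div_surjective (A := MvPolynomial (Fin n) E) e
    exact S.div_mem (h3 x) (h3 y)

theorem aniso_ext {F : Type} [Field F] {q : Matrix (Fin n) (Fin n) F}
    (hq : ∀ x, ev q x = 0 → x = 0) :
    ∀ x, ev ((q.map MvPolynomial.C).map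
      (algebraMap (MvPolynomial (Fin n) F) (FractionRing (MvPolynomial (Fin n) F)))) x = 0 → x = 0 := by
  intro x hx
  by_contra h0
  have h1 : Iso ((algebraMap (MvPolynomial (Fin n) F) (FractionRing (MvPolynomial (Fin n) F))).comp
      MvPolynomial.C) q ∅ 1 := by
    rw [iso_one]
    refine ⟨x, h0, ?_, by simp⟩
    rw [← hx]; congr 1
  obtain ⟨y, hy0, hy, -⟩ := iso_one.1 h1.specMv
  apply hy0
  apply hq
  rw [← hy]; congr 1
  ext i j; simp

theorem claim2b : ∀ (j : ℕ) {F E : Type} [Field F] [Field E]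
    {ι : F →+* E} {q : Matrix (Fin n) (Fin n) F} {b : Fin n → F} {a : Fin n → E} {T : E}
    (_ : GenZ ι q b a T) (_ : ∀ x, ev q x = 0 → x = 0) (L : Set (Fin n → F))
    (_ : Iso ι q L j), ∃ W : Submodule E (Fin n → E), j ≤ Module.finrank E W ∧
      ∀ x ∈ W, SolH ι q L x ∧ bv (q.map ι) (a + T • (ι ∘ b)) ⬝ᵥ x = 0 := by
  intro j
  induction j with
  | zero =>
    intro F E _ _ ι q b a T hz hq L h
    refine ⟨⊥, by simp, fun x hx => ?_⟩
    rw [(Submodule.mem_bot E).1 hx]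
    exact ⟨SolH.zero, by simp⟩
  | succ j ih =>
    intro F E _ _ ι q b a T hz hq L h
    rcases Nat.eq_zero_or_pos j with rfl | hj
    · obtain ⟨f, hf0, hf⟩ := iso_one.1 h
      obtain ⟨g, hg0, hg, hg2⟩ := lemA hz hq L f hf0 hf
      refine ⟨E ∙ g, by rw [finrank_span_singleton hg0], fun y hy => ?_⟩
      obtain ⟨c, rfl⟩ := Submodule.mem_span_singleton.1 hy
      exact ⟨hg.smul c, by rw [dotProduct_smul, hg2, smul_zero]⟩
    · let αF := algebraMap (MvPolynomial (Fin n) F) (FractionRing (MvPolynomial (Fin n) F))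
      let αE := algebraMap (MvPolynomial (Fin n) E) (FractionRing (MvPolynomial (Fin n) E))
      have hinj : Function.Injective (αE.comp (MvPolynomial.map ι)) := by
        rw [RingHom.coe_comp]
        exact (IsFractionRing.injective _ _).comp (MvPolynomial.map_injective _ ι.injective)
      let ι' : FractionRing (MvPolynomial (Fin n) F) →+* FractionRing (MvPolynomial (Fin n) E) :=
        IsFractionRing.lift hinj
      have hι : ∀ p, ι' (αF p) = αE (MvPolynomial.map ι p) :=
        fun p => IsFractionRing.lift_algebraMap hinj p
      have hι' : ι'.comp αF = αE.comp (MvPolynomial.map ι) := RingHom.ext hι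
      have hcC : (ι'.comp αF).comp MvPolynomial.C = (αE.comp MvPolynomial.C).comp ι := by
        ext; simp [hι]
      have h1 := h.map (αE.comp MvPolynomial.C)
      rw [← hcC] at h1
      obtain ⟨W, hW1, hW2⟩ := h1.hyper (dotProductEquiv _ (Fin n)
        ((ι'.comp αF) ∘ MvPolynomial.X))
      have h2 : Iso ι' ((q.map MvPolynomial.C).map αF) ((fun l => αF ∘ l) '' gL L) j := by
        rw [← iso_comp]
        refine ⟨W, hW1, fun x hx => ?_⟩
        rw [solH_gL]
        exact hW2 x hx
      obtain ⟨V, hV1, hV2⟩ := ih (hz.ext ι' hι') (aniso_ext hq) _ h2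
      let x0 := a + T • (ι ∘ b)
      have hx0 : αE ∘ (MvPolynomial.C ∘ a) + αE (MvPolynomial.C T) •
          (ι' ∘ (αF ∘ (MvPolynomial.C ∘ b))) = (αE.comp MvPolynomial.C) ∘ x0 := by
        funext i; simp [hι, x0]
      have hqm : ((q.map MvPolynomial.C).map αF).map ι' = (q.map ι).map (αE.comp MvPolynomial.C) := by
        ext i j; simp [hι]
      have h3 : Iso αE ((q.map ι).map MvPolynomial.C)
          (gL (insert (bv (q.map ι) x0) ((fun l => ι ∘ l) '' L))) j := by
        refine ⟨V, hV1, fun x hx => ?_⟩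
        obtain ⟨h4, h5⟩ := hV2 x hx
        rw [← solH_comp, solH_gL, hcC, solH_comp] at h4
        rw [hx0, hqm, bv_map] at h5
        obtain ⟨⟨h4, h4'⟩, h6⟩ := h4
        rw [solH_gL]
        refine ⟨⟨h4, ?_⟩, ?_⟩
        · rw [Set.forall_mem_insert]
          exact ⟨h5, h4'⟩
        · rw [← h6]
          congr 1
          funext i
          have : ι' (αF (MvPolynomial.X i)) = αE (MvPolynomial.X i) := by rw [hι, MvPolynomial.map_X]
          exact this.symm
      obtain ⟨U, hU1, hU2⟩ := claimH hj h3
      refine ⟨U, hU1, fun x hx => ?_⟩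
      obtain ⟨h7, h8⟩ := hU2 x hx
      rw [Set.forall_mem_insert] at h8
      refine ⟨?_, h8.1⟩
      have h9 : SolH (RingHom.id E) (q.map ι) ((fun l => ι ∘ l) '' L) x := ⟨h7, h8.2⟩
      rw [← solH_comp] at h9
      exact h9

end claim2b
end S3

namespace S3

section step0
variable {n : ℕ}
open Polynomial

theorem GenZ.lin_ne {F E : Type} [Field F] [Field E]
    {ι : F →+* E} {q : Matrix (Fin n) (Fin n) F} {b : Fin n → F} {a : Fin n → E} {T : E}
    (hz : GenZ ι q b a T) (hq : ∀ x, ev q x = 0 → x = 0) (hn : 2 ≤ n) (l : Fin n → F)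
    (hl : l ≠ 0) : (ι ∘ l) ⬝ᵥ (a + T • (ι ∘ b)) ≠ 0 := by
  intro h0
  rw [dotProduct_add, dotProduct_smul, dot_map, smul_eq_mul] at h0
  let Φ := MvPolynomial.eval₂Hom ι a
  have hΦX : Φ ∘ MvPolynomial.X = a := by funext i; simp [Φ]
  have hΦC : ∀ v : Fin n → F, Φ ∘ (MvPolynomial.C ∘ v) = ι ∘ v := by
    intro v; funext i; simp [Φ]
  have hqm : (q.map MvPolynomial.C).map Φ = q.map ι := by ext; simp [Φ]
  obtain ⟨v, hv0, hv⟩ : ∃ v : Fin n → F, v ≠ 0 ∧ l ⬝ᵥ v = 0 := by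
    have h1 := LinearMap.finrank_range_add_finrank_ker (dotProductEquiv F (Fin n) l)
    have h4 : Module.finrank F (LinearMap.range (dotProductEquiv F (Fin n) l)) ≤ 1 := by
      simpa using Submodule.finrank_le (LinearMap.range (dotProductEquiv F (Fin n) l))
    rw [Module.finrank_fin_fun] at h1
    have h5 : 0 < Module.finrank F (LinearMap.ker (dotProductEquiv F (Fin n) l)) := by omega
    rw [Module.finrank_pos_iff_exists_ne_zero] at h5
    obtain ⟨x, hx⟩ := h5
    exact ⟨x, by simpa using hx, x.2⟩
  have hlb : l ⬝ᵥ b = 0 := by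
    let w : Fin n → MvPolynomial (Fin n) F := (MvPolynomial.C (l ⬝ᵥ b) : MvPolynomial (Fin n) F) •
        (MvPolynomial.X : Fin n → MvPolynomial (Fin n) F)
      + (- ((MvPolynomial.C ∘ l) ⬝ᵥ (MvPolynomial.X : Fin n → MvPolynomial (Fin n) F))) • (MvPolynomial.C ∘ b)
    have hw : Φ ∘ w = ι (l ⬝ᵥ b) • (a + T • (ι ∘ b)) := by
      have h1 : Φ ∘ w = ι (l ⬝ᵥ b) • a + (- ((ι ∘ l) ⬝ᵥ a)) • (ι ∘ b) := by
        rw [← hΦX, ← hΦC, ← hΦC, dot_map]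
        funext i
        simp [w, Φ]
      have h2 : (ι ∘ l) ⬝ᵥ a = - (T * ι (l ⬝ᵥ b)) := by linear_combination h0
      rw [h1, h2]
      funext i
      simp
      ring
    have h1 : ev (q.map MvPolynomial.C) w = 0 := by
      apply hz.indep
      change Φ _ = Φ _
      rw [← ev_map, hqm, hw, ev_smul, hz.zero, mul_zero, map_zero]
    have h2 := ev_map (MvPolynomial.eval v) (q.map MvPolynomial.C) w
    have h3 : (q.map MvPolynomial.C).map (MvPolynomial.eval v) = q := by ext; simp
    have h4 : MvPolynomial.eval v ∘ w = (l ⬝ᵥ b) • v := by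
      have h6 : MvPolynomial.eval v ∘ (MvPolynomial.X : Fin n → MvPolynomial (Fin n) F) = v := by
        funext i; simp
      have h7 : MvPolynomial.eval v ∘ (MvPolynomial.C ∘ l) = l := by
        funext i; simp
      have h5 : MvPolynomial.eval v ((MvPolynomial.C ∘ l) ⬝ᵥ MvPolynomial.X) = 0 := by
        rw [← dot_map, h6, h7, hv]
      funext i
      simp [w, h5]
    rw [h1, map_zero, h3, h4] at h2
    have := hq _ h2
    exact (smul_eq_zero.1 this).resolve_right hv0
  rw [hlb, map_zero, mul_zero, add_zero] at h0
  have h1 : (MvPolynomial.C ∘ l) ⬝ᵥ (MvPolynomial.X : Fin n → MvPolynomial (Fin n) F) = 0 := by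
    apply hz.indep
    change Φ _ = Φ _
    rw [← dot_map, hΦC, hΦX, h0, map_zero]
  apply hl
  funext i
  have h2 := congrArg (MvPolynomial.eval (Pi.single i 1 : Fin n → F)) h1
  simpa [dotProduct, Pi.single_apply] using h2

theorem claim2c {F E : Type} [Field F] [Field E]
    {ι : F →+* E} {q : Matrix (Fin n) (Fin n) F} {b : Fin n → F} {a : Fin n → E} {T : E}
    (hz : GenZ ι q b a T) (hq : ∀ x, ev q x = 0 → x = 0) (hn : 2 ≤ n) (l : Fin n → F)
    (hl : l ≠ 0) {j : ℕ} (h : Iso ι q {l} j) : Iso ι q ∅ (j + 1) := by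
  obtain ⟨W, h1, h2⟩ := claim2b j hz hq _ h
  refine Iso.extend (W := W) h1 (fun x hx => ⟨(h2 x hx).1.1, by simp⟩)
    (e := a + T • (ι ∘ b)) ?_ ⟨hz.zero, by simp⟩ (fun x hx => (h2 x hx).2)
  intro hx
  exact hz.lin_ne hq hn l hl ((h2 _ hx).1.2 l rfl)

theorem polyAniso {F : Type} [Field F] {q : Matrix (Fin n) (Fin n) F}
    (hq : ∀ x, ev q x = 0 → x = 0) (P : Fin n → F[X]) (hP : ev (q.map C) P = 0) : P = 0 := by
  by_contra h0
  have h1 : Iso ((algebraMap F[X] (FractionRing F[X])).comp C) q ∅ 1 := by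
    rw [iso_one]
    refine ⟨algebraMap F[X] (FractionRing F[X]) ∘ P, ?_, ?_, by simp⟩
    · intro h; apply h0
      funext i
      exact IsFractionRing.injective F[X] (FractionRing F[X]) (by simpa using congrFun h i)
    · have : q.map ((algebraMap F[X] (FractionRing F[X])).comp C) =
        (q.map C).map (algebraMap F[X] (FractionRing F[X])) := by ext; simp
      rw [this, ev_map, hP, map_zero]
  obtain ⟨x, hx0, hx, -⟩ := iso_one.1 (h1.spec (Polynomial.evalRingHom (0 : F)))
  refine hx0 (hq x ?_)
  rw [← hx]; congr 1; ext; simp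

theorem step0 {F K : Type} [Field F] [Field K] (τ : F →+* K) (q : Matrix (Fin n) (Fin n) F)
    (hq : ∀ x, ev q x = 0 → x = 0) (x : Fin n → K) (hx0 : x ≠ 0) (hx : ev (q.map τ) x = 0) :
    ∃ (F1 : Type) (_ : Field F1) (σ : F →+* F1) (π : F1[X]) (v : Fin n → F1[X]) (h : F1[X])
      (g : AdjoinRoot π →+* K), (∀ x, ev (q.map σ) x = 0 → x = 0) ∧ Irreducible π ∧
      ev ((q.map σ).map C) v = π * h ∧ h ≠ 0 ∧ ¬ π ∣ h ∧
      g.comp ((AdjoinRoot.of π).comp σ) = τ := by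
  classical
  let _ := τ.toAlgebra
  let Fs : Finset (Fin n) → IntermediateField F K := fun s => IntermediateField.adjoin F (x '' s)
  let Good : Finset (Fin n) → Prop := fun s => ∀ y : Fin n → K, (∀ i, y i ∈ Fs s) →
    ev (q.map τ) y = 0 → y = 0
  have hg0 : Good ∅ := by
    intro y hy hy2
    have : ∀ i, ∃ z, τ z = y i := by
      intro i
      have := hy i
      simp only [Fs, Finset.coe_empty, Set.image_empty, IntermediateField.adjoin_empty,
        IntermediateField.mem_bot] at this
      exact this
    choose z hz using this
    have hz' : τ ∘ z = y := funext hz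
    rw [← hz', ev_map] at hy2
    have h1 := hq z ((map_eq_zero τ).1 hy2)
    rw [← hz', h1]; funext i; simp
  have hg1 : ¬ Good Finset.univ := by
    intro h
    refine hx0 (h x (fun i => IntermediateField.subset_adjoin _ _ ⟨i, by simp, rfl⟩) hx)
  obtain ⟨s, hs⟩ := Set.Finite.exists_maximal (s := {s | Good s}) (Set.toFinite _) ⟨∅, hg0⟩
  have hsg : Good s := hs.1
  obtain ⟨j, hj⟩ : ∃ j, j ∉ s := by
    by_contra hcon
    push Not at hcon
    exact hg1 (Finset.eq_univ_of_forall hcon ▸ hsg)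
  have hns : ¬ Good (insert j s) := by
    intro h
    exact hj (hs.2 h (Finset.subset_insert _ _) (Finset.mem_insert_self _ _))
  let θ := x j
  let F1 := Fs s
  have hFF : Fs (insert j s) = (IntermediateField.adjoin F1 {θ}).restrictScalars F := by
    rw [IntermediateField.adjoin_adjoin_left]
    simp only [Fs]
    congr 1
    rw [Finset.coe_insert, Set.image_insert_eq, Set.union_comm]; rfl
  simp only [Good] at hns
  push Not at hns
  obtain ⟨y, hy1, hy2, hy0⟩ := hns
  let σ : F →+* F1 := algebraMap F F1
  have hστ : (algebraMap F1 K).comp σ = τ := by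
    ext; rfl
  have hqσ : (q.map σ).map (algebraMap F1 K) = q.map τ := by
    ext; rfl
  have han : ∀ z : Fin n → F1, ev (q.map σ) z = 0 → z = 0 := by
    intro z hz
    have h1 : ev (q.map τ) (algebraMap F1 K ∘ z) = 0 := by
      rw [← hqσ, ev_map, hz, map_zero]
    have h2 := hsg _ (fun i => (z i).2) h1
    funext i
    exact Subtype.ext (congrFun h2 i)
  have hfr : ∀ i, ∃ r t : F1[X], aeval θ t ≠ 0 ∧ y i * aeval θ t = aeval θ r := by
    intro i
    have := hy1 i
    rw [hFF, IntermediateField.mem_restrictScalars, IntermediateField.mem_adjoin_simple_iff] at this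
    obtain ⟨r, t, h⟩ := this
    by_cases ht : aeval θ t = 0
    · refine ⟨0, 1, by simp, ?_⟩
      rw [h, ht]; simp
    · refine ⟨r, t, ht, ?_⟩
      rw [h, div_mul_cancel₀ _ ht]
  choose r t ht0 hrt using hfr
  let P : Fin n → F1[X] := fun i => r i * ∏ k ∈ Finset.univ.erase i, t k
  let D : K := ∏ k, aeval θ (t k)
  have hD : D ≠ 0 := Finset.prod_ne_zero_iff.2 fun k _ => ht0 k
  have hP : ∀ i, aeval θ (P i) = D * y i := by
    intro i
    simp only [P, D, map_mul, map_prod]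
    rw [← hrt, ← Finset.mul_prod_erase Finset.univ (fun k => aeval θ (t k)) (Finset.mem_univ i)]
    ring
  let Θ : F1[X] →+* K := (aeval θ : F1[X] →ₐ[F1] K).toRingHom
  have hqΘ : ((q.map σ).map C).map Θ = q.map τ := by
    ext i k
    simp only [Matrix.map_apply, Θ]
    have : (aeval θ : F1[X] →ₐ[F1] K) (C (σ (q i k))) = algebraMap F1 K (σ (q i k)) := aeval_C _ _
    exact this
  have hPy : Θ ∘ P = D • y := funext hP
  have hPz : Θ (ev ((q.map σ).map C) P) = 0 := by
    rw [← ev_map, hqΘ, hPy, ev_smul, hy2, mul_zero]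
  have hPne : P ≠ 0 := by
    intro h
    apply hy0
    have h1 : D • y = 0 := by rw [← hPy, h]; funext i; simp
    exact (smul_eq_zero.1 h1).resolve_left hD
  have hinteg : IsIntegral F1 θ := by
    rw [← isAlgebraic_iff_isIntegral]
    refine ⟨ev ((q.map σ).map C) P, fun h => hPne (polyAniso han P h), hPz⟩
  let π := minpoly F1 θ
  have hmon : π.Monic := minpoly.monic hinteg
  have hirr : Irreducible π := minpoly.irreducible hinteg
  let v : Fin n → F1[X] := fun i => P i %ₘ π
  have hΘπ : Θ π = 0 := minpoly.aeval F1 θ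
  have hvP : Θ ∘ v = Θ ∘ P := by
    funext i
    have h1 := congrArg Θ (modByMonic_add_div (P i) π)
    rw [map_add, map_mul, hΘπ, zero_mul, add_zero] at h1
    exact h1
  have hvne : v ≠ 0 := by
    intro h
    apply hy0
    have h1 : D • y = 0 := by rw [← hPy, ← hvP, h]; funext i; simp
    exact (smul_eq_zero.1 h1).resolve_left hD
  have hvz : Θ (ev ((q.map σ).map C) v) = 0 := by
    rw [← ev_map, hqΘ, hvP, hPy, ev_smul, hy2, mul_zero]
  obtain ⟨h, hh⟩ : π ∣ ev ((q.map σ).map C) v := minpoly.dvd F1 θ hvz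
  have hev0 : ev ((q.map σ).map C) v ≠ 0 := fun h => hvne (polyAniso han v h)
  have hh0 : h ≠ 0 := by
    rintro rfl; apply hev0; rw [hh, mul_zero]
  have hdpos : 0 < π.natDegree := hirr.natDegree_pos
  have hdeg : (ev ((q.map σ).map C) v).natDegree ≤ 2 * (π.natDegree - 1) := by
    have hvi : ∀ i, (v i).natDegree ≤ π.natDegree - 1 := by
      intro i
      have := natDegree_modByMonic_lt (P i) hmon (fun h => by rw [h] at hdpos; simp at hdpos)
      simp only [v]; omega
    unfold ev
    refine natDegree_sum_le_of_forall_le _ _ fun i _ => natDegree_sum_le_of_forall_le _ _ fun k _ => ?_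
    simp only [Matrix.map_apply]
    refine natDegree_mul_le.trans ?_
    have h1 : (C (σ (q i k)) * v i).natDegree ≤ (v i).natDegree := natDegree_C_mul_le _ _
    have h2 := hvi i
    have h3 := hvi k
    omega
  have hndvd : ¬ π ∣ h := by
    intro hd
    have h1 := natDegree_le_of_dvd hd hh0
    rw [hh, natDegree_mul hmon.ne_zero hh0] at hdeg
    omega
  have hl : eval₂ (algebraMap F1 K) θ π = 0 := by
    rw [← aeval_def]; exact minpoly.aeval F1 θ
  have hl2 : ∀ z, AdjoinRoot.lift (algebraMap F1 K) θ hl (AdjoinRoot.of π z) = algebraMap F1 K z :=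
    fun z => AdjoinRoot.lift_of hl
  refine ⟨F1, inferInstance, σ, π, v, h, AdjoinRoot.lift (algebraMap F1 K) θ hl, han, hirr, hh, hh0,
    hndvd, ?_⟩
  rw [← hστ]
  exact RingHom.ext fun z => hl2 (σ z)

end step0
end S3

namespace S3

section step1
variable {n : ℕ}
open Polynomial

theorem exists_frac (R : Type) [CommRing R] [IsDomain R] : ∃ (Q : Type) (_ : Field Q)
    (_ : Algebra R Q), IsFractionRing R Q :=
  ⟨FractionRing R, inferInstance, inferInstance, inferInstance⟩

theorem locSpec {A C0 E κ : Type} [CommRing A] [CommRing C0] [IsDomain C0] [IsNoetherianRing C0]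
    [Field E] [Algebra C0 E] [IsFractionRing C0 E] [Field κ] (lam : C0 →+* κ) (ρ p u w : C0)
    (hrel : u * p = ρ * w) (hu : lam u ≠ 0) (hρ : lam ρ = 0)
    (hgen : ∀ c, lam c = 0 → ∃ s t, c = p * s + ρ * t) {f : A →+* C0}
    {q : Matrix (Fin n) (Fin n) A} {L : Set (Fin n → A)} {r : ℕ}
    (h : Iso ((algebraMap C0 E).comp f) q L r) : Iso (lam.comp f) q L r := by
  have hP : (RingHom.ker lam).IsPrime := RingHom.ker_isPrime _
  let R := Localization.AtPrime (RingHom.ker lam)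
  have hdom : IsDomain R :=
    IsLocalization.isDomain_localization (Ideal.primeCompl_le_nonZeroDivisors _)
  have hnoe : IsNoetherianRing R :=
    IsLocalization.isNoetherianRing (RingHom.ker lam).primeCompl R inferInstance
  let al := algebraMap C0 R
  have hinj : Function.Injective al :=
    IsLocalization.injective _ (Ideal.primeCompl_le_nonZeroDivisors (RingHom.ker lam))
  have hmax : IsLocalRing.maximalIdeal R = Ideal.span {al ρ} := by
    apply le_antisymm
    · rw [← Localization.AtPrime.map_eq_maximalIdeal, Ideal.map_le_iff_le_comap]
      intro c hc
      obtain ⟨s, t, rfl⟩ := hgen c hc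
      rw [Ideal.mem_comap, Ideal.mem_span_singleton]
      have hunit : IsUnit (al u) := IsLocalization.map_units R
        (⟨u, hu⟩ : (RingHom.ker lam).primeCompl)
      have h1 : al ρ ∣ al p := by
        rw [← hunit.dvd_mul_left, ← map_mul, hrel, map_mul]
        exact dvd_mul_right _ _
      change al ρ ∣ al _
      rw [map_add, map_mul, map_mul]
      exact dvd_add (h1.mul_right _) (dvd_mul_right _ _)
    · rw [Ideal.span_singleton_le_iff_mem, ← Localization.AtPrime.map_eq_maximalIdeal]
      exact Ideal.mem_map_of_mem _ hρ
  have hpid : IsPrincipalIdealRing R := by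
    refine ((tfae_of_isNoetherianRing_of_isLocalRing_of_isDomain R).out 0 4).2 ?_
    exact ⟨al ρ, hmax⟩
  obtain ⟨Q, _, _, _⟩ := exists_frac R
  have h1 : Iso (((algebraMap R Q).comp al).comp f) q L r := by
    refine h.liftInj _ ?_
    rw [RingHom.coe_comp]
    exact (IsFractionRing.injective R Q).comp hinj
  rw [RingHom.comp_assoc] at h1
  have hunit : ∀ y : (RingHom.ker lam).primeCompl, IsUnit (lam y) := by
    intro y
    exact isUnit_iff_ne_zero.2 y.2
  let res : R →+* κ := IsLocalization.lift hunit
  have h2 := h1.spec res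
  have h3 : res.comp (al.comp f) = lam.comp f := by
    ext x
    exact IsLocalization.lift_eq hunit (f x)
  rwa [h3] at h2

variable {k : Type} [Field k]

/-- coefficients embedding -/
noncomputable abbrev cc (n : ℕ) (k : Type) [Field k] : k →+* MvPolynomial (Fin n) k[X] := MvPolynomial.C.comp C

/-- the quadratic polynomial defining the generic zero -/
noncomputable def PP (q : Matrix (Fin n) (Fin n) k) (v : Fin n → k[X]) :
    (MvPolynomial (Fin n) k[X])[X] :=
  X ^ 2 + C (bv (q.map (cc n k)) (MvPolynomial.C ∘ v) ⬝ᵥ MvPolynomial.X) * X +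
    C (ev (q.map (cc n k)) MvPolynomial.X * MvPolynomial.C (ev (q.map C) v))

theorem PP_monic (q : Matrix (Fin n) (Fin n) k) (v : Fin n → k[X]) : (PP q v).Monic := by
  unfold PP; monicity!

theorem PP_natDegree (q : Matrix (Fin n) (Fin n) k) (v : Fin n → k[X]) : (PP q v).natDegree = 2 := by
  unfold PP; compute_degree!

theorem aniso_frac {q : Matrix (Fin n) (Fin n) k} (hq : ∀ x, ev q x = 0 → x = 0) :
    ∀ x, ev (q.map ((algebraMap k[X] (FractionRing k[X])).comp C)) x = 0 → x = 0 := by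
  intro x hx
  by_contra h0
  have h1 : Iso ((algebraMap k[X] (FractionRing k[X])).comp C) q ∅ 1 := by
    rw [iso_one]
    exact ⟨x, h0, hx, by simp⟩
  obtain ⟨x, hx0, hx, -⟩ := iso_one.1 (h1.spec (Polynomial.evalRingHom (0 : k)))
  refine hx0 (hq x ?_)
  rw [← hx]; congr 1; ext; simp

theorem aniso_cc' {A F2 : Type} [CommRing A] [Field F2] {al : A →+* F2}
    (hal : Function.Injective al) {q : Matrix (Fin n) (Fin n) A}
    (hq : ∀ x, ev (q.map al) x = 0 → x = 0) :
    ∀ x : Fin n → MvPolynomial (Fin n) A, ev (q.map MvPolynomial.C) x = 0 → x = 0 := by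
  intro x hx
  let β := algebraMap (MvPolynomial (Fin n) F2) (FractionRing (MvPolynomial (Fin n) F2))
  let g : MvPolynomial (Fin n) A →+* FractionRing (MvPolynomial (Fin n) F2) :=
    β.comp (MvPolynomial.map al)
  have hg : Function.Injective g := by
    simp only [g]
    rw [RingHom.coe_comp]
    exact (IsFractionRing.injective _ _).comp (MvPolynomial.map_injective _ hal)
  have h2 : ((q.map al).map MvPolynomial.C).map β = (q.map MvPolynomial.C).map g := by
    ext i j
    simp only [Matrix.map_apply, g, RingHom.comp_apply, MvPolynomial.map_C]
  have h3 : ev (((q.map al).map MvPolynomial.C).map β) (g ∘ x) = 0 := by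
    rw [h2, ev_map, hx, map_zero]
  have h1 := aniso_ext hq (g ∘ x) h3
  funext i
  apply hg
  have := congrFun h1 i
  rw [Pi.zero_apply, map_zero]
  exact this

theorem aniso_cc {q : Matrix (Fin n) (Fin n) k} (hq : ∀ x, ev q x = 0 → x = 0) :
    ∀ x, ev (q.map (cc n k)) x = 0 → x = 0 := by
  have h1 : ∀ x, ev ((q.map C).map (algebraMap k[X] (FractionRing k[X]))) x = 0 → x = 0 :=
    aniso_frac hq
  exact aniso_cc' (IsFractionRing.injective _ _) h1

theorem PP_prime {q : Matrix (Fin n) (Fin n) k} (hq : ∀ x, ev q x = 0 → x = 0) (hn : 2 ≤ n)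
    {v : Fin n → k[X]} (hv : ev (q.map C) v ≠ 0) : Prime (PP q v) := by
  rw [← irreducible_iff_prime, (PP_monic q v).irreducible_iff_roots_eq_zero_of_degree_le_three
    (by rw [PP_natDegree]) (by rw [PP_natDegree]; norm_num)]
  rw [Multiset.eq_zero_iff_forall_notMem]
  intro y hy
  rw [mem_roots (PP_monic q v).ne_zero, IsRoot] at hy
  set β := bv (q.map (cc n k)) (MvPolynomial.C ∘ v) ⬝ᵥ MvPolynomial.X with hβ
  set φa := ev (q.map (cc n k)) MvPolynomial.X with hφa
  have hy' : y ^ 2 + β * y + φa * MvPolynomial.C (ev (q.map C) v) = 0 := by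
    rw [← hy]; simp [PP, hβ, hφa]
  have hqcc : q.map (cc n k) = (q.map C).map MvPolynomial.C := by ext; simp
  have hevb : ev (q.map (cc n k)) (MvPolynomial.C ∘ v) = MvPolynomial.C (ev (q.map C) v) := by
    rw [hqcc, ev_map]
  let φb : MvPolynomial (Fin n) k[X] := MvPolynomial.C (ev (q.map C) v)
  have hφb : φb ≠ 0 := fun h => hv (MvPolynomial.C_eq_zero.1 h)
  have h1 : ev (q.map (cc n k)) (φb • MvPolynomial.X + y • (MvPolynomial.C ∘ v)) = 0 := by
    rw [ev_add, ev_smul, ev_smul, bv_smul, dotProduct_smul, smul_dotProduct, bv_comm, ← hβ, hevb,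
      ← hφa]
    simp only [smul_eq_mul]
    linear_combination φb * hy'
  have h2 := aniso_cc hq _ h1
  have h3 : ∀ i, φb * MvPolynomial.X i + y * MvPolynomial.C (v i) = 0 := fun i => congrFun h2 i
  apply hv
  have hv0 : v = 0 := by
    funext j
    obtain ⟨i, hij⟩ : ∃ i : Fin n, i ≠ j := by
      have : Nontrivial (Fin n) := Fin.nontrivial_iff_two_le.2 hn
      exact exists_ne j
    have h4 : φb * (MvPolynomial.X i * MvPolynomial.C (v j) - MvPolynomial.X j * MvPolynomial.C (v i)) = 0 := by
      linear_combination MvPolynomial.C (v j) * h3 i - MvPolynomial.C (v i) * h3 j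
    have h5 := (mul_eq_zero.1 h4).resolve_left hφb
    have h6 := congrArg (MvPolynomial.eval (Pi.single i 1 : Fin n → k[X])) h5
    simpa [Pi.single_apply, hij.symm] using h6
  rw [hv0, ev_zero]

end step1
end S3

namespace S3

section step1
variable {n : ℕ}
open Polynomial

theorem genZ_abs {A C0 E : Type} [CommRing A] [IsDomain A] [CommRing C0] [IsDomain C0]
    [Field E] [Algebra C0 E] [IsFractionRing C0 E] (q : Matrix (Fin n) (Fin n) A)
    (v : Fin n → A) (hv : ev q v ≠ 0) (om : MvPolynomial (Fin n) A →+* C0)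
    (hom : Function.Injective om) (ρ : C0)
    (hrel : ρ ^ 2 + om (bv (q.map MvPolynomial.C) (MvPolynomial.C ∘ v) ⬝ᵥ MvPolynomial.X) * ρ +
      om (ev (q.map MvPolynomial.C) MvPolynomial.X * MvPolynomial.C (ev q v)) = 0)
    (hgen : ∀ c, ∃ p : (MvPolynomial (Fin n) A)[X], c = eval₂ om ρ p)
    (ι : FractionRing A →+* E)
    (hι : ∀ x, ι (algebraMap A (FractionRing A) x) = algebraMap C0 E (om (MvPolynomial.C x))) :
    GenZ ι (q.map (algebraMap A (FractionRing A))) (algebraMap A (FractionRing A) ∘ v)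
      (fun i => algebraMap C0 E (om (MvPolynomial.X i)))
      (algebraMap C0 E ρ / algebraMap C0 E (om (MvPolynomial.C (ev q v)))) := by
  set αF := algebraMap A (FractionRing A) with hαF
  set αE := algebraMap C0 E with hαE
  have hiE : Function.Injective αE := IsFractionRing.injective _ _
  let g : MvPolynomial (Fin n) A →+* E := αE.comp om
  have hg : Function.Injective g := by
    simp only [g]; rw [RingHom.coe_comp]; exact hiE.comp hom
  have hφb : g (MvPolynomial.C (ev q v)) ≠ 0 := by
    intro h
    apply hv
    apply MvPolynomial.C_injective (Fin n) A
    apply hg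
    rw [h]; simp
  refine ⟨?_, ?_, ?_⟩
  · rw [injective_iff_map_eq_zero]
    intro P hP
    obtain ⟨d, hd0, P0, h1⟩ := clearDen P
    have h2 : (MvPolynomial.eval₂Hom ι (fun i => αE (om (MvPolynomial.X i)))).comp
        (MvPolynomial.map αF) = g := by
      apply MvPolynomial.ringHom_ext
      · intro p; simp [hι, g]
      · intro i; simp [g]
    have h3 := RingHom.congr_fun h2 P0
    simp only [RingHom.comp_apply] at h3
    rw [hαF, ← h1, map_mul, hP, zero_mul] at h3
    have h4 : P0 = 0 := hg (by rw [← h3]; simp)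
    rw [h4, map_zero] at h1
    refine (mul_eq_zero.1 h1).resolve_right ?_
    refine mt MvPolynomial.C_eq_zero.1 ?_
    exact (map_ne_zero_iff _ (IsFractionRing.injective _ _)).2 hd0
  · have hqm : (q.map αF).map ι = (q.map MvPolynomial.C).map g := by
      ext i j; simp [hι, g]
    have hb : ι ∘ (αF ∘ v) = g ∘ (MvPolynomial.C ∘ v) := by
      funext i; simp [hι, g]
    have ha : (fun i => αE (om (MvPolynomial.X i))) = g ∘ (MvPolynomial.X : Fin n → _) := rfl
    have hr := congrArg αE hrel
    simp only [map_add, map_mul, map_pow, map_zero] at hr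
    rw [hqm, hb, ha, ev_add, ev_smul, ev_map, ev_map, ev_map, dotProduct_smul, bv_comm, bv_map,
      dot_map, smul_eq_mul]
    simp only [g, RingHom.comp_apply] at hφb ⊢
    field_simp
    linear_combination hr
  · intro S hS1 hS2 hS3 e
    have h3 : ∀ p, g p ∈ S := by
      intro p
      induction p using MvPolynomial.induction_on with
      | C x =>
        have := hS1 (αF x)
        rw [hι] at this; exact this
      | add p q hp hq => rw [map_add]; exact S.add_mem hp hq
      | mul_X p i hp => rw [map_mul]; exact S.mul_mem hp (hS2 i)
    have h4 : αE ρ ∈ S := by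
      have h5 := S.mul_mem hS3 (h3 (MvPolynomial.C (ev q v)))
      have h6 : αE ρ / αE (om (MvPolynomial.C (ev q v))) * g (MvPolynomial.C (ev q v)) = αE ρ :=
        div_mul_cancel₀ _ hφb
      rwa [h6] at h5
    have h5 : ∀ c, αE c ∈ S := by
      intro c
      obtain ⟨p, rfl⟩ := hgen c
      rw [hom_eval₂]
      induction p using Polynomial.induction_on' with
      | add p q hp hq => rw [eval₂_add]; exact S.add_mem hp hq
      | monomial k a =>
        rw [eval₂_monomial]
        exact S.mul_mem (h3 a) (S.pow_mem h4 k)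
    obtain ⟨x, y, hy, rfl⟩ := IsFractionRing.div_surjective (A := C0) e
    exact S.div_mem (h5 x) (h5 y)

theorem step1 {k : Type} [Field k] {q : Matrix (Fin n) (Fin n) k} (hq : ∀ x, ev q x = 0 → x = 0)
    (hn : 2 ≤ n) {π : k[X]} [hfact : Fact (Irreducible π)] {v : Fin n → k[X]} {h : k[X]}
    (hv : ev (q.map C) v = π * h) (hh : h ≠ 0) (hd : ¬ π ∣ h) :
    ∃ (F2 E : Type) (_ : Field F2) (_ : Field E) (μ : k →+* F2) (ι : F2 →+* E) (b : Fin n → F2)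
      (a : Fin n → E) (T : E), GenZ ι (q.map μ) b a T ∧ (∀ x, ev (q.map μ) x = 0 → x = 0) ∧
      ∀ r, Iso (ι.comp μ) q ∅ r → Iso (AdjoinRoot.of π) q ∅ r := by
  have hπ : Irreducible π := hfact.out
  have hv0 : ev (q.map C) v ≠ 0 := by rw [hv]; exact mul_ne_zero hπ.ne_zero hh
  have hPP := PP_prime hq hn hv0
  let C0 := AdjoinRoot (PP q v)
  have hdom : IsDomain C0 := AdjoinRoot.isDomain_of_prime hPP
  have hnoe : IsNoetherianRing C0 := inferInstance
  let om : MvPolynomial (Fin n) k[X] →+* C0 := AdjoinRoot.of (PP q v)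
  have hom : Function.Injective om := by
    apply AdjoinRoot.of.injective_of_degree_ne_zero
    rw [degree_eq_natDegree hPP.ne_zero, PP_natDegree]
    norm_num
  let ρ : C0 := AdjoinRoot.root (PP q v)
  have hroot : eval₂ om ρ (PP q v) = 0 := AdjoinRoot.eval₂_root (PP q v)
  have hgen : ∀ c : C0, ∃ p : (MvPolynomial (Fin n) k[X])[X], c = eval₂ om ρ p := by
    intro c
    obtain ⟨p, rfl⟩ := AdjoinRoot.mk_surjective c
    refine ⟨p, ?_⟩
    rw [← AdjoinRoot.aeval_eq, aeval_def]
    rfl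
  have hqcc : q.map (cc n k) = (q.map C).map MvPolynomial.C := by ext; simp
  obtain ⟨β, hβ⟩ : ∃ β, β = bv ((q.map C).map MvPolynomial.C) (MvPolynomial.C ∘ v) ⬝ᵥ
    (MvPolynomial.X : Fin n → MvPolynomial (Fin n) k[X]) := ⟨_, rfl⟩
  obtain ⟨φa, hφa⟩ : ∃ φa, φa = ev ((q.map C).map MvPolynomial.C)
    (MvPolynomial.X : Fin n → MvPolynomial (Fin n) k[X]) := ⟨_, rfl⟩
  have hPPe : PP q v = X ^ 2 + C β * X + C (φa * MvPolynomial.C (ev (q.map C) v)) := by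
    rw [hβ, hφa, ← hqcc]; rfl
  have hevP : ∀ {S : Type} [CommRing S] (f : MvPolynomial (Fin n) k[X] →+* S) (y : S),
      eval₂ f y (PP q v) = y ^ 2 + f β * y + f (φa * MvPolynomial.C (ev (q.map C) v)) := by
    intro S _ f y
    rw [hPPe, eval₂_add, eval₂_add, eval₂_mul, eval₂_C, eval₂_C, eval₂_X, eval₂_X_pow]
  have hrel : ρ ^ 2 + om β * ρ + om (φa * MvPolynomial.C (ev (q.map C) v)) = 0 := by
    have h1 := hroot
    rw [hevP] at h1
    exact h1
  obtain ⟨E, _, _, _⟩ := exists_frac C0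
  have hg : Function.Injective ((algebraMap C0 E).comp (om.comp MvPolynomial.C)) := by
    rw [RingHom.coe_comp, RingHom.coe_comp]
    exact (IsFractionRing.injective _ _).comp (hom.comp (MvPolynomial.C_injective _ _))
  let ι : FractionRing k[X] →+* E := IsFractionRing.lift hg
  have hι : ∀ x, ι (algebraMap k[X] (FractionRing k[X]) x) =
      algebraMap C0 E (om (MvPolynomial.C x)) := fun x => IsFractionRing.lift_algebraMap hg x
  have hz := genZ_abs (E := E) (q.map C) v hv0 om hom ρ (by rw [← hβ, ← hφa]; exact hrel) hgen ι hι
  refine ⟨FractionRing k[X], E, inferInstance, inferInstance,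
    (algebraMap k[X] (FractionRing k[X])).comp C, ι, _, _, _, hz, aniso_frac hq, ?_⟩
  intro r hr
  let K' := AdjoinRoot π
  let αk := algebraMap (MvPolynomial (Fin n) K') (FractionRing (MvPolynomial (Fin n) K'))
  have hαk : Function.Injective αk := IsFractionRing.injective _ _
  let δ : MvPolynomial (Fin n) k[X] →+* FractionRing (MvPolynomial (Fin n) K') :=
    αk.comp (MvPolynomial.map (AdjoinRoot.mk π))
  have hδC : ∀ x, δ (MvPolynomial.C x) = αk (MvPolynomial.C (AdjoinRoot.mk π x)) := by
    intro x; simp only [δ, RingHom.comp_apply, MvPolynomial.map_C]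
  have hδ0 : δ (MvPolynomial.C (ev (q.map C) v)) = 0 := by
    rw [hδC, hv, map_mul, AdjoinRoot.mk_self, zero_mul, map_zero, map_zero]
  have hl : eval₂ δ 0 (PP q v) = 0 := by
    rw [hevP, map_mul, hδ0]
    simp
  let lam : C0 →+* FractionRing (MvPolynomial (Fin n) K') := AdjoinRoot.lift δ 0 hl
  have hlo : ∀ x, lam (om x) = δ x := fun x => AdjoinRoot.lift_of hl
  have hlρ : lam ρ = 0 := AdjoinRoot.lift_root hl
  have hf : Iso ((algebraMap C0 E).comp (om.comp (cc n k))) q ∅ r := by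
    have : (algebraMap C0 E).comp (om.comp (cc n k)) =
      ι.comp ((algebraMap k[X] (FractionRing k[X])).comp C) := by
      ext x
      simp only [RingHom.comp_apply, hι]
    rw [this]; exact hr
  have hloc := locSpec lam ρ (om (MvPolynomial.C π)) (om (φa * MvPolynomial.C h)) (-(ρ + om β))
    ?_ ?_ hlρ ?_ hf
  · have h1 : lam.comp (om.comp (cc n k)) = αk.comp (MvPolynomial.C.comp (AdjoinRoot.of π)) := by
      ext x
      simp only [RingHom.comp_apply, hlo, hδC]
      rfl
    rw [h1] at hloc
    have h2 := hloc.specMv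
    have h3 : (MvPolynomial.constantCoeff : MvPolynomial (Fin n) K' →+* K').comp
      (MvPolynomial.C.comp (AdjoinRoot.of π)) = AdjoinRoot.of π := by
      apply RingHom.ext
      intro x
      simp only [RingHom.comp_apply, MvPolynomial.constantCoeff_C]
    rw [h3] at h2
    exact h2
  · have h1 := hrel
    rw [hv, map_mul MvPolynomial.C, map_mul om, map_mul om] at h1
    rw [map_mul om]
    linear_combination h1
  · rw [hlo, map_mul]
    refine mul_ne_zero ?_ ?_
    · intro h0
      have h1 : MvPolynomial.map (AdjoinRoot.mk π) φa = 0 := hαk (by rw [map_zero]; exact h0)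
      have hn0 : 0 < n := by omega
      let i : Fin n := ⟨0, hn0⟩
      have h2 := congrArg (MvPolynomial.eval (Pi.single i 1 : Fin n → K')) h1
      let E1 : MvPolynomial (Fin n) k[X] →+* K' :=
        (MvPolynomial.eval (Pi.single i 1 : Fin n → K')).comp (MvPolynomial.map (AdjoinRoot.mk π))
      have h3 : E1 φa = 0 := by rw [map_zero] at h2; exact h2
      have h4 : E1 ∘ MvPolynomial.X = AdjoinRoot.of π ∘ (Pi.single i 1 : Fin n → k) := by
        funext j
        simp only [E1, Function.comp, RingHom.comp_apply, MvPolynomial.map_X, MvPolynomial.eval_X,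
          Pi.single_apply]
        split_ifs
        · rw [map_one]
        · rw [map_zero]
      have h5 : ((q.map C).map MvPolynomial.C).map E1 = q.map (AdjoinRoot.of π) := by
        ext a b
        simp only [E1, Matrix.map_apply, RingHom.comp_apply, MvPolynomial.map_C, MvPolynomial.eval_C]
        rfl
      rw [hφa, ← ev_map, h4, h5, ev_map, map_eq_zero] at h3
      have h6 := congrFun (hq _ h3) i
      simp at h6
    · rw [hδC]
      intro h0
      apply hd
      rw [← AdjoinRoot.mk_eq_zero]
      exact MvPolynomial.C_injective (Fin n) K' (hαk (by rw [h0, map_zero, map_zero]))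
  · intro c hc
    obtain ⟨p, rfl⟩ := hgen c
    have h1 : eval₂ om ρ p = ρ * eval₂ om ρ p.divX + om (p.coeff 0) := by
      conv_lhs => rw [← X_mul_divX_add p]
      rw [eval₂_add, eval₂_mul, eval₂_X, eval₂_C]
    rw [h1, map_add, map_mul, hlρ, zero_mul, zero_add, hlo] at hc
    have h2 : MvPolynomial.map (AdjoinRoot.mk π) (p.coeff 0) = 0 := hαk (by rw [map_zero]; exact hc)
    rw [← MvPolynomial.C_dvd_iff_map_hom_eq_zero _ π (fun r' => AdjoinRoot.mk_eq_zero)] at h2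
    obtain ⟨s, hs⟩ := h2
    refine ⟨om s, eval₂ om ρ p.divX, ?_⟩
    rw [h1, hs, map_mul]
    ring

end step1
end S3

namespace S3

section combine
variable {n : ℕ}
open Polynomial

theorem iso_comp0 {A A' K : Type} [CommRing A] [CommRing A'] [Field K] {f : A →+* K} {g : A' →+* A}
    {q : Matrix (Fin n) (Fin n) A'} {r : ℕ} :
    Iso (f.comp g) q ∅ r ↔ Iso f (q.map g) ∅ r := by
  rw [iso_comp, Set.image_empty]

theorem combine {F K : Type} [Field F] [Field K] (τ : F →+* K) (q : Matrix (Fin n) (Fin n) F)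
    (hq : ∀ x, ev q x = 0 → x = 0) (hn : 2 ≤ n) (h1 : Iso τ q ∅ 1) :
    ∃ (E : Type) (_ : Field E) (s : F →+* E), (∀ r, Iso s q ∅ r → Iso τ q ∅ r) ∧
      (∀ (l : Fin n → F), l ≠ 0 → ∀ j, Iso s q {l} j → Iso s q ∅ (j + 1)) ∧ Iso s q ∅ 1 := by
  obtain ⟨x, hx0, hx, -⟩ := iso_one.1 h1
  obtain ⟨F1, _, σ, π, v, h, g, hσ, hπ, hv, hh, hd, hg⟩ := step0 τ q hq x hx0 hx
  have : Fact (Irreducible π) := ⟨hπ⟩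
  obtain ⟨F2, E, _, _, μ, ι, b, a, T, hz, hμ, hr⟩ := step1 hσ hn hv hh hd
  have hqq : (q.map σ).map μ = q.map (μ.comp σ) := by ext; simp
  refine ⟨E, inferInstance, (ι.comp μ).comp σ, ?_, ?_, ?_⟩
  · intro r h2
    have h3 := (iso_comp0.2 (hr r (iso_comp0.1 h2))).map g
    rwa [hg] at h3
  · intro l hl j h2
    rw [RingHom.comp_assoc] at h2 ⊢
    rw [iso_comp, Set.image_singleton, ← hqq] at h2
    rw [iso_comp0, ← hqq]
    refine claim2c hz hμ hn _ ?_ h2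
    intro h0
    apply hl
    funext i
    have := congrFun h0 i
    simpa using this
  · rw [RingHom.comp_assoc, iso_comp0, ← hqq, iso_one]
    refine ⟨_, ?_, hz.zero, by simp⟩
    intro h0
    refine hz.lin_ne hμ hn (fun _ => 1) ?_ (by rw [h0, dotProduct_zero])
    intro h3
    simpa using congrFun h3 ⟨0, by omega⟩

end combine
end S3

namespace S3

section assembly

theorem ev_eq_dot {n : ℕ} {A : Type} [CommRing A] (q : Matrix (Fin n) (Fin n) A) (x : Fin n → A) :
    ev q x = x ⬝ᵥ Matrix.mulVec q x := by
  simp only [ev, dotProduct, Matrix.mulVec, Finset.mul_sum]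
  refine Finset.sum_congr rfl fun i _ => Finset.sum_congr rfl fun j _ => by ring

theorem ev_mulVec {m n : ℕ} {A : Type} [CommRing A] (q : Matrix (Fin n) (Fin n) A)
    (M : Matrix (Fin n) (Fin m) A) (x : Fin m → A) :
    ev q (Matrix.mulVec M x) = ev (M.transpose * q * M) x := by
  rw [ev_eq_dot, ev_eq_dot, ← Matrix.mulVec_mulVec, ← Matrix.mulVec_mulVec,
    Matrix.dotProduct_mulVec x, Matrix.vecMul_transpose]

theorem ev_sub_mat {n : ℕ} {A : Type} [CommRing A] (a b : Matrix (Fin n) (Fin n) A) (x : Fin n → A) :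
    ev (a - b) x = ev a x - ev b x := by
  simp only [ev_eq_dot, Matrix.sub_mulVec, dotProduct_sub]

theorem ev_transpose {n : ℕ} {A : Type} [CommRing A] (a : Matrix (Fin n) (Fin n) A) (x : Fin n → A) :
    ev a.transpose x = ev a x := by
  rw [ev_eq_dot, ev_eq_dot, Matrix.mulVec_transpose, dotProduct_comm, Matrix.dotProduct_mulVec]

theorem ev_map_zero {n : ℕ} {F K : Type} [Field F] [Field K] (τ : F →+* K)
    (D : Matrix (Fin n) (Fin n) F) (h : ∀ x, ev D x = 0) (x : Fin n → K) :
    ev (D.map τ) x = 0 := by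
  have h1 : ∀ i, D i i = 0 := by
    intro i
    have := h (Pi.single i 1)
    rw [ev_eq_dot] at this
    simpa using this
  have h2 : ∀ i j, D i j = - D j i := by
    intro i j
    have := h (Pi.single i 1 + Pi.single j 1)
    rw [ev_eq_dot] at this
    simp [Matrix.mulVec_add, h1] at this
    linear_combination this
  let U : Matrix (Fin n) (Fin n) F := Matrix.of fun i j => if i < j then D i j else 0
  have hU : D = U - U.transpose := by
    ext i j
    simp only [U, Matrix.sub_apply, Matrix.transpose_apply, Matrix.of_apply]
    rcases lt_trichotomy i j with h | h | h
    · rw [if_pos h, if_neg h.not_gt, sub_zero]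
    · subst h; simp [h1]
    · rw [if_pos h, if_neg h.not_gt, zero_sub, h2]
  have h3 : D.map τ = U.map τ - (U.map τ).transpose := by
    rw [hU]; ext i j; simp
  rw [h3, ev_sub_mat, ev_transpose, sub_self]

theorem ev_map_congr {n : ℕ} {F K : Type} [Field F] [Field K] (τ : F →+* K)
    (a b : Matrix (Fin n) (Fin n) F) (h : ∀ x, ev a x = ev b x) (x : Fin n → K) :
    ev (a.map τ) x = ev (b.map τ) x := by
  have h1 := ev_map_zero τ (a - b) (fun x => by rw [ev_sub_mat, h, sub_self]) x
  have h2 : (a - b).map τ = a.map τ - b.map τ := by ext i j; simp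
  rw [h2, ev_sub_mat, sub_eq_zero] at h1
  exact h1

theorem mulVec_inj_map {m n : ℕ} {F K : Type} [Field F] [Field K] (τ : F →+* K)
    (M : Matrix (Fin n) (Fin m) F) (h : Function.Injective M.mulVec) :
    Function.Injective (M.map τ).mulVec := by
  rw [Matrix.mulVec_injective_iff] at h ⊢
  exact linInd_map τ h

/-- a matrix `M` realises `p` as a restriction of `q` -/
structure Res {m n : ℕ} {F : Type} [Field F] (p : Matrix (Fin m) (Fin m) F)
    (q : Matrix (Fin n) (Fin n) F) (M : Matrix (Fin n) (Fin m) F) : Prop where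
  inj : Function.Injective M.mulVec
  eq : ∀ x, ev q (M.mulVec x) = ev p x

theorem Res.map {m n : ℕ} {F K : Type} [Field F] [Field K] {p : Matrix (Fin m) (Fin m) F}
    {q : Matrix (Fin n) (Fin n) F} {M : Matrix (Fin n) (Fin m) F} (h : Res p q M) (τ : F →+* K) :
    Res (p.map τ) (q.map τ) (M.map τ) := by
  refine ⟨mulVec_inj_map τ M h.inj, fun x => ?_⟩
  rw [ev_mulVec, ← ev_map_congr τ (M.transpose * q * M) p (fun x => by rw [← ev_mulVec, h.eq]) x,
    Matrix.map_mul, Matrix.map_mul, Matrix.transpose_map]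

theorem Res.iso_up {m n : ℕ} {F K : Type} [Field F] [Field K] {p : Matrix (Fin m) (Fin m) F}
    {q : Matrix (Fin n) (Fin n) F} {M : Matrix (Fin n) (Fin m) F} (h : Res p q M) (τ : F →+* K)
    (L : Set (Fin n → F)) (hL : ∀ l ∈ L, Matrix.vecMul l M = 0) {r : ℕ} (h1 : Iso τ p ∅ r) :
    Iso τ q L r := by
  obtain ⟨W, h2, h3⟩ := h1
  refine ⟨W.map (M.map τ).mulVecLin, ?_, ?_⟩
  · rw [← (Submodule.equivMapOfInjective (M.map τ).mulVecLin (h.map τ).inj W).finrank_eq]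
    exact h2
  · rintro _ ⟨x, hx, rfl⟩
    refine ⟨?_, ?_⟩
    · rw [Matrix.mulVecLin_apply, (h.map τ).eq]
      exact (h3 x hx).1
    · intro l hl
      have h4 : Matrix.vecMul (τ ∘ l) (M.map τ) = τ ∘ Matrix.vecMul l M := by
        funext i; exact (RingHom.map_vecMul τ M l i).symm
      rw [Matrix.mulVecLin_apply, Matrix.dotProduct_mulVec, h4, hL l hl]
      simp [dotProduct]

theorem Res.iso_down {m n d : ℕ} {F K : Type} [Field F] [Field K] {p : Matrix (Fin m) (Fin m) F}
    {q : Matrix (Fin n) (Fin n) F} {M : Matrix (Fin n) (Fin m) F} (h : Res p q M) (τ : F →+* K)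
    (hd : m + d = n) {r : ℕ} (h1 : Iso τ q ∅ (r + d)) : Iso τ p ∅ r := by
  obtain ⟨W, h2, h3⟩ := h1
  let f := (M.map τ).mulVecLin
  have hf : Function.Injective f := (h.map τ).inj
  refine ⟨W.comap f, ?_, ?_⟩
  · have h4 := (Submodule.equivMapOfInjective f hf (W.comap f)).finrank_eq.symm
    rw [Submodule.map_comap_eq] at h4
    have h5 := Submodule.finrank_sup_add_finrank_inf_eq (LinearMap.range f) W
    have h6 := LinearMap.finrank_range_of_inj hf
    have h7 := Submodule.finrank_le (LinearMap.range f ⊔ W)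
    simp only [Module.finrank_fin_fun] at h6 h7
    omega
  · intro x hx
    refine ⟨?_, by simp⟩
    rw [← (h.map τ).eq]
    exact (h3 _ hx).1

theorem le_i0 {n : ℕ} {F K : Type} [Field F] [Field K] [Algebra F K] (q : QF F n) (r : ℕ) :
    r ≤ QF.i0 (QF.baseChange q K) ↔ Iso (algebraMap F K) q ∅ r := by
  unfold QF.i0
  set S := {d | ∃ W : Submodule K (Fin n → K), Module.finrank K W = d ∧
    ∀ x ∈ W, QF.eval (QF.baseChange q K) x = 0} with hS
  have hb : BddAbove S := by
    refine ⟨n, ?_⟩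
    rintro _ ⟨W, rfl, -⟩
    simpa using Submodule.finrank_le W
  have hne : S.Nonempty := ⟨0, ⊥, by simp, by
    intro x hx
    rw [Submodule.mem_bot] at hx
    rw [hx]
    exact ev_zero _⟩
  constructor
  · intro h
    obtain ⟨W, h1, h2⟩ := Nat.sSup_mem hne hb
    exact ⟨W, by rw [h1]; exact h, fun x hx => ⟨h2 x hx, by simp⟩⟩
  · rintro ⟨W, h1, h2⟩
    exact h1.trans (le_csSup hb ⟨W, rfl, fun x hx => (h2 x hx).1⟩)

theorem isotropic_iff {n : ℕ} {F K : Type} [Field F] [Field K] [Algebra F K] (q : QF F n) :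
    QF.Isotropic (QF.baseChange q K) ↔ Iso (algebraMap F K) q ∅ 1 := by
  rw [iso_one]
  constructor
  · rintro ⟨x, h0, h⟩; exact ⟨x, h0, h, by simp⟩
  · rintro ⟨x, h0, h, -⟩; exact ⟨x, h0, h⟩

theorem i1_le {n : ℕ} {F K : Type} [Field F] [Field K] [Algebra F K] (q : QF F n)
    (h : Iso (algebraMap F K) q ∅ 1) : QF.i1 q ≤ QF.i0 (QF.baseChange q K) := by
  rw [← le_i0] at h
  exact Nat.sInf_le ⟨h, ⟨K⟩, rfl⟩

theorem i1_attain {n : ℕ} {F : Type} [Field F] (q : QF F n) (h : 0 < QF.i1 q) :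
    ∃ K : QF.FieldExt F, QF.i0 (QF.baseChange q K.carrier) = QF.i1 q := by
  have hne : {i | 0 < i ∧ ∃ K : QF.FieldExt F, QF.i0 (QF.baseChange q K.carrier) = i}.Nonempty := by
    by_contra hc
    rw [Set.not_nonempty_iff_eq_empty] at hc
    unfold QF.i1 at h
    rw [hc] at h
    simp at h
  exact (Nat.sInf_mem hne).2

theorem codim1 {m : ℕ} {F : Type} [Field F] (p : QF F m) (q : QF F (m + 1))
    (M : Matrix (Fin (m + 1)) (Fin m) F) (h : Res p q M) (hm : 1 ≤ m)
    (hq : ∀ x, ev q x = 0 → x = 0) (hi : 2 ≤ QF.i1 q) : QF.i1 q = QF.i1 p + 1 := by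
  obtain ⟨l, hl0, hl⟩ : ∃ l : Fin (m + 1) → F, l ≠ 0 ∧ Matrix.vecMul l M = 0 := by
    have h1 : LinearMap.ker M.vecMulLinear ≠ ⊥ :=
      LinearMap.ker_ne_bot_of_finrank_lt (by simp)
    obtain ⟨l, hl, hl0⟩ := Submodule.exists_mem_ne_zero_of_ne_bot h1
    exact ⟨l, hl0, hl⟩
  have hlow : ∀ (K : Type) [Field K] [Algebra F K], Iso (algebraMap F K) p ∅ 1 →
      QF.i1 q ≤ QF.i0 (QF.baseChange p K) + 1 := by
    intro K _ _ h1
    have h2 := i1_le q (h.iso_up (algebraMap F K) ∅ (by simp) h1)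
    obtain ⟨r, hr⟩ : ∃ r, QF.i1 q = r + 1 := ⟨QF.i1 q - 1, by omega⟩
    rw [hr, le_i0] at h2
    have h3 := (le_i0 p r).2 (h.iso_down _ rfl h2)
    omega
  obtain ⟨K, hK⟩ := i1_attain q (by omega)
  obtain ⟨E, _, s, ha, hb, hc⟩ := combine (algebraMap F K.carrier) q hq (by omega)
    ((le_i0 q 1).1 (by omega))
  let _ : Algebra F E := s.toAlgebra
  have hs : algebraMap F E = s := rfl
  have h1 : QF.i0 (QF.baseChange q E) ≤ QF.i1 q := by
    rw [← hK, le_i0]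
    exact ha _ ((le_i0 q _).1 le_rfl)
  have h2 : QF.i1 q ≤ QF.i0 (QF.baseChange q E) := i1_le q hc
  have h3 : QF.i0 (QF.baseChange p E) + 1 ≤ QF.i0 (QF.baseChange q E) := by
    rw [le_i0]
    exact hb l hl0 _ (h.iso_up s {l} (by rintro _ rfl; exact hl) ((le_i0 p _).1 le_rfl))
  have h4 : Iso (algebraMap F E) p ∅ 1 := 
    h.iso_down _ rfl ((le_i0 q 2).1 (by omega))
  have h5 := i1_le p h4
  have h6 : 0 < QF.i1 p := by
    have : {i | 0 < i ∧ ∃ K : QF.FieldExt F, QF.i0 (QF.baseChange p K.carrier) = i}.Nonempty :=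
      ⟨_, (le_i0 p 1).2 h4, ⟨E⟩, rfl⟩
    exact (Nat.sInf_mem this).1
  obtain ⟨K', hK'⟩ := i1_attain p h6
  have h7 := hlow K'.carrier ((le_i0 p 1).1 (by omega))
  omega

theorem i1_main {F : Type} [Field F] {n : ℕ} (q : QF F n) (hq : ∀ x, ev q x = 0 → x = 0) :
    ∀ (d m : ℕ) (p : QF F m) (M : Matrix (Fin n) (Fin m) F), Res p q M → 1 ≤ m → m + d = n →
      d < QF.i1 q → QF.i1 q = QF.i1 p + d := by
  intro d
  induction d with
  | zero =>
    intro m p M h hm hd hi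
    have hiff : ∀ (K : Type) [Field K] [Algebra F K],
        QF.i0 (QF.baseChange q K) = QF.i0 (QF.baseChange p K) := by
      intro K _ _
      apply le_antisymm
      · rw [le_i0]
        exact h.iso_down (d := 0) _ hd ((le_i0 q _).1 le_rfl)
      · rw [le_i0]
        exact h.iso_up _ ∅ (by simp) ((le_i0 p _).1 le_rfl)
    unfold QF.i1
    simp only [hiff, add_zero]
  | succ d ih =>
    intro m p M h hm hd hi
    have hli := Matrix.mulVec_injective_iff.1 h.inj
    obtain ⟨w, hw⟩ : ∃ w, w ∉ Submodule.span F (Set.range M.col) := by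
      by_contra hc
      push Not at hc
      have h1 : Submodule.span F (Set.range M.col) = ⊤ := by
        rw [eq_top_iff]; intro x _; exact hc x
      have h2 := finrank_span_eq_card hli
      rw [h1] at h2
      simp at h2
      omega
    have hli' : LinearIndependent F (Fin.snoc M.col w : Fin (m + 1) → Fin n → F) :=
      linearIndependent_finSnoc.2 ⟨hli, hw⟩
    let M' : Matrix (Fin n) (Fin (m + 1)) F :=
      Matrix.of fun i j => (Fin.snoc M.col w : Fin (m + 1) → Fin n → F) j i
    have hM' : Function.Injective M'.mulVec := Matrix.mulVec_injective_iff.2 hli'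
    let N : Matrix (Fin (m + 1)) (Fin m) F := Matrix.of fun i j => if i = j.castSucc then 1 else 0
    have hN : M' * N = M := by
      ext i j
      simp only [Matrix.mul_apply, N, M', Matrix.of_apply, mul_ite, mul_one, mul_zero,
        Finset.sum_ite_eq', Finset.mem_univ, if_true]
      exact congrFun (Fin.snoc_castSucc (α := fun _ => Fin n → F) w M.col j) i
    let p' : QF F (m + 1) := M'.transpose * q * M'
    have hp' : Res p' q M' := ⟨hM', fun x => ev_mulVec _ _ _⟩
    have hp'' : Res p p' N := by
      refine ⟨?_, fun x => ?_⟩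
      · intro x y hxy
        apply h.inj
        rw [← hN, ← Matrix.mulVec_mulVec, ← Matrix.mulVec_mulVec, hxy]
      · rw [← hp'.eq, Matrix.mulVec_mulVec, hN, h.eq]
    have h1 := ih (m + 1) p' M' hp' (by omega) (by omega) (by omega)
    have h2 := codim1 p p' N hp'' hm ?_ (by omega)
    · omega
    · intro x hx
      rw [← hp'.eq] at hx
      apply hM'
      rw [hq _ hx, Matrix.mulVec_zero]

theorem final (F : Type) [Field F] {m n : ℕ}
    (q : QF F n) (p : QF F m) (hn : 2 ≤ n) (hm : 2 ≤ m)
    (hq : QF.Anisotropic q) 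
    (hdom : QF.Dominated p q) (hdim : QF.izh q < m) :
    QF.SBEquiv q p ∧ QF.izh q = QF.izh p := by
  obtain ⟨f, hf, hfe⟩ := hdom
  have hres : Res p q (LinearMap.toMatrix' f) := by
    have h1 : (LinearMap.toMatrix' f).mulVec = f := by
      funext x; exact LinearMap.toMatrix'_mulVec f x
    exact ⟨by rw [h1]; exact hf, fun x => by rw [h1]; exact hfe x⟩
  have hmn : m ≤ n := by
    have := LinearMap.finrank_le_finrank_of_injective hf
    simpa using this
  obtain ⟨d, hd⟩ : ∃ d, m + d = n := ⟨n - m, by omega⟩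
  unfold QF.izh at hdim ⊢
  have hi : d < QF.i1 q := by omega
  refine ⟨?_, ?_⟩
  · intro K _ _
    rw [isotropic_iff, isotropic_iff]
    constructor
    · intro h
      have h1 := i1_le q h
      exact hres.iso_down _ hd ((le_i0 q _).1 (by omega))
    · intro h
      exact hres.iso_up _ ∅ (by simp) h
  · have := i1_main q hq d m p _ hres (by omega) hd hi
    omega

end assembly
end S3


/-- Lemma 2.11: let `φ`, `ψ` be anisotropic quadratic forms of dimension
`≥ 2` over a field `F` of characteristic 2 with `ψ ≺ φ`.  If `dim ψ > dim_Izh(φ)`, then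
`φ` and `ψ` are stably birationally equivalent; in particular `dim_Izh(φ) = dim_Izh(ψ)`. -/
theorem statement3 (F : Type) [Field F] [CharP F 2] {m n : ℕ}
    (q : QF F n) (p : QF F m) (hn : 2 ≤ n) (hm : 2 ≤ m)
    (hq : QF.Anisotropic q) (hp : QF.Anisotropic p)
    (hdom : QF.Dominated p q) (hdim : QF.izh q < m) :
    QF.SBEquiv q p ∧ QF.izh q = QF.izh p := by
  exact S3.final F q p hn hm hq hdom hdim
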